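/- Suppose r ≥ 2 and the columns of z generate ℤ^r (effective action). Let 𝒮 ⊆ X_z be the rational singular set: the image under the quotient map of the set of points x ∈ S^{2n−1} whose stabilizer {t ∈ T^r : t • x = x} is infinite, equipped with the subspace topology. Then each reduced singular homology group H̃_i(𝒮; ℤ) is a finitely generated free abelian group, and Σ_i rk H̃_i(𝒮; ℤ) t^i = t^{r−2} · ( Σ_{A ⊆ Fin n, rk(A) = r} (t² − 1)^{|A| − r} − Σ_{A ⊆ Fin n} (−1)^{r − rk(A)} (t² − 1)^{|A| − rk(A)} ), i.e. equals t^{r−2}[T(M_z; 1, t²) − T(M_z; 0, t²)] where T is the Tutte polynomial of the column matroid M_z of z written via its corank–nullity expansion. -/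

import Mathlib

open scoped BigOperators

noncomputable section

/-- The sphere `S^{2n-1}`, realized as the unit sphere of `ℂ^n`. -/
abbrev Sph (n : ℕ) : Type := Metric.sphere (0 : EuclideanSpace ℂ (Fin n)) 1

/-- The element of the circle by which `t ∈ T^r = (Fin r → Circle)` acts on the `j`-th
coordinate of `ℂ^n`, namely `∏ i, (t i) ^ (z i j)`. -/
def weightProd {n r : ℕ} (z : Fin r → Fin n → ℤ) (t : Fin r → Circle) (j : Fin n) : Circle :=
  ∏ i, t i ^ z i j

/-- The orbit equivalence relation on `S^{2n-1}` for the linear torus action with weight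
matrix `z`:  `x ≈ y` iff some `t ∈ T^r` moves `x` to `y`, where `(t • x) j = (∏ i, (t i)^(z i j)) • (x j)`. -/
def orbitSetoid {n r : ℕ} (z : Fin r → Fin n → ℤ) : Setoid (Sph n) where
  r x y := ∃ t : Fin r → Circle,
    ∀ j, (weightProd z t j : ℂ) * (x : EuclideanSpace ℂ (Fin n)) j
      = (y : EuclideanSpace ℂ (Fin n)) j
  iseqv := by
    constructor
    · intro x
      exact ⟨1, fun j => by simp [weightProd]⟩
    · rintro x y ⟨t, ht⟩
      refine ⟨fun i => (t i)⁻¹, fun j => ?_⟩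
      have h : weightProd z (fun i => (t i)⁻¹) j = (weightProd z t j)⁻¹ := by
        simp only [weightProd, inv_zpow]
        exact Finset.prod_inv_distrib _
      rw [h, ← ht j, Circle.coe_inv, inv_mul_cancel_left₀ (Circle.coe_ne_zero _)]
    · rintro x y zz ⟨t, ht⟩ ⟨s, hs⟩
      refine ⟨t * s, fun j => ?_⟩
      have h : weightProd z (t * s) j = weightProd z t j * weightProd z s j := by
        simp [weightProd, mul_zpow, Finset.prod_mul_distrib]
      rw [h, ← hs j, ← ht j]
      push_cast
      ring

/-- The orbit space `X_z = S^{2n-1}/T^r` of the linear torus action with weight matrix `z`,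
equipped with the quotient topology. -/
abbrev OrbitSpace {n r : ℕ} (z : Fin r → Fin n → ℤ) : Type := Quotient (orbitSetoid z)

open CategoryTheory AlgebraicTopology

/-- The singular chain complex functor with integer coefficients: the composition of the
singular simplicial set functor, the free abelian group functor applied levelwise, and the
alternating face map complex. -/
def singularChainComplexFunctor : TopCat.{0} ⥤ ChainComplex AddCommGrpCat ℕ :=
  TopCat.toSSet ⋙ ((SimplicialObject.whiskering _ _).obj AddCommGrpCat.free) ⋙
    alternatingFaceMapComplex AddCommGrpCat

/-- The `i`-th singular homology functor with integer coefficients. -/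
def singularHomologyFunctor (i : ℕ) : TopCat.{0} ⥤ AddCommGrpCat :=
  singularChainComplexFunctor ⋙ HomologicalComplex.homologyFunctor _ _ i

/-- `H_i(X; ℤ)`, the `i`-th singular homology group of `X` with integer coefficients. -/
abbrev SingularHomology (X : Type) [TopologicalSpace X] (i : ℕ) : Type :=
  (singularHomologyFunctor i).obj (TopCat.of X)

/-- The `i`-th reduced singular homology group `H̃_i(X; ℤ)`, realized as the kernel of the
map induced on `H_i` by the constant map from `X` to a one-point space. -/
def ReducedHomology (X : Type) [TopologicalSpace X] (i : ℕ) :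
    AddSubgroup (SingularHomology X i) :=
  AddMonoidHom.ker ((singularHomologyFunctor i).map
    (TopCat.ofHom (ContinuousMap.const X PUnit.unit) : TopCat.of X ⟶ TopCat.of PUnit)).hom

/-- `colRank z A` is the ℚ-dimension of the span in `Fin r → ℚ` of the columns of `z`
indexed by `A`. -/
def colRank {n r : ℕ} (z : Fin r → Fin n → ℤ) (A : Set (Fin n)) : ℕ :=
  Module.finrank ℚ (Submodule.span ℚ ((fun j => fun i => (z i j : ℚ)) '' A))

/-- The stabilizer `{t ∈ T^r : t • x = x}` of a point `x ∈ S^{2n-1}` under the linear torus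
action with weight matrix `z`. -/
def torusStab {n r : ℕ} (z : Fin r → Fin n → ℤ) (x : Sph n) : Set (Fin r → Circle) :=
  {t | ∀ j, (weightProd z t j : ℂ) * (x : EuclideanSpace ℂ (Fin n)) j
    = (x : EuclideanSpace ℂ (Fin n)) j}

/-- The rational singular set of the action: the image in the orbit space of the points of
the sphere whose stabilizer is infinite. -/
def singSet {n r : ℕ} (z : Fin r → Fin n → ℤ) : Set (OrbitSpace z) :=
  (Quotient.mk (orbitSetoid z)) '' {x : Sph n | (torusStab z x).Infinite}

namespace SSH

section Alt
variable {R A : Type*} [CommRing R] [AddCommGroup A] [Module R A]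

lemma alt_sum {k : ℕ} (F : Fin (k+1) → Fin (k+2) → A)
    (hF : ∀ i j : Fin (k+1), j ≤ i → F i j.castSucc = F j i.succ) :
    ∑ i : Fin (k+1), ∑ j : Fin (k+2), ((-1 : R)^(i:ℕ) * (-1 : R)^(j:ℕ)) • F i j = 0 := by
  rw [← Finset.sum_product']
  let P := Fin (k + 1) × Fin (k + 2)
  let S : Finset P := {ij : P | (ij.2 : ℕ) ≤ (ij.1 : ℕ)}
  rw [Finset.univ_product_univ, ← Finset.sum_add_sum_compl S, ← eq_neg_iff_add_eq_zero,
    ← Finset.sum_neg_distrib]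
  let φ : ∀ ij : P, ij ∈ S → P := fun ij hij =>
    (Fin.castLT ij.2 (lt_of_le_of_lt (Finset.mem_filter.mp hij).right (Fin.is_lt ij.1)), ij.1.succ)
  apply Finset.sum_bij φ
  · intro ij hij
    simp_rw [S, φ, Finset.compl_filter, Finset.mem_filter_univ, Fin.val_succ,
      Fin.val_castLT] at hij ⊢
    lia
  · rintro ⟨i, j⟩ hij ⟨i', j'⟩ hij' h
    rw [Prod.mk_inj]
    exact ⟨by simpa [φ] using! congr_arg Prod.snd h,
      by simpa [φ, Fin.castSucc_castLT] using! congr_arg Fin.castSucc (congr_arg Prod.fst h)⟩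
  · rintro ⟨i', j'⟩ hij'
    simp_rw [S, Finset.compl_filter, Finset.mem_filter_univ, not_le] at hij'
    refine ⟨(j'.pred <| ?_, Fin.castSucc i'), ?_, ?_⟩
    · rintro rfl
      simp only [Fin.val_zero, not_lt_zero] at hij'
    · simpa [S] using! Nat.le_sub_one_of_lt hij'
    · simp only [φ, Fin.castLT_castSucc, Fin.succ_pred]
  · rintro ⟨i, j⟩ hij
    simp_rw [S, Finset.mem_filter_univ] at hij
    have := hF i (Fin.castLT j (lt_of_le_of_lt hij i.2)) hij
    rw [Fin.castSucc_castLT] at this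
    dsimp only [φ]
    rw [this, ← neg_smul]
    congr 1
    simp only [Fin.val_succ, pow_succ, Fin.val_castLT]
    ring

lemma succAbove_comm {k : ℕ} (i j : Fin (k+1)) (h : j ≤ i) (x : Fin k) :
    j.castSucc.succAbove (i.succAbove x) = i.succ.succAbove (j.succAbove x) := by
  simp only [Fin.succAbove, Fin.lt_def, Fin.le_def] at *
  ext
  split_ifs <;> simp at * <;> omega
end Alt

/-- topological simplices -/
abbrev Δ (k : ℕ) : Type := stdSimplex ℝ (Fin k)

def smap {k m : ℕ} (f : Fin k → Fin m) : C(Δ k, Δ m) :=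
  ⟨stdSimplex.map f, stdSimplex.continuous_map f⟩

lemma smap_comp {k m l : ℕ} (f : Fin k → Fin m) (g : Fin m → Fin l) :
    (smap g).comp (smap f) = smap (g ∘ f) := by
  ext1 x; exact stdSimplex.map_comp_apply f g x

section Ch
variable (R : Type) [CommRing R] {X Y Z : Type} [TopologicalSpace X] [TopologicalSpace Y]
  [TopologicalSpace Z]

/-- augmented singular chains -/
abbrev Ch (R : Type) [CommRing R] (X : Type) [TopologicalSpace X] (k : ℕ) : Type := C(Δ k, X) →₀ R

/-- face -/
def fc {k : ℕ} (i : Fin (k+1)) (σ : C(Δ (k+1), X)) : C(Δ k, X) := σ.comp (smap i.succAbove)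

variable (X) in
def dC (k : ℕ) : Ch R X (k+1) →ₗ[R] Ch R X k :=
  ∑ i : Fin (k+1), ((-1 : R)^(i:ℕ)) • Finsupp.lmapDomain R R (fc i)

lemma dC_single {k : ℕ} (σ : C(Δ (k+1), X)) (a : R) :
    dC R X k (Finsupp.single σ a) = ∑ i : Fin (k+1), ((-1 : R)^(i:ℕ)) • Finsupp.single (fc i σ) a := by
  simp [dC, Finsupp.mapDomain_single]

lemma dC_dC (k : ℕ) : dC R X k ∘ₗ dC R X (k+1) = 0 := by
  ext σ : 2
  simp only [LinearMap.comp_apply, Finsupp.lsingle_apply, dC_single, map_sum, map_smul,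
    LinearMap.zero_apply]
  rw [← alt_sum (R := R) (fun i j => Finsupp.single (fc i (fc j σ)) (1:R))]
  · rw [Finset.sum_comm]
    simp only [Finset.smul_sum, smul_smul]
    refine Finset.sum_congr rfl fun i _ => Finset.sum_congr rfl fun j _ => by rw [mul_comm]
  · intro i j h
    congr 1
    simp only [fc, ContinuousMap.comp_assoc, smap_comp]
    congr 2
    funext x
    exact succAbove_comm i j h x

def mC (f : C(X, Y)) (k : ℕ) : Ch R X k →ₗ[R] Ch R Y k :=
  Finsupp.lmapDomain R R (fun σ => f.comp σ)

lemma mC_single (f : C(X, Y)) {k : ℕ} (σ : C(Δ k, X)) (a : R) :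
    mC R f k (Finsupp.single σ a) = Finsupp.single (f.comp σ) a := by
  simp [mC, Finsupp.mapDomain_single]

lemma mC_dC (f : C(X, Y)) (k : ℕ) : mC R f k ∘ₗ dC R X k = dC R Y k ∘ₗ mC R f (k+1) := by
  ext σ : 2
  simp only [LinearMap.comp_apply, Finsupp.lsingle_apply, dC_single, map_sum, map_smul, mC_single]
  rfl

lemma mC_comp (f : C(X, Y)) (g : C(Y, Z)) (k : ℕ) : mC R (g.comp f) k = mC R g k ∘ₗ mC R f k := by
  ext σ : 2
  simp [mC_single, ContinuousMap.comp_assoc]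

lemma mC_id (k : ℕ) : mC R (ContinuousMap.id X) k = LinearMap.id := by
  ext σ : 2
  simp [mC_single]

end Ch

section Lin

/-- vertex spaces -/
abbrev TT (k : ℕ) : Type := Δ k × unitInterval

def linS {k m : ℕ} (w : Fin m → Δ k) (t : Δ m) : Δ k :=
  ⟨∑ j, t j • (w j : Fin k → ℝ), (convex_stdSimplex ℝ (Fin k)).sum_mem (fun j _ => t.2.1 j) t.2.2
    (fun j _ => (w j).2)⟩

def linI {m : ℕ} (w : Fin m → unitInterval) (t : Δ m) : unitInterval :=
  ⟨∑ j, t j • (w j : ℝ), (convex_Icc (0:ℝ) 1).sum_mem (fun j _ => t.2.1 j) t.2.2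
    (fun j _ => (w j).2)⟩

lemma cont_coord {m : ℕ} (j : Fin m) : Continuous (fun t : Δ m => t j) :=
  (continuous_apply j).comp continuous_subtype_val

def lin {k m : ℕ} (w : Fin m → TT k) : C(Δ m, TT k) where
  toFun t := (linS (fun j => (w j).1) t, linI (fun j => (w j).2) t)
  continuous_toFun := by
    refine Continuous.prodMk (Continuous.subtype_mk ?_ _) (Continuous.subtype_mk ?_ _)
    · exact continuous_finsetSum _ fun j _ => (cont_coord j).smul continuous_const
    · exact continuous_finsetSum _ fun j _ => (cont_coord j).smul continuous_const

lemma smap_sum {m m' : ℕ} {V : Type*} [AddCommGroup V] [Module ℝ V] (f : Fin m → Fin m')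
    (w : Fin m' → V) (t : Δ m) : ∑ j, (smap f t) j • w j = ∑ j, t j • w (f j) := by
  have h : ∀ j, (smap f t) j = ∑ i with f i = j, t i := fun j => by
    exact FunOnFinite.linearMap_apply_apply ..
  simp only [h, Finset.sum_smul]
  rw [← Finset.sum_fiberwise (s := Finset.univ) (g := f)]
  refine Finset.sum_congr rfl fun j _ => Finset.sum_congr rfl fun i hi => ?_
  rw [(Finset.mem_filter.mp hi).2]

lemma lin_comp {k m m' : ℕ} (f : Fin m → Fin m') (w : Fin m' → TT k) :
    (lin w).comp (smap f) = lin (w ∘ f) := by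
  ext1 t
  refine Prod.ext (Subtype.ext ?_) (Subtype.ext ?_)
  · exact smap_sum f (fun j => ((w j).1 : Fin k → ℝ)) t
  · exact smap_sum f (fun j => ((w j).2 : ℝ)) t

def tmap {k m : ℕ} (f : Fin k → Fin m) : C(TT k, TT m) := (smap f).prodMap (ContinuousMap.id _)

lemma tmap_lin {k k' m : ℕ} (f : Fin k → Fin k') (w : Fin m → TT k) :
    (tmap f).comp (lin w) = lin (tmap f ∘ w) := by
  ext1 t
  refine Prod.ext (Subtype.ext ?_) rfl
  change FunOnFinite.linearMap ℝ ℝ f (∑ j, t j • ((w j).1 : Fin k → ℝ)) = ∑ j, t j • (FunOnFinite.linearMap ℝ ℝ f ((w j).1 : Fin k → ℝ))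
  simp only [map_sum, map_smul]

def vtx (k : ℕ) (e : unitInterval) (j : Fin k) : TT k := (stdSimplex.vertex j, e)

lemma lin_vtx (k : ℕ) (e : unitInterval) (t : Δ k) : lin (vtx k e) t = (t, e) := by
  refine Prod.ext (Subtype.ext ?_) (Subtype.ext ?_)
  · change ∑ j, t j • (stdSimplex.vertex j : Fin k → ℝ) = t
    ext i
    simp [Finset.sum_apply, Pi.single_apply]
  · change ∑ j, t j • (e : ℝ) = e
    rw [← Finset.sum_smul, stdSimplex.sum_eq_one, one_smul]

lemma tmap_vtx {k : ℕ} (i : Fin (k+1)) (e : unitInterval) :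
    tmap i.succAbove ∘ vtx k e = vtx (k+1) e ∘ i.succAbove := by
  funext j
  exact Prod.ext (stdSimplex.map_vertex _ _) rfl

variable (R : Type) [CommRing R]

abbrev LC (T : Type) (m : ℕ) : Type := (Fin m → T) →₀ R

def dL (T : Type) (m : ℕ) : LC R T (m+1) →ₗ[R] LC R T m :=
  ∑ i : Fin (m+1), ((-1 : R)^(i:ℕ)) • Finsupp.lmapDomain R R (fun w => w ∘ i.succAbove)

def cn {T : Type} (b : T) (m : ℕ) : LC R T m →ₗ[R] LC R T (m+1) :=
  Finsupp.lmapDomain R R (fun w => (Fin.cons b w : Fin (m+1) → T))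

def dH (k m : ℕ) : LC R (TT k) m →ₗ[R] LC R (TT (k+1)) m :=
  ∑ i : Fin (k+1), ((-1 : R)^(i:ℕ)) • Finsupp.lmapDomain R R (fun w => tmap i.succAbove ∘ w)

variable {R}
lemma dL_single {T : Type} {m : ℕ} (w : Fin (m+1) → T) (a : R) :
    dL R T m (Finsupp.single w a) = ∑ i : Fin (m+1), ((-1 : R)^(i:ℕ)) • Finsupp.single (w ∘ i.succAbove) a := by
  simp [dL, Finsupp.mapDomain_single]
lemma dH_single {k m : ℕ} (w : Fin m → TT k) (a : R) :
    dH R k m (Finsupp.single w a) = ∑ i : Fin (k+1), ((-1 : R)^(i:ℕ)) • Finsupp.single (tmap i.succAbove ∘ w) a := by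
  simp [dH, Finsupp.mapDomain_single]
lemma cn_single {T : Type} (b : T) {m : ℕ} (w : Fin m → T) (a : R) :
    cn R b m (Finsupp.single w a) = Finsupp.single (Fin.cons b w : Fin (m+1) → T) a := by
  simp [cn, Finsupp.mapDomain_single]

lemma dL_cn {T : Type} (b : T) (m : ℕ) (x : LC R T (m+1)) :
    dL R T (m+1) (cn R b (m+1) x) = x - cn R b m (dL R T m x) := by
  induction x using Finsupp.induction_linear with
  | zero => simp
  | add f g hf hg => simp only [map_add, hf, hg]; abel
  | single w a =>
    rw [cn_single, dL_single, dL_single, Fin.sum_univ_succ, map_sum, sub_eq_add_neg, ← Finset.sum_neg_distrib]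
    congr 1
    · simp
    · refine Finset.sum_congr rfl fun i _ => ?_
      rw [map_smul, cn_single, ← neg_smul]
      congr 1
      · simp [pow_succ]
      · congr 1
        funext j
        refine Fin.cases ?_ (fun j => ?_) j <;> simp

lemma dL_cn_zero {T : Type} (b : T) (x : LC R T 0) :
    dL R T 0 (cn R b 0 x) = x := by
  induction x using Finsupp.induction_linear with
  | zero => simp
  | add f g hf hg => simp only [map_add, hf, hg]
  | single w a =>
    rw [cn_single, dL_single]
    simp

lemma dL_dH (k m : ℕ) (x : LC R (TT k) (m+1)) :
    dL R (TT (k+1)) m (dH R k (m+1) x) = dH R k m (dL R (TT k) m x) := by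
  induction x using Finsupp.induction_linear with
  | zero => simp
  | add f g hf hg => simp only [map_add, hf, hg]
  | single w a =>
    simp only [dL_single, dH_single, map_sum, map_smul, Finset.smul_sum]
    rw [Finset.sum_comm]
    refine Finset.sum_congr rfl fun i _ => Finset.sum_congr rfl fun j _ => ?_
    rw [smul_comm]; rfl

lemma tmap_comp {k m l : ℕ} (f : Fin k → Fin m) (g : Fin m → Fin l) (x : TT k) :
    (tmap g) (tmap f x) = tmap (g ∘ f) x := by
  refine Prod.ext ?_ rfl
  exact stdSimplex.map_comp_apply f g _

lemma dH_dH (k m : ℕ) (x : LC R (TT k) m) : dH R (k+1) m (dH R k m x) = 0 := by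
  induction x using Finsupp.induction_linear with
  | zero => simp
  | add f g hf hg => simp only [map_add, hf, hg, add_zero]
  | single w a =>
    simp only [dH_single, map_sum, map_smul, Finset.smul_sum, smul_smul]
    refine alt_sum (R := R) (fun i j => Finsupp.single (tmap j.succAbove ∘ tmap i.succAbove ∘ w) a) ?_
    intro i j h
    congr 1
    funext x
    simp only [Function.comp, tmap_comp]
    congr 2
    funext y
    exact succAbove_comm i j h y

end Lin
end SSH

namespace SSH
variable {R : Type} [CommRing R] {X Y : Type} [TopologicalSpace X] [TopologicalSpace Y]

def opS {k m : ℕ} (σ : C(Δ k, X)) (w : Fin m → TT k) : C(Δ m, X × unitInterval) :=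
  (σ.prodMap (ContinuousMap.id _)).comp (lin w)

variable (X) in
def op {k m : ℕ} (l : LC R (TT k) m) : Ch R X k →ₗ[R] Ch R (X × unitInterval) m :=
  Finsupp.linearCombination R (fun σ => Finsupp.lmapDomain R R (opS σ) l)

lemma op_single {k m : ℕ} (l : LC R (TT k) m) (σ : C(Δ k, X)) :
    op X l (Finsupp.single σ 1) = Finsupp.lmapDomain R R (opS σ) l := by
  simp [op]

lemma op_add {k m : ℕ} (l l' : LC R (TT k) m) : op X (l + l') = op X l + op X l' := by
  ext σ : 2
  simp only [LinearMap.comp_apply, Finsupp.lsingle_apply, op_single, map_add, LinearMap.add_apply]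

lemma op_sub {k m : ℕ} (l l' : LC R (TT k) m) : op X (l - l') = op X l - op X l' := by
  ext σ : 2
  simp only [LinearMap.comp_apply, Finsupp.lsingle_apply, op_single, map_sub, LinearMap.sub_apply]

lemma op_zero {k m : ℕ} : op X (0 : LC R (TT k) m) = 0 := by
  ext σ : 2
  simp only [LinearMap.comp_apply, Finsupp.lsingle_apply, op_single, map_zero, LinearMap.zero_apply]

lemma dC_op {k m : ℕ} (l : LC R (TT k) (m+1)) (x : Ch R X k) :
    dC R _ m (op X l x) = op X (dL R _ m l) x := by
  suffices dC R _ m ∘ₗ (op X l) = op X (dL R _ m l) from LinearMap.congr_fun this x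
  ext σ : 2
  simp only [LinearMap.comp_apply, Finsupp.lsingle_apply, op_single]
  induction l using Finsupp.induction_linear with
  | zero => simp
  | add f g hf hg => simp only [map_add, hf, hg]
  | single w a =>
    rw [dL_single, map_sum]
    simp only [Finsupp.lmapDomain_apply, Finsupp.mapDomain_single, dC_single]
    refine Finset.sum_congr rfl fun i _ => ?_
    rw [Finsupp.mapDomain_smul, Finsupp.mapDomain_single]
    congr 2
    simp only [fc, opS, ContinuousMap.comp_assoc, lin_comp]

lemma op_dH {k m : ℕ} (l : LC R (TT k) m) (x : Ch R X (k+1)) :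
    op X (dH R k m l) x = op X l (dC R X k x) := by
  suffices op X (dH R k m l) = op X l ∘ₗ dC R X k from LinearMap.congr_fun this x
  ext σ : 2
  simp only [LinearMap.comp_apply, Finsupp.lsingle_apply, op_single, dC_single, map_sum, map_smul]
  simp only [dH, LinearMap.sum_apply, map_sum, LinearMap.smul_apply, map_smul]
  refine Finset.sum_congr rfl fun i _ => ?_
  congr 1
  simp only [Finsupp.lmapDomain_apply, ← Finsupp.mapDomain_comp]
  congr 1
  funext w
  simp only [Function.comp, opS]
  erw [← tmap_lin i.succAbove w]; rfl

lemma mC_op {k m : ℕ} (f : C(X, Y)) (l : LC R (TT k) m) (x : Ch R X k) :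
    mC R (f.prodMap (ContinuousMap.id _)) m (op X l x) = op Y l (mC R f k x) := by
  suffices mC R (f.prodMap (ContinuousMap.id _)) m ∘ₗ (op X l) = op Y l ∘ₗ (mC R f k) from
    LinearMap.congr_fun this x
  ext σ : 2
  simp only [LinearMap.comp_apply, Finsupp.lsingle_apply, op_single, mC_single]
  simp only [mC, Finsupp.lmapDomain_apply, ← Finsupp.mapDomain_comp]
  rfl

/-- base point -/
def bp (k : ℕ) : TT (k+1) := (stdSimplex.barycenter, 0)

def DD (φ : ∀ k, LC R (TT k) k) : ∀ k, LC R (TT k) (k+1)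
  | 0 => 0
  | k+1 => cn R (bp k) (k+1) (φ (k+1) - dH R k (k+1) (DD φ k))

lemma dL_DD (φ : ∀ k, LC R (TT k) k) (h0 : φ 0 = 0) (h : ∀ k, dL R _ k (φ (k+1)) = dH R k k (φ k))
    (k : ℕ) : dL R _ (k+1) (DD φ (k+1)) = φ (k+1) - dH R k (k+1) (DD φ k) := by
  rw [DD, dL_cn, sub_eq_self]
  suffices dL R _ k (φ (k+1) - dH R k (k+1) (DD φ k)) = 0 by rw [this, map_zero]
  rw [map_sub, h, dL_dH]
  cases k with
  | zero => simp [h0, DD]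
  | succ k => rw [dL_DD φ h0 h k, map_sub, dH_dH]; simp

lemma dC_opDD (φ : ∀ k, LC R (TT k) k) (h0 : φ 0 = 0) (h : ∀ k, dL R _ k (φ (k+1)) = dH R k k (φ k))
    (k : ℕ) (x : Ch R X (k+1)) : dC R _ (k+1) (op X (DD φ (k+1)) x) + op X (DD φ k) (dC R X k x)
     = op X (φ (k+1)) x := by
  rw [dC_op, dL_DD φ h0 h, op_sub, LinearMap.sub_apply, op_dH, sub_add_cancel]

/-- prism -/
def vt (R : Type) [CommRing R] (e : unitInterval) (k : ℕ) : LC R (TT k) k := Finsupp.single (vtx k e) 1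

lemma dL_vt (e : unitInterval) (k : ℕ) : dL R _ k (vt R e (k+1)) = dH R k k (vt R e k) := by
  simp only [vt, dL_single, dH_single, tmap_vtx]

lemma op_vt (e : unitInterval) (k : ℕ) : op X (vt R e k) = mC R ((ContinuousMap.id X).prodMk (ContinuousMap.const X e)) k := by
  ext σ : 2
  simp only [LinearMap.comp_apply, Finsupp.lsingle_apply, op_single, mC_single, vt,
    Finsupp.lmapDomain_apply, Finsupp.mapDomain_single]
  congr 1
  ext1 t
  simp [opS, lin_vtx]

lemma vt_zero (e e' : unitInterval) : vt R e 0 = vt R e' 0 := by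
  simp only [vt]; congr 1; exact Subsingleton.elim _ _

/-- chain homotopy between two families of maps -/
def Hty {X Y : Type} [TopologicalSpace X] [TopologicalSpace Y] (f g : ∀ k, Ch R X k →ₗ[R] Ch R Y k) : Prop :=
  f 0 = g 0 ∧ ∃ D : ∀ k, Ch R X k →ₗ[R] Ch R Y (k+1), 
    ∀ k x, f (k+1) x - g (k+1) x = dC R Y (k+1) (D (k+1) x) + D k (dC R X k x)

lemma Hty.of_homotopic {f g : C(X, Y)} (h : f.Homotopic g) : Hty (mC R f) (mC R g) := by
  obtain ⟨F⟩ := h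
  obtain ⟨G, hG⟩ : ∃ G : C(X × unitInterval, Y), ∀ x s, G (x, s) = F (s, x) :=
    ⟨F.toContinuousMap.comp ContinuousMap.prodSwap, fun _ _ => rfl⟩
  have hf : g = G.comp ((ContinuousMap.id X).prodMk (ContinuousMap.const X 1)) := by
    ext1 x; exact ((hG x 1).trans (F.apply_one x)).symm
  have hg : f = G.comp ((ContinuousMap.id X).prodMk (ContinuousMap.const X 0)) := by
    ext1 x; exact ((hG x 0).trans (F.apply_zero x)).symm
  let φ : ∀ k, LC R (TT k) k := fun k => vt R 0 k - vt R 1 k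
  have h0 : φ 0 = 0 := by simp only [φ]; rw [vt_zero 0 1, sub_self]
  have h1 : ∀ k, dL R _ k (φ (k+1)) = dH R k k (φ k) := fun k => by
    simp only [φ, map_sub, dL_vt]
  refine ⟨?_, fun k => mC R G (k+1) ∘ₗ op X (DD φ k), fun k x => ?_⟩
  · rw [hf, hg, mC_comp, mC_comp, ← op_vt, ← op_vt, vt_zero 0 1]
  · have := congrArg (mC R G (k+1)) (dC_opDD (X := X) φ h0 h1 k x)
    simp only [map_add] at this
    have e := LinearMap.congr_fun (mC_dC R G (k+1)) (op X (DD φ (k+1)) x)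
    simp only [LinearMap.comp_apply] at e ⊢
    rw [← e, this, hf, hg, mC_comp, mC_comp, ← op_vt, ← op_vt]
    simp only [φ, op_sub, LinearMap.sub_apply, map_sub, LinearMap.comp_apply]

/-- subdivision -/
def sdL (R : Type) [CommRing R] : ∀ k, LC R (TT k) k
  | 0 => vt R 0 0
  | k+1 => cn R (bp k) k (dH R k k (sdL R k))

lemma dL_sdL (k : ℕ) : dL R _ k (sdL R (k+1)) = dH R k k (sdL R k) := by
  cases k with
  | zero => exact dL_cn_zero _ _
  | succ k => 
    rw [sdL, dL_cn, dL_dH, dL_sdL k, dH_dH, map_zero, sub_zero]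

variable (R X) in
def sd (k : ℕ) : Ch R X k →ₗ[R] Ch R X k := mC R ContinuousMap.fst k ∘ₗ op X (sdL R k)

variable (R X) in
def sdT (k : ℕ) : Ch R X k →ₗ[R] Ch R X (k+1) :=
  mC R ContinuousMap.fst (k+1) ∘ₗ op X (DD (fun k => vt R 0 k - sdL R k) k)

lemma mC_fst_vt (k : ℕ) (x : Ch R X k) : mC R ContinuousMap.fst k (op X (vt R 0 k) x) = x := by
  rw [op_vt, ← LinearMap.comp_apply, ← mC_comp]
  exact LinearMap.congr_fun (mC_id R k) x

lemma sd_zero (x : Ch R X 0) : sd R X 0 x = x := mC_fst_vt 0 x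

lemma sdT_spec (k : ℕ) (x : Ch R X (k+1)) :
    dC R X (k+1) (sdT R X (k+1) x) + sdT R X k (dC R X k x) = x - sd R X (k+1) x := by
  have := congrArg (mC R ContinuousMap.fst (k+1)) (dC_opDD (X := X) (fun k => vt R 0 k - sdL R k)
    (by simp [sdL]) (fun k => by simp only [map_sub, dL_vt, dL_sdL]) k x)
  simp only [map_add] at this
  have e := LinearMap.congr_fun (mC_dC R (ContinuousMap.fst : C(X × unitInterval, X)) (k+1)) (op X (DD (fun k => vt R 0 k - sdL R k) (k+1)) x)
  simp only [LinearMap.comp_apply] at e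
  simp only [sdT, LinearMap.comp_apply]
  rw [← e, this, op_sub, LinearMap.sub_apply, map_sub, mC_fst_vt]; rfl

lemma sd_dC (k : ℕ) (x : Ch R X (k+1)) : dC R X k (sd R X (k+1) x) = sd R X k (dC R X k x) := by
  have e := LinearMap.congr_fun (mC_dC R (ContinuousMap.fst : C(X × unitInterval, X)) (k)) (op X (sdL R (k+1)) x)
  simp only [LinearMap.comp_apply] at e
  simp only [sd, LinearMap.comp_apply]
  rw [← e, dC_op, dL_sdL, op_dH]

end SSH

namespace SSH
variable {R : Type} [CommRing R] {X Y : Type} [TopologicalSpace X] [TopologicalSpace Y]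

/-- linear singular simplex in a simplex -/
def linD {k m : ℕ} (v : Fin m → Δ k) : C(Δ m, Δ k) := ContinuousMap.fst.comp (lin (fun j => (v j, 0)))

lemma linD_apply {k m : ℕ} (v : Fin m → Δ k) (t : Δ m) :
    ((linD v t : Δ k) : Fin k → ℝ) = ∑ j, t j • (v j : Fin k → ℝ) := rfl

lemma fst_lin {k m : ℕ} (w : Fin m → TT k) : ContinuousMap.fst.comp (lin w) = linD (fun j => (w j).1) := rfl

lemma linD_linD {k m l : ℕ} (v : Fin m → Δ k) (w : Fin l → Δ m) :
    (linD v).comp (linD w) = linD (fun j => linD v (w j)) := by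
  ext1 t
  apply stdSimplex.ext
  rw [ContinuousMap.comp_apply, linD_apply, linD_apply]
  simp only [linD_apply, Finset.sum_apply, Pi.smul_apply, smul_eq_mul, Finset.smul_sum, Finset.sum_smul]
  rw [Finset.sum_comm]
  simp only [smul_smul]

lemma linD_vertex {k : ℕ} : linD (fun j : Fin k => (stdSimplex.vertex j : Δ k)) = ContinuousMap.id _ := by
  ext1 t
  exact congrArg Prod.fst (lin_vtx k 0 t)

lemma sd_single {k : ℕ} (σ : C(Δ k, X)) :
    sd R X k (Finsupp.single σ 1) = Finsupp.lmapDomain R R (fun w => σ.comp (linD fun j => (w j).1)) (sdL R k) := by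
  simp only [sd, LinearMap.comp_apply, op_single, mC, Finsupp.lmapDomain_apply, ← Finsupp.mapDomain_comp]
  rfl

lemma sdT_single {k : ℕ} (σ : C(Δ k, X)) :
    ∃ l : LC R (TT k) (k+1), sdT R X k (Finsupp.single σ 1) = Finsupp.lmapDomain R R (fun w => σ.comp (linD fun j => (w j).1)) l := by
  refine ⟨DD (fun k => vt R 0 k - sdL R k) k, ?_⟩
  simp only [sdT, LinearMap.comp_apply, op_single, mC, Finsupp.lmapDomain_apply, ← Finsupp.mapDomain_comp]
  rfl

lemma supported_induction {α M : Type*} [AddCommGroup M] [Module R M] (s : Set α) (f : (α →₀ R) →ₗ[R] M)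
    (N : Submodule R M) (h : ∀ a ∈ s, f (Finsupp.single a 1) ∈ N) :
    ∀ x ∈ Finsupp.supported R R s, f x ∈ N := by
  intro x hx
  rw [Finsupp.supported_eq_span_single] at hx
  have : Submodule.span R ((fun a => Finsupp.single a (1:R)) '' s) ≤ N.comap f := by
    rw [Submodule.span_le]
    rintro _ ⟨a, ha, rfl⟩
    exact h a ha
  exact this hx

lemma lmapDomain_mem {α β : Type*} (g : α → β) (l : α →₀ R) (s : Set β) (h : ∀ a ∈ l.support, g a ∈ s) :
    Finsupp.lmapDomain R R g l ∈ Finsupp.supported R R s := by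
  classical
  rw [Finsupp.mem_supported]
  intro b hb
  have := Finsupp.mapDomain_support hb
  rw [Finset.mem_image] at this
  obtain ⟨a, ha, rfl⟩ := this
  exact h a ha

/-- small simplices -/
def sm (U V : Set X) (k : ℕ) : Set C(Δ k, X) := {σ | Set.range σ ⊆ U ∨ Set.range σ ⊆ V}

lemma sm_comp {U V : Set X} {k m : ℕ} {σ : C(Δ k, X)} (h : σ ∈ sm U V k) (g : C(Δ m, Δ k)) :
    σ.comp g ∈ sm U V m := by
  have : Set.range (σ.comp g) ⊆ Set.range σ := by
    rintro _ ⟨x, rfl⟩; exact ⟨g x, rfl⟩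
  exact h.imp this.trans this.trans

abbrev SM (R : Type) [CommRing R] (U V : Set X) (k : ℕ) : Submodule R (Ch R X k) := Finsupp.supported R R (sm U V k)

lemma dC_mem {U V : Set X} {k : ℕ} {x : Ch R X (k+1)} (hx : x ∈ SM R U V (k+1)) : dC R X k x ∈ SM R U V k := by
  refine supported_induction _ _ _ (fun σ hσ => ?_) x hx
  rw [dC_single]
  exact Submodule.sum_mem _ fun i _ => Submodule.smul_mem _ _
    (Finsupp.single_mem_supported R _ (sm_comp hσ _))

lemma sd_mem {U V : Set X} {k : ℕ} {x : Ch R X k} (hx : x ∈ SM R U V k) : sd R X k x ∈ SM R U V k := by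
  refine supported_induction _ _ _ (fun σ hσ => ?_) x hx
  rw [sd_single]
  exact lmapDomain_mem _ _ _ fun w _ => sm_comp hσ _

lemma sdT_mem {U V : Set X} {k : ℕ} {x : Ch R X k} (hx : x ∈ SM R U V k) : sdT R X k x ∈ SM R U V (k+1) := by
  refine supported_induction _ _ _ (fun σ hσ => ?_) x hx
  obtain ⟨l, hl⟩ := sdT_single (R := R) σ
  rw [hl]
  exact lmapDomain_mem _ _ _ fun w _ => sm_comp hσ _

lemma sum_smul_dist {m : ℕ} {E : Type*} [NormedAddCommGroup E] [NormedSpace ℝ E] (t : Δ m) (v : Fin m → E) (x : E) (c : ℝ)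
    (h : ∀ j, ‖v j - x‖ ≤ c) : ‖∑ j, t j • v j - x‖ ≤ c := by
  have h1 : ∑ j, t j • v j - x = ∑ j, t j • (v j - x) := by
    simp only [smul_sub, Finset.sum_sub_distrib, ← Finset.sum_smul, stdSimplex.sum_eq_one, one_smul]
  rw [h1]
  calc _ ≤ ∑ j, ‖t j • (v j - x)‖ := norm_sum_le _ _
    _ ≤ ∑ j, t j * c := Finset.sum_le_sum fun j _ => by
        rw [norm_smul, Real.norm_of_nonneg (stdSimplex.zero_le t j)]
        exact mul_le_mul_of_nonneg_left (h j) (t.2.1 j)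
    _ = c := by rw [← Finset.sum_mul, stdSimplex.sum_eq_one, one_mul]

lemma mem_support_dH {k m : ℕ} (l : LC R (TT k) m) (w' : Fin m → TT (k+1)) (h : w' ∈ (dH R k m l).support) :
    ∃ i : Fin (k+1), ∃ w ∈ l.support, w' = tmap i.succAbove ∘ w := by
  have : dH R k m l ∈ Finsupp.supported R R {w' | ∃ i : Fin (k+1), ∃ w ∈ l.support, w' = tmap i.succAbove ∘ w} := by
    rw [dH, LinearMap.sum_apply]
    refine Submodule.sum_mem _ fun i _ => ?_
    rw [LinearMap.smul_apply]
    refine Submodule.smul_mem _ _ ?_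
    exact lmapDomain_mem _ _ _ fun w hw => ⟨i, w, hw, rfl⟩
  exact (Finsupp.mem_supported _ _).1 this h

lemma mesh (k : ℕ) {E : Type} [NormedAddCommGroup E] [NormedSpace ℝ E] (ε : ℝ) (hε : 0 ≤ ε) (v : Fin k → E)
    (hv : ∀ i j, ‖v i - v j‖ ≤ ε) : ∀ w ∈ (sdL R k).support, ∀ i j,
    ‖∑ a, (w i).1 a • v a - ∑ a, (w j).1 a • v a‖ ≤ (k / (k+1) : ℝ) * ε := by
  induction k with
  | zero => intro w _ i; exact i.elim0
  | succ k ih =>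
    intro w hw
    have : ∃ w' ∈ (dH R k k (sdL R k)).support, Fin.cons (bp k) w' = w := by
      have h : sdL R (k+1) ∈ Finsupp.supported R R {w | ∃ w' ∈ (dH R k k (sdL R k)).support, Fin.cons (bp k) w' = w} :=
        lmapDomain_mem _ _ _ fun w' hw' => ⟨w', hw', rfl⟩
      exact (Finsupp.mem_supported _ _).1 h hw
    obtain ⟨w', hw', rfl⟩ := this
    obtain ⟨f, w, hw2, rfl⟩ := mem_support_dH _ _ hw'
    have hk : (k / (k+1) : ℝ) ≤ ((k+1 : ℕ) / ((k+1 : ℕ) + 1) : ℝ) := by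
      push_cast
      rw [div_le_div_iff₀ (by positivity) (by positivity)]
      nlinarith
    have key : ∀ t : Δ (k+1), ‖∑ a, t a • v a - ∑ a, (bp k).1 a • v a‖ ≤ ((k+1 : ℕ) / ((k+1 : ℕ) + 1) : ℝ) * ε := by
      intro t
      refine (sum_smul_dist t v _ ((k/(k+1) : ℝ) * ε) fun j => ?_).trans (mul_le_mul_of_nonneg_right hk hε)
      have e1 : v j - ∑ a, (bp k).1 a • v a = (1/(k+1) : ℝ) • ∑ a, (v j - v a) := by
        have : ∀ a, (bp k).1 a = (1/(k+1) : ℝ) := fun a => by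
          exact (stdSimplex.barycenter_apply (𝕜 := ℝ) (X := Fin (k+1)) a).trans (by simp)
        simp only [this, Finset.sum_sub_distrib, Finset.sum_const, Finset.card_univ, Fintype.card_fin, smul_sub, Finset.smul_sum]
        congr 1
        rw [← Nat.cast_smul_eq_nsmul ℝ, smul_smul]
        push_cast
        rw [one_div, inv_mul_cancel₀ (by positivity), one_smul]
      rw [e1, norm_smul, Real.norm_of_nonneg (by positivity)]
      have : ‖∑ a, (v j - v a)‖ ≤ k * ε := by
        rw [Fin.sum_univ_succAbove _ j, sub_self, zero_add]
        calc _ ≤ ∑ a : Fin k, ‖v j - v (j.succAbove a)‖ := norm_sum_le _ _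
          _ ≤ ∑ a : Fin k, ε := Finset.sum_le_sum fun a _ => hv _ _
          _ = _ := by simp
      calc _ ≤ (1/(k+1) : ℝ) * (k * ε) := by gcongr
        _ = _ := by ring
    intro i j
    refine Fin.cases ?_ (fun i => ?_) i <;> refine Fin.cases ?_ (fun j => ?_) j
    · simp only [Fin.cons_zero, sub_self, norm_zero]; positivity
    · rw [norm_sub_rev]; exact key _
    · exact key _
    · have := ih (fun a => v (f.succAbove a)) (fun i j => hv _ _) w hw2 i j
      simp only [Fin.cons_succ]
      have e : ∀ i, ∑ a, ((tmap f.succAbove ∘ w) i).1 a • v a = ∑ a, (w i).1 a • v (f.succAbove a) := fun i =>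
        smap_sum f.succAbove v (w i).1
      rw [e, e]
      exact this.trans (mul_le_mul_of_nonneg_right hk hε)

def fine {k : ℕ} (σ : C(Δ k, X)) (ε : ℝ) : Set C(Δ k, X) :=
  {τ | ∃ v : Fin k → Δ k, (∀ i j, ‖(v i : Fin k → ℝ) - v j‖ ≤ ε) ∧ τ = σ.comp (linD v)}

lemma sd_fine {k : ℕ} (σ : C(Δ k, X)) (ε : ℝ) (hε : 0 ≤ ε) (x : Ch R X k) (hx : x ∈ Finsupp.supported R R (fine σ ε)) :
    sd R X k x ∈ Finsupp.supported R R (fine σ ((k / (k+1) : ℝ) * ε)) := by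
  refine supported_induction _ _ _ (fun τ hτ => ?_) x hx
  obtain ⟨v, hv, rfl⟩ := hτ
  rw [sd_single]
  refine lmapDomain_mem _ _ _ fun w hw => ⟨fun j => linD v (w j).1, fun i j => ?_, ?_⟩
  · exact mesh k ε hε (fun i => (v i : Fin k → ℝ)) hv w hw i j
  · rw [ContinuousMap.comp_assoc, linD_linD]

lemma sd_iter_fine {k : ℕ} (σ : C(Δ k, X)) (m : ℕ) :
    ((sd R X k)^m) (Finsupp.single σ 1) ∈ Finsupp.supported R R (fine σ ((k / (k+1) : ℝ)^m)) := by
  induction m with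
  | zero =>
    refine Finsupp.single_mem_supported R _ ⟨fun j => stdSimplex.vertex j, fun i j => ?_, ?_⟩
    · rw [pow_zero, pi_norm_le_iff_of_nonneg zero_le_one]
      intro a
      rw [Real.norm_eq_abs, abs_le, Pi.sub_apply]
      have h1 := stdSimplex.zero_le (stdSimplex.vertex i : Δ k) a
      have h2 := stdSimplex.le_one (stdSimplex.vertex i : Δ k) a
      have h3 := stdSimplex.zero_le (stdSimplex.vertex j : Δ k) a
      have h4 := stdSimplex.le_one (stdSimplex.vertex j : Δ k) a
      exact ⟨by linarith! , by linarith!⟩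
    · rw [linD_vertex]; rfl
  | succ m ih =>
    rw [pow_succ', pow_succ']
    exact sd_fine σ _ (by positivity) _ ih

lemma exists_sd_small {U V : Set X} (hU : IsOpen U) (hV : IsOpen V) (hUV : U ∪ V = Set.univ) {k : ℕ} (x : Ch R X k) :
    ∃ m, ((sd R X k)^m) x ∈ SM R U V k := by
  have mono : ∀ (x : Ch R X k) m m', m ≤ m' → ((sd R X k)^m) x ∈ SM R U V k → ((sd R X k)^m') x ∈ SM R U V k := by
    intro x m m' h hx
    obtain ⟨c, rfl⟩ := Nat.exists_eq_add_of_le' h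
    clear h
    induction c with
    | zero => simpa using hx
    | succ c ih => rw [Nat.add_right_comm, pow_succ']; exact sd_mem ih
  induction x using Finsupp.induction_linear with
  | zero => exact ⟨0, by simp⟩
  | add f g hf hg =>
    obtain ⟨m, hm⟩ := hf
    obtain ⟨m', hm'⟩ := hg
    refine ⟨max m m', ?_⟩
    rw [map_add]
    exact Submodule.add_mem _ (mono _ _ _ (le_max_left _ _) hm) (mono _ _ _ (le_max_right _ _) hm')
  | single σ a =>
    have : ∃ ε > 0, fine σ ε ⊆ sm U V k := by
      obtain ⟨δ, hδ, h⟩ := lebesgue_number_lemma_of_metric (s := (Set.univ : Set (Δ k))) (c := fun b : Bool => σ ⁻¹' (if b then U else V))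
        isCompact_univ (fun b => by cases b <;> simp [hU.preimage, hV.preimage, σ.continuous]) (by
          intro x _
          have : σ x ∈ U ∪ V := hUV ▸ Set.mem_univ _
          rcases this with h | h
          · exact Set.mem_iUnion.2 ⟨true, by simpa using h⟩
          · exact Set.mem_iUnion.2 ⟨false, by simpa using h⟩)
      refine ⟨δ/2, by positivity, ?_⟩
      rintro _ ⟨v, hv, rfl⟩
      cases k with
      | zero => 
        left
        rintro _ ⟨x, rfl⟩
        exact absurd (stdSimplex.sum_eq_one x) (by simp)
      | succ k =>
      obtain ⟨b, hb⟩ := h (v 0) trivial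
      have : Set.range (σ.comp (linD v)) ⊆ if b then U else V := by
        rintro _ ⟨t, rfl⟩
        apply hb
        rw [Metric.mem_ball, Subtype.dist_eq, dist_eq_norm]
        refine lt_of_le_of_lt (sum_smul_dist t (fun j => (v j : Fin (k+1) → ℝ)) (v 0) (δ/2) fun j => hv j 0) (by linarith)
      cases b
      · right; simpa using this
      · left; simpa using this
    obtain ⟨ε, hε, h⟩ := this
    obtain ⟨m, hm⟩ := exists_pow_lt_of_lt_one hε (show (k / (k+1) : ℝ) < 1 by rw [div_lt_one (by positivity)]; linarith)
    refine ⟨m, ?_⟩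
    have h1 := Finsupp.supported_mono (R := R) (M := R) (s := fine σ ((k / (k+1) : ℝ)^m)) (t := sm U V k) (fun τ ⟨v, hv, e⟩ => h ⟨v, fun i j => (hv i j).trans hm.le, e⟩)
      (sd_iter_fine σ m)
    have e : Finsupp.single σ a = a • Finsupp.single σ (1:R) := by simp
    rw [e, map_smul]
    exact Submodule.smul_mem _ _ h1

/-- the key fact for excision -/
lemma small_cyc {U V : Set X} (hU : IsOpen U) (hV : IsOpen V) (hUV : U ∪ V = Set.univ) {k : ℕ} (x : Ch R X (k+1))
    (hx : dC R X k x ∈ SM R U V k) : ∃ y, x - dC R X (k+1) y ∈ SM R U V (k+1) := by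
  obtain ⟨m, hm⟩ := exists_sd_small (R := R) hU hV hUV x
  induction m generalizing x with
  | zero => exact ⟨0, by simpa using hm⟩
  | succ m ih =>
    obtain ⟨y, hy⟩ := ih (sd R X (k+1) x) (by rw [sd_dC]; exact sd_mem hx) (by rw [pow_succ] at hm; exact hm)
    refine ⟨y + sdT R X (k+1) x, ?_⟩
    have := sdT_spec (R := R) k x
    have e : x - dC R X (k+1) (y + sdT R X (k+1) x) = (sd R X (k+1) x - dC R X (k+1) y) + sdT R X k (dC R X k x) := by
      rw [map_add, ← sub_eq_zero]
      rw [← sub_eq_zero] at this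
      rw [← neg_eq_zero, ← this]; abel
    rw [e]
    exact Submodule.add_mem _ hy (sdT_mem hx)

end SSH

namespace SSH

section API
variable {R : Type} [CommRing R] (K L : ChainComplex (ModuleCat.{0} R) ℕ)

def Zc (k : ℕ) : Submodule R (K.X k) := LinearMap.ker (K.d k (k-1)).hom

lemma next_eq (k : ℕ) : (ComplexShape.down ℕ).next k = k - 1 := by
  cases k with
  | zero => exact ChainComplex.next_nat_zero
  | succ k => exact ChainComplex.next_nat_succ k

lemma mem_Zc_succ {k : ℕ} {x : K.X (k+1)} : x ∈ Zc K (k+1) ↔ K.d (k+1) k x = 0 := Iff.rfl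

lemma mem_Zc_zero (x : K.X 0) : x ∈ Zc K 0 := by
  have : K.d 0 (0-1) = 0 := K.shape _ _ (by simp)
  rw [Zc, this]; rfl

def mkH (k : ℕ) : Zc K k →ₗ[R] K.homology k :=
  (K.liftCycles (ModuleCat.ofHom (Zc K k).subtype) (k-1) (next_eq k) (by
    ext x; exact x.2) ≫ K.homologyπ k).hom

lemma mkH_surj (k : ℕ) : Function.Surjective (mkH K k) := by
  intro h
  obtain ⟨c, rfl⟩ := (ModuleCat.epi_iff_surjective (K.homologyπ k)).1 inferInstance h
  have hc : K.iCycles k c ∈ Zc K k := by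
    change (K.iCycles k ≫ K.d k (k-1)) c = 0
    rw [K.iCycles_d]; rfl
  refine ⟨⟨_, hc⟩, ?_⟩
  simp only [mkH, ModuleCat.hom_comp, LinearMap.comp_apply]
  congr 1
  apply (ModuleCat.mono_iff_injective (K.iCycles k)).1 inferInstance
  change (K.liftCycles _ _ _ _ ≫ K.iCycles k) _ = _
  rw [K.liftCycles_i]; rfl

lemma mkH_eq_zero {k : ℕ} (x : Zc K k) : mkH K k x = 0 ↔ ∃ y, K.d (k+1) k y = x := by
  constructor
  · intro h
    have ex := ShortComplex.exact_of_g_is_cokernel (ShortComplex.mk (K.toCycles (k+1) k) (K.homologyπ k) (by simp))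
      (K.homologyIsCokernel (k+1) k (by simp))
    rw [ShortComplex.moduleCat_exact_iff] at ex
    obtain ⟨y, hy⟩ := ex _ h
    refine ⟨y, ?_⟩
    have := congrArg (K.iCycles k) hy
    change (K.toCycles _ _ ≫ K.iCycles k) y = (K.liftCycles _ _ _ _ ≫ K.iCycles k) _ at this
    rw [K.liftCycles_i, K.toCycles_i] at this
    exact this
  · rintro ⟨y, hy⟩
    have : K.toCycles (k+1) k y = K.liftCycles (ModuleCat.ofHom (Zc K k).subtype) (k-1) (next_eq k) (by
      ext x; exact x.2) x := by
      apply (ModuleCat.mono_iff_injective (K.iCycles k)).1 inferInstance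
      change (K.toCycles _ _ ≫ K.iCycles k) y = (K.liftCycles _ _ _ _ ≫ K.iCycles k) _
      rw [K.liftCycles_i, K.toCycles_i]
      exact hy
    simp only [mkH, ModuleCat.hom_comp, LinearMap.comp_apply]
    change K.homologyπ k _ = 0
    erw [← this]
    change (K.toCycles (k+1) k ≫ K.homologyπ k) y = 0
    rw [K.toCycles_comp_homologyπ]; rfl

variable {K L}
lemma map_Zc (φ : K ⟶ L) {k : ℕ} {x : K.X k} (hx : x ∈ Zc K k) : φ.f k x ∈ Zc L k := by
  change (φ.f k ≫ L.d k (k-1)) x = 0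
  rw [φ.comm]
  change φ.f (k-1) (K.d k (k-1) x) = 0
  have : K.d k (k-1) x = 0 := hx
  rw [this, map_zero]

lemma mkH_map (φ : K ⟶ L) {k : ℕ} (x : Zc K k) :
    HomologicalComplex.homologyMap φ k (mkH K k x) = mkH L k ⟨φ.f k x, map_Zc φ x.2⟩ := by
  have h1 : K.liftCycles (ModuleCat.ofHom (Zc K k).subtype) (k-1) (next_eq k) (by
      ext x; exact x.2) ≫ HomologicalComplex.cyclesMap φ k = ModuleCat.ofHom ((φ.f k).hom.restrict (fun x hx => map_Zc φ hx)) ≫ L.liftCycles (ModuleCat.ofHom (Zc L k).subtype) (k-1) (next_eq k) (by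
      ext x; exact x.2) := by
    rw [← cancel_mono (L.iCycles k)]
    simp only [Category.assoc, HomologicalComplex.cyclesMap_i, HomologicalComplex.liftCycles_i, HomologicalComplex.liftCycles_i_assoc]
    rfl
  change (K.liftCycles (ModuleCat.ofHom (Zc K k).subtype) _ _ _ ≫ K.homologyπ k ≫ HomologicalComplex.homologyMap φ k) x = _
  rw [HomologicalComplex.homologyπ_naturality, ← Category.assoc, h1, Category.assoc]
  rfl

lemma isIso_iff (φ : K ⟶ L) (k : ℕ) : IsIso (HomologicalComplex.homologyMap φ k) ↔
    (∀ x ∈ Zc K k, (∃ y, L.d (k+1) k y = φ.f k x) → ∃ y, K.d (k+1) k y = x) ∧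
    (∀ y ∈ Zc L k, ∃ x ∈ Zc K k, ∃ w, φ.f k x + L.d (k+1) k w = y) := by
  rw [ConcreteCategory.isIso_iff_bijective]
  refine and_congr ?_ ?_
  · rw [← ModuleCat.mono_iff_injective, ModuleCat.mono_iff_ker_eq_bot, LinearMap.ker_eq_bot']
    constructor
    · intro h x hx hy
      have := h (mkH K k ⟨x, hx⟩) (by 
        change HomologicalComplex.homologyMap φ k _ = 0
        rw [mkH_map, mkH_eq_zero]; exact hy)
      exact (mkH_eq_zero K _).1 this
    · intro h c hc
      obtain ⟨x, rfl⟩ := mkH_surj K k c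
      change HomologicalComplex.homologyMap φ k _ = 0 at hc
      rw [mkH_map, mkH_eq_zero] at hc
      exact (mkH_eq_zero K _).2 (h x x.2 hc)
  · constructor
    · intro h y hy
      obtain ⟨c, hc⟩ := h (mkH L k ⟨y, hy⟩)
      obtain ⟨x, rfl⟩ := mkH_surj K k c
      rw [mkH_map, eq_comm, ← sub_eq_zero, ← map_sub, mkH_eq_zero] at hc
      obtain ⟨w, hw⟩ := hc
      refine ⟨x, x.2, w, ?_⟩
      rw [hw]; simp
    · intro h c
      obtain ⟨y, rfl⟩ := mkH_surj L k c
      obtain ⟨x, hx, w, hw⟩ := h y y.2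
      refine ⟨mkH K k ⟨x, hx⟩, ?_⟩
      rw [mkH_map, eq_comm, ← sub_eq_zero, ← map_sub, mkH_eq_zero]
      exact ⟨w, by simp [← hw]⟩

lemma quasiIso_of (φ : K ⟶ L) 
    (h1 : ∀ k, ∀ x ∈ Zc K k, (∃ y, L.d (k+1) k y = φ.f k x) → ∃ y, K.d (k+1) k y = x)
    (h2 : ∀ k, ∀ y ∈ Zc L k, ∃ x ∈ Zc K k, ∃ w, φ.f k x + L.d (k+1) k w = y) : QuasiIso φ := by
  rw [quasiIso_iff]
  intro k
  rw [quasiIsoAt_iff_isIso_homologyMap, isIso_iff]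
  exact ⟨h1 k, h2 k⟩

/-- complex from data -/
def CC (C : ℕ → Type) [∀ k, AddCommGroup (C k)] [∀ k, Module R (C k)] (d : ∀ k, C (k+1) →ₗ[R] C k)
    (h : ∀ k x, d k (d (k+1) x) = 0) : ChainComplex (ModuleCat.{0} R) ℕ :=
  ChainComplex.of (fun k => ModuleCat.of R (C k)) (fun k => ModuleCat.ofHom (d k)) (fun k => by
    ext x; exact h k x)

lemma CC_d (C : ℕ → Type) [∀ k, AddCommGroup (C k)] [∀ k, Module R (C k)] (d : ∀ k, C (k+1) →ₗ[R] C k)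
    (h : ∀ k x, d k (d (k+1) x) = 0) (k : ℕ) : (CC C d h).d (k+1) k = ModuleCat.ofHom (d k) :=
  ChainComplex.of_d (fun k => ModuleCat.of R (C k)) (fun k => ModuleCat.ofHom (d k)) k

def CChom {C C' : ℕ → Type} [∀ k, AddCommGroup (C k)] [∀ k, Module R (C k)] [∀ k, AddCommGroup (C' k)] [∀ k, Module R (C' k)]
    {d : ∀ k, C (k+1) →ₗ[R] C k} {h : ∀ k x, d k (d (k+1) x) = 0}
    {d' : ∀ k, C' (k+1) →ₗ[R] C' k} {h' : ∀ k x, d' k (d' (k+1) x) = 0} (f : ∀ k, C k →ₗ[R] C' k)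
    (hf : ∀ k x, f k (d k x) = d' k (f (k+1) x)) : CC C d h ⟶ CC C' d' h' :=
  ChainComplex.ofHom (X := CC C d h) (Y := CC C' d' h') (fun k => ModuleCat.ofHom (f k)) (fun k => by
    rw [CC_d, CC_d]
    ext x; exact (hf k x).symm)

lemma CC_d' (C : ℕ → Type) [∀ k, AddCommGroup (C k)] [∀ k, Module R (C k)] (d : ∀ k, C (k+1) →ₗ[R] C k)
    (h : ∀ k x, d k (d (k+1) x) = 0) (k : ℕ) (x : C (k+1)) : (CC C d h).d (k+1) k x = d k x :=
  congrArg (fun q : ModuleCat.of R (C (k+1)) ⟶ ModuleCat.of R (C k) => q.hom x) (CC_d C d h k)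

/-- being a cycle, on data -/
def cyc {C : ℕ → Type} [∀ k, AddCommGroup (C k)] [∀ k, Module R (C k)] (d : ∀ k, C (k+1) →ₗ[R] C k) :
    ∀ k, C k → Prop
  | 0, _ => True
  | k+1, x => d k x = 0

lemma mem_Zc_CC {C : ℕ → Type} [∀ k, AddCommGroup (C k)] [∀ k, Module R (C k)] {d : ∀ k, C (k+1) →ₗ[R] C k}
    {h : ∀ k x, d k (d (k+1) x) = 0} {k : ℕ} {x : C k} : x ∈ Zc (CC C d h) k ↔ cyc d k x := by
  cases k with
  | zero => exact ⟨fun _ => trivial, fun _ => mem_Zc_zero _ _⟩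
  | succ k => exact ⟨fun hx => (CC_d' C d h k x).symm.trans hx, fun hx => (CC_d' C d h k x).trans hx⟩

lemma CChom_iso {C C' : ℕ → Type} [∀ k, AddCommGroup (C k)] [∀ k, Module R (C k)] [∀ k, AddCommGroup (C' k)] [∀ k, Module R (C' k)]
    {d : ∀ k, C (k+1) →ₗ[R] C k} {h : ∀ k x, d k (d (k+1) x) = 0}
    {d' : ∀ k, C' (k+1) →ₗ[R] C' k} {h' : ∀ k x, d' k (d' (k+1) x) = 0} (f : ∀ k, C k →ₗ[R] C' k)
    (hf : ∀ k x, f k (d k x) = d' k (f (k+1) x)) (k : ℕ) : 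
    IsIso (HomologicalComplex.homologyMap (CChom f hf : CC C d h ⟶ CC C' d' h') k) ↔
    (∀ x : C k, cyc d k x → (∃ y, d' k y = f k x) → ∃ y, d k y = x) ∧
    (∀ y : C' k, cyc d' k y → ∃ x, cyc d k x ∧ ∃ w, f k x + d' k w = y) := by
  rw [isIso_iff]
  refine and_congr ?_ ?_
  · constructor
    · intro H x hx ⟨y, hy⟩
      obtain ⟨w, hw⟩ := H x (mem_Zc_CC.2 hx) ⟨y, (CC_d' C' d' h' k y).trans hy⟩
      exact ⟨w, (CC_d' C d h k w).symm.trans hw⟩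
    · intro H x hx ⟨y, hy⟩
      obtain ⟨w, hw⟩ := H x (mem_Zc_CC.1 hx) ⟨y, (CC_d' C' d' h' k y).symm.trans hy⟩
      exact ⟨w, (CC_d' C d h k w).trans hw⟩
  · constructor
    · intro H y hy
      obtain ⟨x, hx, w, hw⟩ := H y (mem_Zc_CC.2 hy)
      exact ⟨x, mem_Zc_CC.1 hx, w, (congrArg (fun q : C' k => f k x + q) (CC_d' C' d' h' k w).symm).trans hw⟩
    · intro H y hy
      obtain ⟨x, hx, w, hw⟩ := H y (mem_Zc_CC.1 hy)
      exact ⟨x, mem_Zc_CC.2 hx, w, (congrArg (fun q : C' k => f k x + q) (CC_d' C' d' h' k w)).trans hw⟩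

lemma CChom_qi {C C' : ℕ → Type} [∀ k, AddCommGroup (C k)] [∀ k, Module R (C k)] [∀ k, AddCommGroup (C' k)] [∀ k, Module R (C' k)]
    {d : ∀ k, C (k+1) →ₗ[R] C k} {h : ∀ k x, d k (d (k+1) x) = 0}
    {d' : ∀ k, C' (k+1) →ₗ[R] C' k} {h' : ∀ k x, d' k (d' (k+1) x) = 0} (f : ∀ k, C k →ₗ[R] C' k)
    (hf : ∀ k x, f k (d k x) = d' k (f (k+1) x)) : QuasiIso (CChom f hf : CC C d h ⟶ CC C' d' h') ↔
    ∀ k, (∀ x : C k, cyc d k x → (∃ y, d' k y = f k x) → ∃ y, d k y = x) ∧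
    (∀ y : C' k, cyc d' k y → ∃ x, cyc d k x ∧ ∃ w, f k x + d' k w = y) := by
  rw [quasiIso_iff]
  refine forall_congr' fun k => ?_
  rw [quasiIsoAt_iff_isIso_homologyMap, CChom_iso]

lemma CC_subsing {C : ℕ → Type} [∀ k, AddCommGroup (C k)] [∀ k, Module R (C k)] {d : ∀ k, C (k+1) →ₗ[R] C k}
    {h : ∀ k x, d k (d (k+1) x) = 0} {k : ℕ} : Subsingleton ((CC C d h).homology k) ↔ 
    ∀ x : C k, cyc d k x → ∃ y, d k y = x := by
  constructor
  · intro H x hx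
    obtain ⟨w, hw⟩ := (mkH_eq_zero _ ⟨x, mem_Zc_CC.2 hx⟩).1 (Subsingleton.elim (mkH (CC C d h) k ⟨x, mem_Zc_CC.2 hx⟩) 0)
    exact ⟨w, (CC_d' C d h k w).symm.trans hw⟩
  · intro H
    refine subsingleton_of_forall_eq 0 fun c => ?_
    obtain ⟨⟨x, hx⟩, rfl⟩ := mkH_surj _ k c
    rw [mkH_eq_zero]
    obtain ⟨w, hw⟩ := H x (mem_Zc_CC.1 hx)
    exact ⟨w, (CC_d' C d h k w).trans hw⟩
end API

section
variable (R : Type) [CommRing R] (X : Type) {Y Z : Type} [TopologicalSpace X] [TopologicalSpace Y] [TopologicalSpace Z]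

def SC : ChainComplex (ModuleCat.{0} R) ℕ := CC (Ch R X) (dC R X) (fun k => LinearMap.congr_fun (dC_dC R k))
variable {X}
def SCm (f : C(X, Y)) : SC R X ⟶ SC R Y := CChom (mC R f) (fun k x => LinearMap.congr_fun (mC_dC R f k) x)

lemma SCm_comp (f : C(X, Y)) (g : C(Y, Z)) : SCm R (g.comp f) = SCm R f ≫ SCm R g := by
  ext k x
  exact LinearMap.congr_fun (mC_comp R f g k) x

lemma SCm_id : SCm R (ContinuousMap.id X) = 𝟙 _ := by
  ext k x
  exact LinearMap.congr_fun (mC_id R k) x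

lemma SC_d (k : ℕ) (x : Ch R X (k+1)) : (SC R X).d (k+1) k x = dC R X k x := by
  exact congrArg (fun q : ModuleCat.of R (Ch R X (k+1)) ⟶ ModuleCat.of R (Ch R X k) => q.hom x)
    (CC_d (Ch R X) (dC R X) (fun k => LinearMap.congr_fun (dC_dC R k)) k)

lemma homologyMap_eq {f g : C(X, Y)} (h : f.Homotopic g) (k : ℕ) :
    HomologicalComplex.homologyMap (SCm R f) k = HomologicalComplex.homologyMap (SCm R g) k := by
  ext c
  obtain ⟨x, rfl⟩ := mkH_surj _ k c
  change HomologicalComplex.homologyMap (SCm R f) k _ = HomologicalComplex.homologyMap (SCm R g) k _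
  rw [mkH_map, mkH_map, ← sub_eq_zero, ← map_sub, mkH_eq_zero]
  obtain ⟨h0, D, hD⟩ := Hty.of_homotopic (R := R) h
  obtain ⟨x, hx⟩ := x
  cases k with
  | zero =>
    refine ⟨0, ?_⟩
    rw [map_zero, eq_comm]
    change mC R f 0 x - mC R g 0 x = 0
    rw [h0, sub_self]
  | succ k =>
    refine ⟨D (k+1) x, ?_⟩
    rw [SC_d]
    have h3 : dC R X k x = 0 := (SC_d R k x).symm.trans hx
    have h4 := hD k x
    rw [h3, map_zero, add_zero] at h4
    exact h4.symm

/-- f induces iso on all homology -/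
abbrev QI (f : C(X, Y)) : Prop := QuasiIso (SCm R f)

lemma QI_of_homotopic {f g : C(X, Y)} (h : f.Homotopic g) (hf : QI R f) : QI R g := by
  rw [QI, quasiIso_iff] at *
  intro k
  have := hf k
  rw [quasiIsoAt_iff_isIso_homologyMap] at *
  rwa [← homologyMap_eq R h]

lemma QI_id : QI R (ContinuousMap.id X) := by
  rw [QI, SCm_id]; infer_instance

lemma QI_comp {f : C(X, Y)} {g : C(Y, Z)} (hf : QI R f) (hg : QI R g) : QI R (g.comp f) := by
  rw [QI, SCm_comp]
  infer_instance

lemma QI_of_comp_left {f : C(X, Y)} {g : C(Y, Z)} (hf : QI R f) (hg : QI R (g.comp f)) : QI R g := by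
  rw [QI, SCm_comp] at hg
  exact quasiIso_of_comp_left (SCm R f) (SCm R g)

lemma QI_of_comp_right {f : C(X, Y)} {g : C(Y, Z)} (hf : QI R g) (hg : QI R (g.comp f)) : QI R f := by
  rw [QI, SCm_comp] at hg
  exact quasiIso_of_comp_right (SCm R f) (SCm R g)

lemma QI_of_equiv {f : C(X, Y)} {g : C(Y, X)} (h1 : (g.comp f).Homotopic (ContinuousMap.id X))
    (h2 : (f.comp g).Homotopic (ContinuousMap.id Y)) : QI R f := by
  rw [QI, quasiIso_iff]
  intro k
  rw [quasiIsoAt_iff_isIso_homologyMap]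
  have e1 := homologyMap_eq R h1 k
  have e2 := homologyMap_eq R h2 k
  rw [SCm_comp, SCm_id, HomologicalComplex.homologyMap_comp, HomologicalComplex.homologyMap_id] at e1 e2
  exact ⟨_, e1, e2⟩

end
end SSH

namespace SSH

section
variable {R : Type} [CommRing R] {A B C X : Type} [TopologicalSpace A] [TopologicalSpace B] [TopologicalSpace C] [TopologicalSpace X]

lemma dC_dC' (k : ℕ) (x : Ch R X (k+2)) : dC R X k (dC R X (k+1) x) = 0 := LinearMap.congr_fun (dC_dC R k) x
lemma mC_dC' (f : C(A, X)) (k : ℕ) (x : Ch R A (k+1)) : mC R f k (dC R A k x) = dC R X k (mC R f (k+1) x) :=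
  LinearMap.congr_fun (mC_dC R f k) x
lemma mC_comp' (f : C(A, B)) (g : C(B, C)) (k : ℕ) (x : Ch R A k) : mC R (g.comp f) k x = mC R g k (mC R f k x) :=
  LinearMap.congr_fun (mC_comp R f g k) x

structure MV (iU : C(A, X)) (iV : C(B, X)) (jU : C(C, A)) (jV : C(C, B)) : Prop where
  eU : Topology.IsEmbedding iU
  eV : Topology.IsEmbedding iV
  eC : Topology.IsEmbedding jU
  oU : IsOpen (Set.range iU)
  oV : IsOpen (Set.range iV)
  cov : Set.range iU ∪ Set.range iV = Set.univ
  comm : iU.comp jU = iV.comp jV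
  inter : ∀ a b, iU a = iV b → ∃ c, jU c = a

lemma mC_inj {f : C(A, X)} (hf : Function.Injective f) (k : ℕ) : Function.Injective (mC R f k) := by
  refine Finsupp.mapDomain_injective ?_
  intro σ τ h
  ext1 t
  exact hf (DFunLike.congr_fun h t)

lemma lift_emb {f : C(A, X)} (hf : Topology.IsEmbedding f) {k : ℕ} (σ : C(Δ k, X)) (h : Set.range σ ⊆ Set.range f) :
    ∃ τ : C(Δ k, A), f.comp τ = σ := by
  choose g hg using fun t => h ⟨t, rfl⟩
  refine ⟨⟨g, ?_⟩, ?_⟩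
  · rw [hf.continuous_iff]
    have : f ∘ g = σ := funext hg
    rw [this]; exact σ.continuous
  · ext1 t; exact hg t

lemma mC_range {f : C(A, X)} (hf : Topology.IsEmbedding f) (k : ℕ) :
    LinearMap.range (mC R f k) = Finsupp.supported R R {σ : C(Δ k, X) | Set.range σ ⊆ Set.range f} := by
  have : {σ : C(Δ k, X) | Set.range σ ⊆ Set.range f} = Set.range (fun τ : C(Δ k, A) => f.comp τ) := by
    ext σ
    constructor
    · exact fun h => lift_emb hf σ h
    · rintro ⟨τ, rfl⟩
      rintro _ ⟨t, rfl⟩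
      exact ⟨_, rfl⟩
  rw [this, ← Set.image_univ, ← Finsupp.lmapDomain_supported, Finsupp.supported_univ, LinearMap.range_eq_map]
  rfl

section
variable (R) {iU : C(A, X)} {iV : C(B, X)} {jU : C(C, A)} {jV : C(C, B)} (h : MV iU iV jU jV)

variable (A B) in
def PC : ChainComplex (ModuleCat.{0} R) ℕ :=
  CC (fun k => Ch R A k × Ch R B k) (fun k => (dC R A k).prodMap (dC R B k)) (fun k x => by
    simp only [LinearMap.prodMap_apply, dC_dC']; rfl)

variable (iU iV) in
def SS : ChainComplex (ModuleCat.{0} R) ℕ :=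
  CC (fun k => SM R (Set.range iU) (Set.range iV) k) (fun k => (dC R X k).restrict (fun x hx => dC_mem hx)) (fun k x => by
    ext1; exact dC_dC' k x.1)

variable (jU jV) in
def PI : SC R C ⟶ PC R A B := CChom (fun k => (mC R jU k).prod (mC R jV k)) (fun k x => by
  simp only [LinearMap.prod_apply, Function.prod_apply, mC_dC', LinearMap.prodMap_apply])

lemma mem_SM_left (k : ℕ) (x : Ch R A k) : mC R iU k x ∈ SM R (Set.range iU) (Set.range iV) k := by
  refine lmapDomain_mem _ _ _ fun σ _ => Or.inl ?_
  rintro _ ⟨t, rfl⟩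
  exact ⟨_, rfl⟩

lemma mem_SM_right (k : ℕ) (x : Ch R B k) : mC R iV k x ∈ SM R (Set.range iU) (Set.range iV) k := by
  refine lmapDomain_mem _ _ _ fun σ _ => Or.inr ?_
  rintro _ ⟨t, rfl⟩
  exact ⟨_, rfl⟩

variable (iU iV) in
def PJ : PC R A B ⟶ SS R iU iV := CChom (fun k => LinearMap.codRestrict _
  ((mC R iU k).coprod (-(mC R iV k))) (fun x => by
    simp only [LinearMap.coprod_apply, LinearMap.neg_apply]
    exact Submodule.add_mem _ (mem_SM_left R k _) (Submodule.neg_mem _ (mem_SM_right R k _)))) (fun k x => by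
  ext1
  change mC R iU k (dC R A k x.1) + -(mC R iV k (dC R B k x.2)) = dC R X k (mC R iU (k+1) x.1 + -(mC R iV (k+1) x.2))
  rw [mC_dC', mC_dC', map_add, map_neg])

variable (iU iV) in
def SX : SS R iU iV ⟶ SC R X := CChom (fun k => (SM R (Set.range iU) (Set.range iV) k).subtype) (fun k x => rfl)

include h in
lemma MV.comm' (k : ℕ) (x : Ch R C k) : mC R iU k (mC R jU k x) = mC R iV k (mC R jV k x) := by
  rw [← mC_comp', ← mC_comp', h.comm]

include h in
lemma PIJ : PI R jU jV ≫ PJ R iU iV = 0 := by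
  ext k x
  exact Subtype.ext (add_neg_eq_zero.2 (h.comm' R k x))

def MVS : ShortComplex (ChainComplex (ModuleCat.{0} R) ℕ) := ShortComplex.mk _ _ (PIJ R h)

include h in
lemma MV.ex (k : ℕ) (a : Ch R A k) (b : Ch R B k) (hab : mC R iU k a = mC R iV k b) :
    ∃ x, mC R jU k x = a ∧ mC R jV k x = b := by
  have h1 : mC R iU k a ∈ LinearMap.range (mC R (iU.comp jU) k) := by
    have e : Topology.IsEmbedding (iU.comp jU) := h.eU.comp h.eC
    rw [mC_range e]
    have ha : mC R iU k a ∈ LinearMap.range (mC R iU k) := ⟨a, rfl⟩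
    have hb : mC R iU k a ∈ LinearMap.range (mC R iV k) := ⟨b, hab.symm⟩
    rw [mC_range h.eU] at ha
    rw [mC_range h.eV] at hb
    have hh := Submodule.mem_inf.2 ⟨ha, hb⟩
    rw [← Finsupp.supported_inter] at hh
    refine Finsupp.supported_mono ?_ hh
    rintro σ ⟨h1, h2⟩
    rintro _ ⟨t, rfl⟩
    obtain ⟨a, ha⟩ := h1 ⟨t, rfl⟩
    obtain ⟨b, hb⟩ := h2 ⟨t, rfl⟩
    obtain ⟨c, hc⟩ := h.inter a b (ha.trans hb.symm)
    exact ⟨c, by rw [← ha, ← hc]; rfl⟩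
  obtain ⟨x, hx⟩ := h1
  rw [mC_comp'] at hx
  refine ⟨x, mC_inj h.eU.injective k hx, mC_inj h.eV.injective k ?_⟩
  rw [← h.comm' R, hx, hab]

include h in
lemma MV.surj (k : ℕ) (y : Ch R X k) (hy : y ∈ SM R (Set.range iU) (Set.range iV) k) :
    ∃ a b, mC R iU k a + - mC R iV k b = y := by
  have : SM R (Set.range iU) (Set.range iV) k = LinearMap.range (mC R iU k) ⊔ LinearMap.range (mC R iV k) := by
    rw [mC_range h.eU, mC_range h.eV, ← Finsupp.supported_union]; rfl
  rw [this, Submodule.mem_sup] at hy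
  obtain ⟨_, ⟨a, rfl⟩, _, ⟨b, rfl⟩, rfl⟩ := hy
  exact ⟨a, -b, by rw [map_neg, neg_neg]⟩

lemma MVS_exact : (MVS R h).ShortExact := by
  apply HomologicalComplex.shortExact_of_degreewise_shortExact
  intro k
  apply ModuleCat.shortComplex_shortExact
  · rintro ⟨a, b⟩
    constructor
    · intro hx
      have hx := congrArg Subtype.val hx
      obtain ⟨x, hx1, hx2⟩ := h.ex R k a b (add_neg_eq_zero.1 hx)
      exact ⟨x, Prod.ext hx1 hx2⟩
    · rintro ⟨x, hx⟩
      have h1 := congrArg Prod.fst hx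
      have h2 := congrArg Prod.snd hx
      refine Subtype.ext (add_neg_eq_zero.2 ?_)
      exact (congrArg _ h1.symm).trans ((h.comm' R k x).trans (congrArg _ h2))
  · intro x y hxy
    exact mC_inj h.eC.injective k (congrArg Prod.fst hxy)
  · rintro ⟨y, hy⟩
    obtain ⟨a, b, hab⟩ := h.surj R k y hy
    exact ⟨(a, b), Subtype.ext hab⟩

include h in
lemma SX_qi : QuasiIso (SX R iU iV) := by
  refine (CChom_qi _ _).2 fun k => ?_
  constructor
  · rintro ⟨x, hx⟩ hx0 ⟨y, hy : dC R X k y = x⟩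
    obtain ⟨w, hw⟩ := small_cyc h.oU h.oV h.cov y (by rw [hy]; exact hx)
    refine ⟨⟨_, hw⟩, Subtype.ext ?_⟩
    change dC R X k (y - dC R X (k+1) w) = x
    rw [map_sub, dC_dC', sub_zero, hy]
  · intro y hy
    cases k with
    | zero =>
      refine ⟨⟨y, ?_⟩, trivial, 0, ?_⟩
      · rw [SM, Finsupp.mem_supported]
        intro σ _
        left
        rintro _ ⟨t, rfl⟩
        exact absurd t.2.2 (by simp)
      · rw [map_zero, add_zero]; rfl
    | succ k =>
      have hy : dC R X k y = 0 := hy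
      obtain ⟨w, hw⟩ := small_cyc h.oU h.oV h.cov y (by rw [hy]; exact Submodule.zero_mem _)
      refine ⟨⟨_, hw⟩, Subtype.ext ?_, w, sub_add_cancel _ _⟩
      change dC R X k (y - dC R X (k+1) w) = 0
      rw [map_sub, dC_dC', sub_zero, hy]
end
end
end SSH

namespace SSH

section
variable {R : Type} [CommRing R] {S : ShortComplex (ChainComplex (ModuleCat.{0} R) ℕ)} (hS : S.ShortExact)
local notation "Hm" => HomologicalComplex.homology
local notation "hm" => HomologicalComplex.homologyMap

include hS
lemma ses_ex1 (k : ℕ) : ∃ δ : S.X₃.homology (k+1) →ₗ[R] S.X₁.homology k,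
    (LinearMap.range (hm S.g (k+1)).hom = LinearMap.ker δ) ∧ LinearMap.range δ = LinearMap.ker (hm S.f k).hom := by
  refine ⟨(hS.δ (k+1) k (by simp)).hom, ?_, ?_⟩
  · exact (ShortComplex.moduleCat_exact_iff_range_eq_ker _).1 (hS.homology_exact₃ (k+1) k (by simp))
  · exact (ShortComplex.moduleCat_exact_iff_range_eq_ker _).1 (hS.homology_exact₁ (k+1) k (by simp))

lemma ses_ex2 (k : ℕ) : LinearMap.range (hm S.f k).hom = LinearMap.ker (hm S.g k).hom := 
  (ShortComplex.moduleCat_exact_iff_range_eq_ker _).1 (hS.homology_exact₂ k)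

lemma ses_surj : Function.Surjective (hm S.g 0).hom := by
  intro c
  obtain ⟨⟨x, hx⟩, rfl⟩ := mkH_surj _ 0 c
  have := hS.epi_g
  have h1 : Epi (S.g.f 0) := inferInstance
  obtain ⟨y, hy⟩ := (ModuleCat.epi_iff_surjective _).1 h1 x
  refine ⟨mkH _ 0 ⟨y, mem_Zc_zero _ _⟩, ?_⟩
  refine (mkH_map _ _).trans ?_
  congr 1
  exact Subtype.ext hy

lemma ses_fin [IsNoetherianRing R] (h1 : ∀ k, Module.Finite R (S.X₁.homology k)) (h2 : ∀ k, Module.Finite R (S.X₂.homology k)) :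
    ∀ k, Module.Finite R (S.X₃.homology k) := by
  intro k
  cases k with
  | zero => 
    have := h2 0
    exact Module.Finite.of_surjective _ (ses_surj hS)
  | succ k =>
    obtain ⟨δ, e1, e2⟩ := ses_ex1 hS k
    have := h2 (k+1)
    have := h1 k
    have i1 : Module.Finite R (LinearMap.ker δ) := by
      rw [← e1]; infer_instance
    rw [Module.finite_def]
    have i2 : Module.Finite R (LinearMap.range δ) := inferInstance
    refine Submodule.fg_of_fg_map_of_fg_inf_ker δ ?_ ?_
    · rw [Submodule.map_top]; exact Module.Finite.iff_fg.1 i2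
    · rw [top_inf_eq]; exact Module.Finite.iff_fg.1 i1

end
section
variable {R : Type} [Field R] {S : ShortComplex (ChainComplex (ModuleCat.{0} R) ℕ)} (hS : S.ShortExact)
local notation "Hm" => HomologicalComplex.homology
local notation "hm" => HomologicalComplex.homologyMap
include hS

lemma ses_dim (h1 : ∀ k, Module.Finite R (S.X₁.homology k)) (h2 : ∀ k, Module.Finite R (S.X₂.homology k))
    (hp : ∀ k, Subsingleton (S.X₁.homology k) ∨ Subsingleton (S.X₂.homology k)) :
    Module.finrank R (S.X₃.homology 0) = Module.finrank R (S.X₂.homology 0) ∧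
    ∀ k, Module.finrank R (S.X₃.homology (k+1)) = Module.finrank R (S.X₂.homology (k+1)) + Module.finrank R (S.X₁.homology k) := by
  have h3 := ses_fin hS h1 h2
  have hf : ∀ k, (hm S.f k).hom = 0 := by
    intro k
    ext c
    rcases hp k with h | h
    · rw [Subsingleton.elim c 0, map_zero, map_zero]
    · exact Subsingleton.elim _ _
  have hg : ∀ k, Function.Injective (hm S.g k).hom := by
    intro k
    rw [← LinearMap.ker_eq_bot, ← ses_ex2 hS, hf, LinearMap.range_zero]
  constructor
  · have := LinearEquiv.ofBijective (hm S.g 0).hom ⟨hg 0, ses_surj hS⟩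
    exact this.finrank_eq.symm
  · intro k
    obtain ⟨δ, e1, e2⟩ := ses_ex1 hS k
    have h4 := h3 (k+1)
    have := LinearMap.finrank_range_add_finrank_ker δ
    rw [← this, e2, hf, LinearMap.ker_zero, finrank_top, ← e1, LinearMap.finrank_range_of_inj (hg _), add_comm]
end

section
variable (R : Type) [CommRing R]
def FG (X : Type) [TopologicalSpace X] : Prop := ∀ k, Module.Finite R ((SC R X).homology k)
def Acy (X : Type) [TopologicalSpace X] : Prop := ∀ k, Subsingleton ((SC R X).homology k)
/-- homology dimension -/
def hd (X : Type) [TopologicalSpace X] (k : ℕ) : ℕ := Module.finrank R ((SC R X).homology k)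

variable {R} {A B C X : Type} [TopologicalSpace A] [TopologicalSpace B] [TopologicalSpace C] [TopologicalSpace X]
  {iU : C(A, X)} {iV : C(B, X)} {jU : C(C, A)} {jV : C(C, B)} 

lemma cyc_prod {k : ℕ} {a : Ch R A k} {b : Ch R B k} : cyc (C := fun k => Ch R A k × Ch R B k) (fun k => (dC R A k).prodMap (dC R B k)) k (a, b) ↔
    cyc (dC R A) k a ∧ cyc (dC R B) k b := by
  cases k with
  | zero => simp [cyc]
  | succ k => simp [cyc, Prod.ext_iff]

/-- iso of homology from quasi-iso -/
def qiEquiv {K L : ChainComplex (ModuleCat.{0} R) ℕ} (φ : K ⟶ L) (h : QuasiIso φ) (k : ℕ) : K.homology k ≃ₗ[R] L.homology k :=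
  haveI := (quasiIsoAt_iff_isIso_homologyMap φ k).1 (h.quasiIsoAt k)
  (asIso (HomologicalComplex.homologyMap φ k)).toLinearEquiv

variable (R A B) in
def PCl : SC R A ⟶ PC R A B := CChom (fun k => LinearMap.inl R _ _) (fun k x => by simp)
variable (R A B) in
def PCr : SC R B ⟶ PC R A B := CChom (fun k => LinearMap.inr R _ _) (fun k x => by simp)

lemma PCl_qi (h : Acy R B) : QuasiIso (PCl R A B) := by
  refine (CChom_qi _ _).2 fun k => ⟨?_, ?_⟩
  · rintro x hx ⟨⟨y1, y2⟩, hy⟩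
    exact ⟨y1, congrArg Prod.fst hy⟩
  · rintro ⟨a, b⟩ hab
    obtain ⟨ha, hb⟩ := cyc_prod.1 hab
    obtain ⟨w, hw⟩ := CC_subsing.1 (h k) b hb
    refine ⟨a, ha, (0, w), ?_⟩
    simp [hw]

lemma PC_fg (hA : FG R A) (hB : FG R B) (k : ℕ) : Module.Finite R ((PC R A B).homology k) := by
  have := hA k
  have := hB k
  refine Module.Finite.of_surjective ((HomologicalComplex.homologyMap (PCl R A B) k).hom.coprod (HomologicalComplex.homologyMap (PCr R A B) k).hom) ?_
  intro c
  obtain ⟨⟨⟨a, b⟩, hx⟩, rfl⟩ := mkH_surj _ k c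
  obtain ⟨ha, hb⟩ := cyc_prod.1 (mem_Zc_CC.1 hx)
  refine ⟨(mkH (SC R A) k ⟨a, mem_Zc_CC.2 ha⟩, mkH (SC R B) k ⟨b, mem_Zc_CC.2 hb⟩), ?_⟩
  rw [LinearMap.coprod_apply]
  refine (congrArg₂ (· + ·) (mkH_map _ _) (mkH_map _ _)).trans ?_
  rw [← map_add]
  congr 1
  refine Subtype.ext (Prod.ext ?_ ?_)
  · exact add_zero a
  · exact zero_add b

lemma MV.fg [IsNoetherianRing R] (h : MV iU iV jU jV) (hA : FG R A) (hB : FG R B) (hC : FG R C) : FG R X := by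
  intro k
  have : Module.Finite R ((SS R iU iV).homology k) := ses_fin (MVS_exact R h) hC (PC_fg hA hB) k
  exact Module.Finite.equiv (qiEquiv _ (SX_qi R h) k)

lemma MV.dim {F : Type} [Field F] (h : MV iU iV jU jV) (hA : FG F A) (hB : Acy F B) (hC : FG F C) 
    (hp : ∀ k, hd F C k = 0 ∨ hd F A k = 0) : 
    hd F X 0 = hd F A 0 ∧ ∀ k, hd F X (k+1) = hd F A (k+1) + hd F C k := by
  have e1 := fun k => (qiEquiv _ (PCl_qi (R := F) (A := A) hB) k)
  have e2 := fun k => (qiEquiv _ (SX_qi F h) k)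
  have hB' : FG F B := fun k => by
    have := hB k
    infer_instance
  have := ses_dim (MVS_exact F h) hC (PC_fg hA hB') (fun k => by
    refine (hp k).imp (fun h => ?_) (fun h => ?_)
    · have := hC k
      have h3 : Subsingleton ((SC F C).homology k) := Module.finrank_zero_iff.1 h
      exact h3
    · have := hA k
      have := Module.finrank_zero_iff.1 h
      exact (e1 k).symm.toEquiv.subsingleton)
  refine ⟨?_, fun k => ?_⟩
  · exact (e2 0).finrank_eq.symm.trans (this.1.trans (e1 0).finrank_eq.symm)
  · refine (e2 (k+1)).finrank_eq.symm.trans ((this.2 k).trans ?_)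
    congr 1
    exact (e1 (k+1)).finrank_eq.symm

variable {A' B' C' X' : Type} [TopologicalSpace A'] [TopologicalSpace B'] [TopologicalSpace C'] [TopologicalSpace X']
  {iU' : C(A', X')} {iV' : C(B', X')} {jU' : C(C', A')} {jV' : C(C', B')} 

lemma range_mem {k : ℕ} {f : C(X, X')} {fA : C(A, A')} {fB : C(B, B')} (hA : f.comp iU = iU'.comp fA) (hB : f.comp iV = iV'.comp fB)
    (x : Ch R X k) (hx : x ∈ SM R (Set.range iU) (Set.range iV) k) : mC R f k x ∈ SM R (Set.range iU') (Set.range iV') k := by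
  refine supported_induction _ _ _ (fun σ hσ => ?_) x hx
  rw [mC_single]
  refine Finsupp.single_mem_supported _ _ ?_
  refine hσ.imp (fun h => ?_) (fun h => ?_)
  · rintro _ ⟨t, rfl⟩
    obtain ⟨a, ha⟩ := h ⟨t, rfl⟩
    refine ⟨fA a, ?_⟩
    rw [ContinuousMap.comp_apply, ← ha]
    exact (DFunLike.congr_fun hA a).symm
  · rintro _ ⟨t, rfl⟩
    obtain ⟨a, ha⟩ := h ⟨t, rfl⟩
    refine ⟨fB a, ?_⟩
    rw [ContinuousMap.comp_apply, ← ha]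
    exact (DFunLike.congr_fun hB a).symm

lemma cyc_map {f : C(A, X)} {k : ℕ} {x : Ch R A k} (hx : cyc (dC R A) k x) : cyc (dC R X) k (mC R f k x) := by
  cases k with
  | zero => trivial
  | succ k => 
    have : dC R A k x = 0 := hx
    change dC R X k (mC R f (k+1) x) = 0
    rw [← mC_dC', this, map_zero]

lemma QI_iff {f : C(A, X)} : QI R f ↔ ∀ k, (∀ x : Ch R A k, cyc (dC R A) k x → (∃ y, dC R X k y = mC R f k x) → ∃ y, dC R A k y = x) ∧
    (∀ y : Ch R X k, cyc (dC R X) k y → ∃ x, cyc (dC R A) k x ∧ ∃ w, mC R f k x + dC R X k w = y) := CChom_qi _ _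

variable (R) in
def PCm (fA : C(A, A')) (fB : C(B, B')) : PC R A B ⟶ PC R A' B' :=
  CChom (fun k => (mC R fA k).prodMap (mC R fB k)) (fun k x => by simp [mC_dC'])

lemma PCm_qi {fA : C(A, A')} {fB : C(B, B')} (hA : QI R fA) (hB : QI R fB) : QuasiIso (PCm R fA fB) := by
  refine (CChom_qi _ _).2 fun k => ⟨?_, ?_⟩
  · rintro ⟨a, b⟩ hx ⟨⟨y1, y2⟩, hy⟩
    obtain ⟨ha, hb⟩ := cyc_prod.1 hx
    obtain ⟨w1, hw1⟩ := (QI_iff.1 hA k).1 a ha ⟨y1, congrArg Prod.fst hy⟩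
    obtain ⟨w2, hw2⟩ := (QI_iff.1 hB k).1 b hb ⟨y2, congrArg Prod.snd hy⟩
    exact ⟨(w1, w2), Prod.ext hw1 hw2⟩
  · rintro ⟨a, b⟩ hx
    obtain ⟨ha, hb⟩ := cyc_prod.1 hx
    obtain ⟨x1, hx1, w1, hw1⟩ := (QI_iff.1 hA k).2 a ha
    obtain ⟨x2, hx2, w2, hw2⟩ := (QI_iff.1 hB k).2 b hb
    exact ⟨(x1, x2), cyc_prod.2 ⟨hx1, hx2⟩, (w1, w2), Prod.ext hw1 hw2⟩

lemma MV.qi (h : MV iU iV jU jV) (h' : MV iU' iV' jU' jV') (f : C(X, X')) (fA : C(A, A')) (fB : C(B, B')) (fC : C(C, C'))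
    (eA : f.comp iU = iU'.comp fA) (eB : f.comp iV = iV'.comp fB) (eC : fA.comp jU = jU'.comp fC) (eC' : fB.comp jV = jV'.comp fC)
    (hA : QI R fA) (hB : QI R fB) (hC : QI R fC) : QI R f := by
  let τ₃ : SS R iU iV ⟶ SS R iU' iV' := CChom (fun k => (mC R f k).restrict (fun x hx => range_mem eA eB x hx)) (fun k x => by
    ext1; exact mC_dC' f k x.1)
  have key : ∀ {P Q S T : Type} [TopologicalSpace P] [TopologicalSpace Q] [TopologicalSpace S] [TopologicalSpace T]
    {f : C(P, Q)} {g : C(Q, S)} {f' : C(P, T)} {g' : C(T, S)} (h : g.comp f = g'.comp f') (k : ℕ) (x : Ch R P k),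
    mC R g k (mC R f k x) = mC R g' k (mC R f' k x) := by
      intro P Q S T _ _ _ _ f g f' g' h k x
      rw [← mC_comp', ← mC_comp', h]
  let φ : MVS R h ⟶ MVS R h' := 
    { τ₁ := SCm R fC
      τ₂ := PCm R fA fB
      τ₃ := τ₃
      comm₁₂ := by
        ext k x
        exact Prod.ext (key eC k x).symm (key eC' k x).symm
      comm₂₃ := by
        ext k x
        refine Subtype.ext ?_
        have h1 := key eA k x.1
        have h2 := key eB k x.2
        exact (congrArg₂ (fun a b : Ch R X' k => a + - b) h1.symm h2.symm).trans (by 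
          rw [← map_neg, ← map_add]; rfl) }
  have q1 : QuasiIso φ.τ₁ := hC
  have q2 : QuasiIso φ.τ₂ := PCm_qi hA hB
  have q3 : QuasiIso τ₃ := HomologicalComplex.HomologySequence.quasiIso_τ₃ φ (MVS_exact R h) (MVS_exact R h') q1 q2
  have e : τ₃ ≫ SX R iU' iV' = SX R iU iV ≫ SCm R f := by
    ext k x; rfl
  have s1 := SX_qi R h
  have s2 := SX_qi R h'
  have : QuasiIso (SX R iU iV ≫ SCm R f) := by rw [← e]; infer_instance
  exact quasiIso_of_comp_left (SX R iU iV) (SCm R f)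
end
end SSH

namespace SSH

section
variable {R : Type} [CommRing R] {X Y Q : Type} [TopologicalSpace X] [TopologicalSpace Y] [TopologicalSpace Q]

lemma QI.hd_eq {f : C(X, Y)} (h : QI R f) (k : ℕ) : hd R X k = hd R Y k := (qiEquiv _ h k).finrank_eq

lemma QI.fg_iff {f : C(X, Y)} (h : QI R f) : FG R X ↔ FG R Y := by
  refine forall_congr' fun k => ?_
  exact Module.Finite.equiv_iff (qiEquiv _ h k)

lemma QI.acy_iff {f : C(X, Y)} (h : QI R f) : Acy R X ↔ Acy R Y := by
  refine forall_congr' fun k => ?_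
  exact (qiEquiv _ h k).toEquiv.subsingleton_congr

lemma QI_homeo (e : X ≃ₜ Y) : QI R (e : C(X, Y)) := by
  refine QI_of_equiv R (g := (e.symm : C(Y, X))) ?_ ?_
  · have : (e.symm : C(Y, X)).comp (e : C(X, Y)) = ContinuousMap.id _ := by ext x; simp
    rw [this]
  · have : (e : C(X, Y)).comp (e.symm : C(Y, X)) = ContinuousMap.id _ := by ext x; simp
    rw [this]

lemma QI_of_isEmpty [IsEmpty Y] (f : C(X, Y)) : QI R f := by
  have : IsEmpty X := ⟨fun x => IsEmpty.false (f x)⟩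
  have e : X ≃ₜ Y := Homeomorph.empty
  have : f = (e : C(X, Y)) := by ext x; exact (IsEmpty.false x).elim
  rw [this]; exact QI_homeo e

instance : Subsingleton (C(Δ 0, X)) := ⟨fun f g => by
  ext t; exact absurd t.2.2 (by simp)⟩

lemma hd_empty [Nontrivial R] [IsEmpty X] (k : ℕ) : hd R X k = if k = 0 then 1 else 0 := by
  have hs : ∀ k, Subsingleton (Ch R X (k+1)) := by
    intro k
    have : IsEmpty C(Δ (k+1), X) := ⟨fun σ => IsEmpty.false (σ (stdSimplex.vertex 0))⟩
    infer_instance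
  cases k with
  | zero =>
    have : Unique C(Δ 0, X) := ⟨⟨⟨fun t => absurd t.2.2 (by simp), by
      have : IsEmpty (Δ 0) := ⟨fun t => absurd t.2.2 (by simp)⟩
      exact continuous_of_const fun x => (IsEmpty.false x).elim⟩⟩, fun _ => Subsingleton.elim _ _⟩
    have hb : Function.Bijective (mkH (SC R X) 0) := by
      refine ⟨?_, mkH_surj _ _⟩
      rw [← LinearMap.ker_eq_bot, LinearMap.ker_eq_bot']
      intro x hx
      obtain ⟨y, hy⟩ := (mkH_eq_zero _ _).1 hx
      have : y = 0 := (hs 0).elim _ _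
      rw [this, map_zero] at hy
      exact Subtype.ext hy.symm
    have e1 := LinearEquiv.ofBijective _ hb
    have h2 : Zc (SC R X) 0 = ⊤ := by
      ext x; simp [mem_Zc_zero]
    rw [h2] at e1
    have e2 : (Ch R X 0) ≃ₗ[R] R := Finsupp.LinearEquiv.finsuppUnique R R _
    have e3 := (e1.symm.trans Submodule.topEquiv)
    have : hd R X 0 = Module.finrank R (Ch R X 0) := e3.finrank_eq
    rw [this, e2.finrank_eq]; simp
  | succ k =>
    have : Subsingleton ((SC R X).homology (k+1)) := CC_subsing.2 fun x _ => ⟨0, (hs k).elim _ _⟩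
    rw [hd, Module.finrank_zero_of_subsingleton]; rfl

lemma FG_empty [IsNoetherianRing R] [IsEmpty X] : FG R X := by
  intro k
  have : Finite C(Δ k, X) := by
    cases k with
    | zero => infer_instance
    | succ k => 
      have : IsEmpty C(Δ (k+1), X) := ⟨fun σ => IsEmpty.false (σ (stdSimplex.vertex 0))⟩
      infer_instance
  have : Module.Finite R ((SC R X).X k) := Module.Finite.finsupp (R := R) (V := R) (ι := C(Δ k, X))
  exact Module.Finite.of_surjective _ (mkH_surj (SC R X) k)

lemma Acy.fg (h : Acy R X) : FG R X := fun k => by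
  have := h k
  infer_instance

lemma Acy.hd_eq [Nontrivial R] (h : Acy R X) (k : ℕ) : hd R X k = 0 := by
  have := h k
  exact Module.finrank_zero_of_subsingleton

lemma Acy_unit : Acy R Unit := by
  intro k
  refine CC_subsing.2 ?_
  intro x hx
  have hu : ∀ k, ∃ σ : C(Δ k, Unit), ∀ τ, τ = σ := fun k => ⟨⟨fun _ => (), continuous_const⟩, fun τ => by ext⟩
  choose u hu using hu
  have hd1 : ∀ k a, dC R Unit k (Finsupp.single (u (k+1)) a) = (∑ i : Fin (k+1), ((-1 : R)^(i:ℕ))) • Finsupp.single (u k) a := by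
    intro k a
    rw [dC_single, Finset.sum_smul]
    exact Finset.sum_congr rfl fun i _ => by rw [hu _ (fc i _)]
  have hsum : ∀ k, (∑ i : Fin (k+1), ((-1 : R)^(i:ℕ))) = if Even k then 1 else 0 := by
    intro k
    rw [Fin.sum_univ_eq_sum_range (fun i => (-1 : R)^i), neg_one_geom_sum]
    simp only [Nat.even_add_one]
    by_cases h : Even k <;> simp [h]
  have hx1 : ∀ k (x : Ch R Unit k), ∃ a, x = Finsupp.single (u k) a := by
    intro k x
    refine ⟨x (u k), ?_⟩
    ext τ
    rw [hu k τ]; simp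
  by_cases hk : Even k
  · obtain ⟨a, rfl⟩ := hx1 k x
    refine ⟨Finsupp.single (u (k+1)) a, ?_⟩
    rw [hd1, hsum, if_pos hk, one_smul]
  · obtain ⟨m, rfl⟩ := Nat.exists_eq_succ_of_ne_zero (n := k) (by rintro rfl; simp at hk)
    have hx' : dC R Unit m x = 0 := hx
    obtain ⟨a, rfl⟩ := hx1 _ x
    have hm : Even m := by simpa [Nat.even_add_one] using hk
    rw [hd1, hsum, if_pos hm, one_smul, Finsupp.single_eq_zero] at hx'
    subst hx'
    exact ⟨0, by simp⟩

lemma Acy_of_homotopic {x0 : X} (h : (ContinuousMap.id X).Homotopic (ContinuousMap.const X x0)) : Acy R X := by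
  have : QI R (ContinuousMap.const X ()) := by
    refine QI_of_equiv R (g := ContinuousMap.const Unit x0) ?_ ?_
    · exact h.symm
    · have : (ContinuousMap.const X ()).comp (ContinuousMap.const Unit x0) = ContinuousMap.id _ := by ext
      rw [this]
  exact this.acy_iff.2 Acy_unit

lemma Acy_of_contractible [ContractibleSpace X] : Acy R X := by
  obtain ⟨x0, h⟩ := (contractible_iff_id_nullhomotopic X).1 inferInstance
  exact Acy_of_homotopic h

/-- inclusion of sets -/
def inc {U W : Set Q} (h : U ⊆ W) : C(U, W) := ⟨Set.inclusion h, continuous_inclusion h⟩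

lemma MV_sets {U V I W O1 O2 : Set Q} (h1 : IsOpen O1) (h2 : IsOpen O2) (hU : U = W ∩ O1) (hV : V = W ∩ O2) (hI : I = U ∩ V)
    (hW : W ⊆ O1 ∪ O2) (hUW : U ⊆ W) (hVW : V ⊆ W) (hIU : I ⊆ U) (hIV : I ⊆ V) : MV (inc hUW) (inc hVW) (inc hIU) (inc hIV) where
  eU := Topology.IsEmbedding.inclusion hUW
  eV := Topology.IsEmbedding.inclusion hVW
  eC := Topology.IsEmbedding.inclusion hIU
  oU := by
    have : Set.range (inc hUW) = Subtype.val ⁻¹' O1 := by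
      subst hU
      change Set.range (Set.inclusion Set.inter_subset_left) = _
      rw [Set.range_inclusion]
      ext ⟨x, hx⟩
      simp [hx]
    rw [this]; exact h1.preimage continuous_subtype_val
  oV := by
    have : Set.range (inc hVW) = Subtype.val ⁻¹' O2 := by
      subst hV
      change Set.range (Set.inclusion Set.inter_subset_left) = _
      rw [Set.range_inclusion]
      ext ⟨x, hx⟩
      simp [hx]
    rw [this]; exact h2.preimage continuous_subtype_val
  cov := by
    subst hU hV
    ext ⟨x, hx⟩
    simp only [Set.mem_union, Set.mem_univ, iff_true]
    rcases hW hx with h | h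
    · exact Or.inl ⟨⟨x, hx, h⟩, rfl⟩
    · exact Or.inr ⟨⟨x, hx, h⟩, rfl⟩
  comm := rfl
  inter := by
    rintro ⟨a, ha⟩ ⟨b, hb⟩ h
    have : a = b := congrArg Subtype.val h
    subst this
    exact ⟨⟨a, by rw [hI]; exact ⟨ha, hb⟩⟩, rfl⟩

lemma deform {P0 P : Set Q} (h : P0 ⊆ P) (H : unitInterval × Q → Q) (hc : Continuous H) (h0 : ∀ x ∈ P, H (0, x) = x)
    (h1 : ∀ s, ∀ x ∈ P, H (s, x) ∈ P) (h2 : ∀ x ∈ P, H (1, x) ∈ P0) (h3 : ∀ s, ∀ x ∈ P0, H (s, x) ∈ P0) : QI R (inc h) := by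
  refine QI_of_equiv R (g := ⟨fun x : P => ⟨H (1, x.1), h2 _ x.2⟩, by fun_prop⟩) ?_ ?_
  · refine ContinuousMap.Homotopic.symm ⟨⟨⟨fun x : unitInterval × P0 => ⟨H (x.1, x.2.1), h3 _ _ x.2.2⟩, by fun_prop⟩, ?_, ?_⟩⟩
    · intro x; exact Subtype.ext (h0 x.1 (h x.2))
    · intro x; rfl
  · refine ContinuousMap.Homotopic.symm ⟨⟨⟨fun x : unitInterval × P => ⟨H (x.1, x.2.1), h1 _ _ x.2.2⟩, by fun_prop⟩, ?_, ?_⟩⟩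
    · intro x; exact Subtype.ext (h0 x.1 (x.2))
    · intro x; rfl

lemma contr {P : Set Q} (q : Q) (hq : q ∈ P) (H : unitInterval × Q → Q) (hc : Continuous H) (h0 : ∀ x ∈ P, H (0, x) = x)
    (h1 : ∀ s, ∀ x ∈ P, H (s, x) ∈ P) (h2 : ∀ x ∈ P, H (1, x) = q) : Acy R P := by
  refine Acy_of_homotopic (x0 := ⟨q, hq⟩) ⟨⟨⟨fun x : unitInterval × P => ⟨H (x.1, x.2.1), h1 _ _ x.2.2⟩, by fun_prop⟩, ?_, ?_⟩⟩
  · intro x; exact Subtype.ext (h0 x.1 (x.2))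
  · intro x; exact Subtype.ext (h2 x.1 x.2)

/-- induction over finite open covers -/
lemma cover_ind {ι : Type} [DecidableEq ι] (O : ι → Set Q) (hO : ∀ i, IsOpen (O i)) (P : Set Q → Prop) (h0 : P ∅)
    (hun : ∀ U V, IsOpen U → IsOpen V → P U → P V → P (U ∩ V) → P (U ∪ V))
    (hP : ∀ J : Finset ι, J.Nonempty → P (⋂ j ∈ J, O j)) (S : Finset ι) : P (⋃ s ∈ S, O s) := by
  have key : ∀ S J : Finset ι, P ((⋃ s ∈ S, O s) ∩ ⋂ j ∈ J, O j) := by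
    intro S
    induction S using Finset.induction_on with
    | empty => intro J; simpa using h0
    | insert s S hs ih =>
      intro J
      have oJ : IsOpen (⋂ j ∈ J, O j) := isOpen_biInter_finset fun j _ => hO j
      have oS : IsOpen (⋃ s ∈ S, O s) := isOpen_biUnion fun j _ => hO j
      rw [Finset.set_biUnion_insert, Set.union_inter_distrib_right]
      refine hun _ _ ((hO s).inter oJ) (oS.inter oJ) ?_ (ih J) ?_
      · have := hP (insert s J) ⟨s, by simp⟩
        rwa [Finset.set_biInter_insert] at this
      · have := ih (insert s J)
        rw [Finset.set_biInter_insert] at this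
        convert this using 1
        ext x; simp only [Set.mem_inter_iff]; tauto
  simpa using key S ∅

lemma MV_open {U V : Set Q} (hU : IsOpen U) (hV : IsOpen V) : MV (inc (Set.subset_union_left : U ⊆ U ∪ V)) (inc (Set.subset_union_right : V ⊆ U ∪ V))
   (inc (Set.inter_subset_left : U ∩ V ⊆ U)) (inc (Set.inter_subset_right : U ∩ V ⊆ V)) :=
  MV_sets hU hV (Set.union_inter_cancel_left).symm (Set.union_inter_cancel_right).symm rfl subset_rfl _ _ _ _

lemma cover_fg [IsNoetherianRing R] {ι : Type} (O : ι → Set Q) (hO : ∀ i, IsOpen (O i)) 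
    (hP : ∀ J : Finset ι, J.Nonempty → FG R (⋂ j ∈ J, O j : Set Q)) (S : Finset ι) : FG R (⋃ s ∈ S, O s : Set Q) := by
  classical
  refine cover_ind O hO (fun U => FG R U) FG_empty ?_ hP S
  intro U V hU hV h1 h2 h3
  exact (MV_open hU hV).fg h1 h2 h3

lemma cover_qi (f : C(X, Q)) {ι : Type} (O : ι → Set Q) (hO : ∀ i, IsOpen (O i)) 
    (hP : ∀ J : Finset ι, J.Nonempty → QI R (f.restrictPreimage (⋂ j ∈ J, O j : Set Q))) (S : Finset ι) : 
    QI R (f.restrictPreimage (⋃ s ∈ S, O s : Set Q)) := by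
  classical
  refine cover_ind O hO (fun U => QI R (f.restrictPreimage U)) (QI_of_isEmpty _) ?_ hP S
  intro U V hU hV h1 h2 h3
  exact (MV_open (hU.preimage f.continuous) (hV.preimage f.continuous)).qi (MV_open hU hV) 
    (f.restrictPreimage (U ∪ V)) _ _ _ rfl rfl rfl rfl h1 h2 h3

end
end SSH

namespace SSH

section
variable {R : Type} [CommRing R] {E B : Type} [TopologicalSpace E] [TopologicalSpace B]

lemma cyc_homotopic {f g : C(E, B)} (h : f.Homotopic g) {k : ℕ} {x : Ch R E k} (hx : cyc (dC R E) k x) :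
    ∃ w, dC R B k w = mC R f k x - mC R g k x := by
  obtain ⟨h0, D, hD⟩ := Hty.of_homotopic (R := R) h
  cases k with
  | zero => exact ⟨0, by rw [map_zero, h0, sub_self]⟩
  | succ k =>
    have hx : dC R E k x = 0 := hx
    exact ⟨D (k+1) x, by rw [hD, hx, map_zero, add_zero]⟩

variable {F : Type} [Group F] [Fintype F] [MulAction F E] [ContinuousConstSMul F E]

variable (E) in
def acm (u : F) : C(E, E) := ⟨fun x => u • x, continuous_const_smul u⟩

lemma transfer (f : C(E, B)) (hF : IsUnit (Fintype.card F : R)) (hinv : ∀ (u : F) x, f (u • x) = f x)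
    (hlift : ∀ k (σ : C(Δ k, B)), ∃ τ : C(Δ k, E), f.comp τ = σ)
    (huniq : ∀ k (τ τ' : C(Δ k, E)), f.comp τ = f.comp τ' → ∃ u : F, τ' = (acm E u).comp τ)
    (hhom : ∀ u : F, (acm E u).Homotopic (ContinuousMap.id E)) : QI R f := by
  choose L hL using hlift
  let tr : ∀ k, Ch R B k →ₗ[R] Ch R E k := fun k =>
    ∑ u : F, (mC R (acm E u) k) ∘ₗ Finsupp.lmapDomain R R (L k)
  have tr_single : ∀ k (τ : C(Δ k, E)), tr k (Finsupp.single (f.comp τ) 1) = ∑ u : F, Finsupp.single ((acm E u).comp τ) (1:R) := by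
    intro k τ
    obtain ⟨v, hv⟩ := huniq k τ (L k (f.comp τ)) (hL k _).symm
    simp only [tr, LinearMap.sum_apply, LinearMap.comp_apply, Finsupp.lmapDomain_apply, Finsupp.mapDomain_single, mC_single]
    rw [hv]
    refine Fintype.sum_equiv (Equiv.mulRight v) _ _ fun u => ?_
    congr 1
    ext t
    simp [acm, mul_smul]
  have tr_d : ∀ k (x : Ch R B (k+1)), tr k (dC R B k x) = dC R E k (tr (k+1) x) := by
    intro k x
    have : tr k ∘ₗ dC R B k = dC R E k ∘ₗ tr (k+1) := by
      ext σ : 2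
      simp only [LinearMap.comp_apply, Finsupp.lsingle_apply]
      obtain ⟨τ, rfl⟩ : ∃ τ, f.comp τ = σ := ⟨_, hL _ σ⟩
      rw [tr_single, dC_single, map_sum, map_sum]
      simp only [map_smul, dC_single]
      rw [Finset.sum_comm]
      refine Finset.sum_congr rfl fun i _ => ?_
      rw [← Finset.smul_sum]
      congr 1
      exact tr_single k (fc i τ)
    exact LinearMap.congr_fun this x
  have tr_f : ∀ k x, tr k (mC R f k x) = ∑ u : F, mC R (acm E u) k x := by
    intro k x
    have : tr k ∘ₗ mC R f k = ∑ u : F, mC R (acm E u) k := by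
      ext τ : 2
      simp only [LinearMap.comp_apply, Finsupp.lsingle_apply, mC_single, tr_single, LinearMap.sum_apply]
    rw [← LinearMap.sum_apply, ← this]; rfl
  have f_tr : ∀ k x, mC R f k (tr k x) = (Fintype.card F : R) • x := by
    intro k x
    have : mC R f k ∘ₗ tr k = (Fintype.card F : R) • LinearMap.id := by
      ext σ : 2
      obtain ⟨τ, rfl⟩ : ∃ τ, f.comp τ = σ := ⟨_, hL _ σ⟩
      simp only [LinearMap.comp_apply, Finsupp.lsingle_apply, tr_single, map_sum, mC_single, LinearMap.smul_apply, LinearMap.id_apply]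
      have : ∀ u : F, f.comp ((acm E u).comp τ) = f.comp τ := by
        intro u; ext t; exact hinv u _
      simp only [this]
      rw [Finset.sum_const, Finset.card_univ, Nat.cast_smul_eq_nsmul]
    exact LinearMap.congr_fun this x
  obtain ⟨c, hc⟩ := hF.exists_left_inv
  rw [QI_iff]
  intro k
  constructor
  · rintro x hx ⟨y, hy⟩
    have h1 := tr_f k x
    rw [← hy, tr_d] at h1
    choose w hw using fun u : F => cyc_homotopic (R := R) (hhom u) hx
    refine ⟨c • (tr (k+1) y - ∑ u, w u), ?_⟩
    rw [map_smul, map_sub, h1, map_sum]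
    simp only [hw, mC_id, LinearMap.id_apply, Finset.sum_sub_distrib, sub_sub_cancel]
    rw [Finset.sum_const, Finset.card_univ, ← Nat.cast_smul_eq_nsmul R, smul_smul, hc, one_smul]
  · intro y hy
    refine ⟨c • tr k y, ?_, 0, ?_⟩
    · cases k with
      | zero => trivial
      | succ k =>
        have hy : dC R B k y = 0 := hy
        change dC R E k _ = 0
        rw [map_smul, ← tr_d, hy, map_zero, smul_zero]
    · rw [map_zero, add_zero, map_smul, f_tr, smul_smul, hc, one_smul]
end
end SSH

namespace SSH

section
variable {J B : Type} [Fintype J] [TopologicalSpace B]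

instance : IsEmpty (Δ 0) := ⟨fun t => absurd t.2.2 (by simp)⟩

lemma circle_path (u : J → Circle) : ∃ g : C(unitInterval, J → Circle), g 0 = 1 ∧ g 1 = u := by
  refine ⟨⟨fun s j => Circle.exp (s.1 * Complex.arg (u j)), by fun_prop⟩, ?_, ?_⟩
  · ext j; simp
  · ext j; simp [Circle.exp_arg]

lemma finite_tor (m : ℕ) (hm : m ≠ 0) : {u : J → Circle | u ^ m = 1}.Finite := by
  have h1 : {u : Circle | u ^ m = 1}.Finite := by
    refine Set.Finite.of_finite_image (f := fun u : Circle => (u : ℂ)) ?_ (Circle.coe_injective.injOn)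
    refine Set.Finite.subset (Polynomial.nthRoots m (1:ℂ)).toFinset.finite_toSet ?_
    rintro _ ⟨u, hu, rfl⟩
    have hu : u ^ m = 1 := hu
    simp only [Finset.mem_coe, Multiset.mem_toFinset]
    rw [Polynomial.mem_nthRoots (Nat.pos_of_ne_zero hm), ← Circle.coe_pow, hu, Circle.coe_one]
  refine (Set.Finite.pi' (fun _ : J => h1)).subset ?_
  intro u hu j
  exact congrFun hu j

lemma transfer_torus [T2Space B] {p : ℕ} [Fact p.Prime] (f : C(J → Circle, B)) (F : Subgroup (J → Circle)) (m : ℕ) (hm : ∀ u ∈ F, u ^ m = 1)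
    (hp : ¬ p ∣ m) (hs : Function.Surjective f) (hf : ∀ e₁ e₂, f e₁ = f e₂ ↔ e₂ * e₁⁻¹ ∈ F) : QI (ZMod p) f := by
  have hm0 : m ≠ 0 := by rintro rfl; simp at hp
  have hfin : (F : Set (J → Circle)).Finite := (finite_tor m hm0).subset hm
  have : Finite F := hfin
  have : Fintype F := Fintype.ofFinite _
  have hq : Topology.IsQuotientMap f := IsClosedMap.isQuotientMap f.continuous.isClosedMap f.continuous hs
  have hc := (hq.isQuotientCoveringMap_of_subgroup F hfin.isDiscrete (fun {_ _} => hf _ _)).isCoveringMap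
  have act : ∀ (u : F) (x : J → Circle), u • x = u.1 * x := fun u x => rfl
  have hcs : ContinuousConstSMul F (J → Circle) := ⟨fun u => by simp only [act]; fun_prop⟩
  refine transfer (F := F) f ?_ ?_ ?_ ?_ ?_
  · rw [isUnit_iff_ne_zero, Ne, ZMod.natCast_eq_zero_iff]
    intro h
    obtain ⟨u, hu⟩ := exists_prime_orderOf_dvd_card p h
    apply hp
    rw [← hu]
    apply orderOf_dvd_of_pow_eq_one
    exact Subtype.ext (hm u.1 u.2)
  · intro u x
    rw [hf, act, mul_inv_rev, mul_inv_cancel_left]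
    exact F.inv_mem u.2
  · intro k σ
    cases k with
    | zero => exact ⟨⟨fun t => isEmptyElim t, continuous_of_const fun x => isEmptyElim x⟩, Subsingleton.elim _ _⟩
    | succ k => 
      have : ContractibleSpace (Δ (k+1)) := (convex_stdSimplex ℝ (Fin (k+1))).contractibleSpace ⟨_, (stdSimplex.vertex (S := ℝ) (0 : Fin (k+1))).2⟩
      have : LocallyPathConnectedSpace (Δ (k+1)) := (convex_stdSimplex ℝ (Fin (k+1))).locallyPathConnectedSpace
      obtain ⟨e, he⟩ := hs (σ (stdSimplex.vertex 0))
      obtain ⟨τ, ⟨-, h⟩, -⟩ := hc.existsUnique_continuousMap_lifts σ (stdSimplex.vertex 0) e he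
      exact ⟨τ, by ext t; exact congrFun h t⟩
  · intro k τ τ' h
    cases k with
    | zero => exact ⟨1, Subsingleton.elim _ _⟩
    | succ k => 
      have h0 : f (τ (stdSimplex.vertex 0)) = f (τ' (stdSimplex.vertex 0)) := congrArg (fun g : C(Δ (k+1), B) => g (stdSimplex.vertex 0)) h
      refine ⟨⟨_, (hf _ _).1 h0⟩, ?_⟩
      have := hc.eq_of_comp_eq (g₁ := τ') (g₂ := (acm (J → Circle) (⟨_, (hf _ _).1 h0⟩ : F)).comp τ) τ'.continuous (ContinuousMap.continuous _) ?_ (stdSimplex.vertex 0) ?_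
      · exact DFunLike.coe_injective this
      · ext t
        have h1 : f (τ t) = f (τ' t) := congrArg (fun g : C(Δ (k+1), B) => g t) h
        change f (τ' t) = f ((⟨_, (hf _ _).1 h0⟩ : F) • τ t)
        rw [← h1, hf, act, mul_inv_cancel_right]
        exact (hf _ _).1 h0
      · change _ = (_ * _) * τ (stdSimplex.vertex 0)
        rw [inv_mul_cancel_right]
  · intro u
    obtain ⟨g, g0, g1⟩ := circle_path u.1
    refine ContinuousMap.Homotopic.symm ⟨⟨⟨fun x => g x.1 * x.2, by fun_prop⟩, ?_, ?_⟩⟩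
    · intro x; simp [g0]
    · intro x; simp [g1]; rfl

end
end SSH

namespace SSH

section
variable {F : Type} [Field F]

abbrev Pun (V : Type) [Zero V] : Set V := {v | v ≠ 0}

def punHomeo {V W : Type} [NormedAddCommGroup V] [NormedSpace ℝ V] [NormedAddCommGroup W] [NormedSpace ℝ W] (e : V ≃L[ℝ] W) : Pun V ≃ₜ Pun W :=
  e.toHomeomorph.subtype (by intro a; simp)

lemma pun_step {V : Type} [NormedAddCommGroup V] [NormedSpace ℝ V] (h : FG F (Pun V)) :
    FG F (Pun (V × ℝ)) ∧ hd F (Pun (V × ℝ)) 0 = 0 ∧ ∀ k, hd F (Pun (V × ℝ)) (k+1) = hd F (Pun V) k := by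
  let O1 : Set (V × ℝ) := {q | q.1 ≠ 0 ∨ 0 < q.2}
  let O2 : Set (V × ℝ) := {q | q.1 ≠ 0 ∨ q.2 < 0}
  let I : Set (V × ℝ) := {q | q.1 ≠ 0}
  have h1 : IsOpen O1 := (isOpen_ne_fun continuous_fst continuous_const).union (isOpen_lt continuous_const continuous_snd)
  have h2 : IsOpen O2 := (isOpen_ne_fun continuous_fst continuous_const).union (isOpen_lt continuous_snd continuous_const)
  have s1 : O1 ⊆ Pun (V × ℝ) := by
    rintro q (hq | hq) h0 <;> simp [h0] at hq
  have s2 : O2 ⊆ Pun (V × ℝ) := by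
    rintro q (hq | hq) h0 <;> simp [h0] at hq
  have i1 : I ⊆ O1 := fun q hq => Or.inl hq
  have i2 : I ⊆ O2 := fun q hq => Or.inl hq
  have mv : MV (inc s1) (inc s2) (inc i1) (inc i2) := by
    refine MV_sets h1 h2 (Set.inter_eq_right.2 s1).symm (Set.inter_eq_right.2 s2).symm ?_ ?_ _ _ _ _
    · ext q
      simp only [O1, O2, I, Set.mem_inter_iff, Set.mem_setOf_eq]
      constructor
      · exact fun h => ⟨Or.inl h, Or.inl h⟩
      · rintro ⟨h | h, h' | h'⟩
        · exact h
        · exact h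
        · exact h'
        · linarith
    · intro q hq
      simp only [O1, O2, Set.mem_union, Set.mem_setOf_eq]
      by_cases hq1 : q.1 = 0
      · have : q.2 ≠ 0 := fun h => hq (Prod.ext hq1 h)
        rcases lt_or_gt_of_ne this with h | h
        · exact Or.inr (Or.inr h)
        · exact Or.inl (Or.inr h)
      · exact Or.inl (Or.inl hq1)
  have a1 : Acy F O1 := by
    refine contr ((0 : V), (1:ℝ)) (Or.inr (by simp)) (fun q => ((1 - q.1.1) • q.2.1, (1 - q.1.1) * q.2.2 + q.1.1)) (by fun_prop) ?_ ?_ ?_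
    · intro x _; simp
    · intro s x hx
      rcases eq_or_lt_of_le s.2.2 with hs | hs
      · exact Or.inr (by simp [hs])
      · have hs' : 0 < 1 - s.1 := by linarith
        rcases hx with hx | hx
        · exact Or.inl (smul_ne_zero hs'.ne' hx)
        · refine Or.inr ?_
          have := mul_pos hs' hx
          have := s.2.1
          change 0 < (1 - s.1) * x.2 + s.1
          linarith
    · intro x _; simp
  have a2 : Acy F O2 := by
    refine contr ((0 : V), (-1:ℝ)) (Or.inr (by simp)) (fun q => ((1 - q.1.1) • q.2.1, (1 - q.1.1) * q.2.2 - q.1.1)) (by fun_prop) ?_ ?_ ?_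
    · intro x _; simp
    · intro s x hx
      rcases eq_or_lt_of_le s.2.2 with hs | hs
      · exact Or.inr (by simp [hs])
      · have hs' : 0 < 1 - s.1 := by linarith
        rcases hx with hx | hx
        · exact Or.inl (smul_ne_zero hs'.ne' hx)
        · refine Or.inr ?_
          have := mul_neg_of_pos_of_neg hs' hx
          have := s.2.1
          change (1 - s.1) * x.2 - s.1 < 0
          linarith
    · intro x _; simp
  let g : C(Pun V, I) := ⟨fun v => ⟨(v.1, 0), v.2⟩, by fun_prop⟩
  have hg : QI F g := by
    refine QI_of_equiv F (g := ⟨fun q : I => ⟨q.1.1, q.2⟩, by fun_prop⟩) ?_ ?_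
    · exact ContinuousMap.Homotopic.refl _
    · refine ⟨⟨⟨fun q : unitInterval × I => ⟨(q.2.1.1, q.1.1 * q.2.1.2), q.2.2⟩, by fun_prop⟩, ?_, ?_⟩⟩
      · intro x; simp [g]
      · intro x; simp
  have hI : FG F I := hg.fg_iff.1 h
  refine ⟨mv.fg a1.fg a2.fg hI, ?_⟩
  obtain ⟨e0, e1⟩ := mv.dim a1.fg a2 hI (fun k => Or.inr (a1.hd_eq k))
  refine ⟨by rw [e0, a1.hd_eq], fun k => ?_⟩
  rw [e1, a1.hd_eq, zero_add, hg.hd_eq]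

lemma pun_hd (d : ℕ) : ∀ (V : Type) [NormedAddCommGroup V] [NormedSpace ℝ V] [FiniteDimensional ℝ V], Module.finrank ℝ V = d →
    FG F (Pun V) ∧ ∀ k, hd F (Pun V) k = if k = d then 1 else 0 := by
  induction d with
  | zero =>
    intro V _ _ _ hV
    have := Module.finrank_zero_iff.1 hV
    have : IsEmpty (Pun V) := ⟨fun v => v.2 (Subsingleton.elim _ _)⟩
    exact ⟨FG_empty, hd_empty⟩
  | succ d ih =>
    intro V _ _ _ hV
    obtain ⟨h1, h2⟩ := ih (Fin d → ℝ) (by simp)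
    obtain ⟨a, b, c⟩ := pun_step h1
    let e : ((Fin d → ℝ) × ℝ) ≃L[ℝ] V := ContinuousLinearEquiv.ofFinrankEq (by simp [hV])
    have q := QI_homeo (R := F) (punHomeo e)
    refine ⟨q.fg_iff.1 a, fun k => ?_⟩
    rw [← q.hd_eq]
    cases k with
    | zero => simp [b]
    | succ k => rw [c, h2]; simp

lemma punC {E : Type} [Fintype E] : FG F (Pun (E → ℂ)) ∧ ∀ k, hd F (Pun (E → ℂ)) k = if k = 2 * Fintype.card E then 1 else 0 :=
  pun_hd _ _ (by simp [Module.finrank_pi_fintype, mul_comm])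

end
end SSH

namespace SSH

section
variable {R : Type} [CommRing R] [IsNoetherianRing R]

def nrm (w : ℂ) (hw : w ≠ 0) : Circle := ⟨w / ‖w‖, mem_sphere_zero_iff_norm.2 (by simp [hw])⟩

lemma cnorm (u : Circle) : ‖(u : ℂ)‖ = 1 := mem_sphere_zero_iff_norm.1 u.2

lemma nrm_self (u : Circle) : nrm (u : ℂ) (Circle.coe_ne_zero u) = u := by
  ext; simp [nrm, cnorm]

lemma FG_circle {Y : Type} [TopologicalSpace Y] (hY : FG R Y) : FG R (Y × Circle) := by
  let c : Fin 4 → ℂ := ![1, -1, Complex.I, -Complex.I]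
  let O : Fin 4 → Set (Y × Circle) := fun j => {q | 0 < ((q.2 : ℂ) * c j).re}
  have hO : ∀ j, IsOpen (O j) := fun j => isOpen_lt continuous_const (by fun_prop)
  have key : FG R (⋃ s ∈ (Finset.univ : Finset (Fin 4)), O s : Set (Y × Circle)) := by
    refine cover_fg O hO ?_ _
    intro J hJ
    set P : Set (Y × Circle) := ⋂ j ∈ J, O j with hPd
    have mP : ∀ q : Y × Circle, q ∈ P ↔ ∀ j ∈ J, 0 < ((q.2 : ℂ) * c j).re := fun q => by simp [P, O]
    by_cases he : IsEmpty P
    · exact FG_empty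
    rw [not_isEmpty_iff] at he
    obtain ⟨⟨⟨y0, u0⟩, h0⟩⟩ := he
    rw [mP] at h0
    have hpos : ∀ (s : unitInterval) (q : Y × Circle), q ∈ P → ∀ j ∈ J, 0 < (((1 - s.1 : ℝ) * (q.2 : ℂ) + (s.1 : ℝ) * u0) * c j).re := by
      intro s q hq j hj
      have h1 := (mP q).1 hq j hj
      have h2 := h0 j hj
      have e : (((1 - s.1 : ℝ) * (q.2 : ℂ) + (s.1 : ℝ) * u0) * c j).re = (1 - s.1) * ((q.2 : ℂ) * c j).re + s.1 * ((u0:ℂ) * c j).re := by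
        rw [add_mul, Complex.add_re, mul_assoc, mul_assoc, Complex.re_ofReal_mul, Complex.re_ofReal_mul]
      rw [e]
      have s0 := s.2.1
      have s1 := s.2.2
      rcases eq_or_lt_of_le s1 with h | h
      · rw [h]; simpa using h2
      · have := mul_pos (sub_pos.2 h) h1
        have := mul_nonneg s0 h2.le
        linarith
    obtain ⟨j0, hj0⟩ := hJ
    have hne : ∀ (s : unitInterval) (q : P), ((1 - s.1 : ℝ) * (q.1.2 : ℂ) + (s.1 : ℝ) * u0) ≠ 0 := by
      intro s q h
      have := hpos s q.1 q.2 j0 hj0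
      rw [h] at this; simp at this
    let g : C(Y, P) := ⟨fun y => ⟨(y, u0), (mP _).2 h0⟩, by fun_prop⟩
    have hg : QI R g := by
      refine QI_of_equiv R (g := ⟨fun q : P => q.1.1, by fun_prop⟩) ?_ ?_
      · exact ContinuousMap.Homotopic.refl _
      · refine ContinuousMap.Homotopic.symm ⟨⟨⟨fun q : unitInterval × P => ⟨(q.2.1.1, nrm _ (hne q.1 q.2)), ?_⟩, ?_⟩, ?_, ?_⟩⟩
        · rw [mP]
          intro j hj
          have := hpos q.1 q.2.1 q.2.2 j hj
          have hn := norm_pos_iff.2 (hne q.1 q.2)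
          have e : ∀ w a : ℂ, (w / (‖w‖ : ℂ) * a).re = (w * a).re / ‖w‖ := by
            intro w a
            rw [div_mul_eq_mul_div, Complex.div_ofReal_re]
          change 0 < (_ / ((‖_‖ : ℝ) : ℂ) * c j).re
          rw [e]
          positivity
        · refine Continuous.subtype_mk (Continuous.prodMk (by fun_prop) (Continuous.subtype_mk ?_ _)) _
          refine Continuous.div (by fun_prop) (by fun_prop) ?_
          intro q
          simpa using hne q.1 q.2
        · intro q
          refine Subtype.ext (Prod.ext rfl ?_)
          ext; simp [nrm, cnorm]
        · intro q
          refine Subtype.ext (Prod.ext rfl ?_)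
          ext; simp [nrm, cnorm, g]
    exact hg.fg_iff.1 hY
  have hu : (⋃ s ∈ (Finset.univ : Finset (Fin 4)), O s : Set (Y × Circle)) = Set.univ := by
    rw [Set.eq_univ_iff_forall]
    rintro ⟨y, u⟩
    simp only [Finset.mem_univ, Set.iUnion_true, Set.mem_iUnion]
    by_contra! h
    have h0 := h 0
    have h1 := h 1
    have h2 := h 2
    have h3 := h 3
    simp [O, c] at h0 h1 h2 h3
    apply Circle.coe_ne_zero u
    apply Complex.ext <;> simp <;> linarith
  rw [hu] at key
  exact (QI_homeo (Homeomorph.Set.univ _)).fg_iff.1 key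

lemma FG_torus (d : ℕ) : FG R (Fin d → Circle) := by
  induction d with
  | zero => exact Acy.fg (Acy_of_contractible)
  | succ d ih =>
    have := FG_circle ih
    have e : (Fin d → Circle) × Circle ≃ₜ (Fin (d+1) → Circle) :=
      { toFun := fun q => Fin.cons q.2 q.1
        invFun := fun f => (fun i => f i.succ, f 0)
        left_inv := fun q => by simp
        right_inv := fun f => by ext i; refine Fin.cases ?_ ?_ i <;> simp
        continuous_toFun := by
          refine continuous_pi fun i => ?_
          refine Fin.cases ?_ ?_ i
          · simpa using continuous_snd
          · intro i; simp only [Fin.cons_succ]; fun_prop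
        continuous_invFun := by fun_prop }
    exact (QI_homeo e).fg_iff.1 this

end
end SSH

namespace SSH

section
variable {n r : ℕ} (z : Fin r → Fin n → ℤ)

lemma wp_one (j : Fin n) : weightProd z 1 j = 1 := by simp [weightProd]
lemma wp_mul (s t : Fin r → Circle) (j : Fin n) : weightProd z (s * t) j = weightProd z s j * weightProd z t j := by
  simp [weightProd, mul_zpow, Finset.prod_mul_distrib]
lemma wp_inv (t : Fin r → Circle) (j : Fin n) : weightProd z t⁻¹ j = (weightProd z t j)⁻¹ := by
  rw [eq_inv_iff_mul_eq_one, ← wp_mul, inv_mul_cancel, wp_one]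

lemma wp_cont (j : Fin n) : Continuous fun t : Fin r → Circle => weightProd z t j := by
  unfold weightProd; fun_prop

/-- the action -/
def ac (t : Fin r → Circle) (x : Fin n → ℂ) : Fin n → ℂ := fun j => (weightProd z t j : ℂ) * x j

def qs : Setoid (Fin n → ℂ) where
  r x y := ∃ t, ac z t x = y
  iseqv := by
    refine ⟨fun x => ⟨1, ?_⟩, ?_, ?_⟩
    · ext j; simp [ac, wp_one]
    · rintro x y ⟨t, rfl⟩
      refine ⟨t⁻¹, ?_⟩
      ext j; simp [ac, wp_inv]
    · rintro x y w ⟨t, rfl⟩ ⟨s, rfl⟩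
      refine ⟨s * t, ?_⟩
      ext j; simp [ac, wp_mul, mul_assoc]

abbrev QQ : Type := Quotient (qs z)

def pq (x : Fin n → ℂ) : QQ z := Quotient.mk (qs z) x

variable {z}

lemma pq_eq {x y : Fin n → ℂ} : pq z x = pq z y ↔ ∃ t, ∀ j, (weightProd z t j : ℂ) * x j = y j := by
  have : pq z x = pq z y ↔ ∃ t, ac z t x = y := Quotient.eq (r := qs z)
  rw [this]
  exact exists_congr fun t => funext_iff

lemma pq_surj : Function.Surjective (pq z) := Quotient.mk_surjective

lemma ac_cont (t : Fin r → Circle) : Continuous (ac z t) := by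
  unfold ac; fun_prop

lemma pq_open : IsOpenQuotientMap (pq z) where
  surjective := pq_surj
  continuous := continuous_quotient_mk'
  isOpenMap := by
    intro U hU
    change IsOpen (pq z ⁻¹' (pq z '' U))
    have : pq z ⁻¹' (pq z '' U) = ⋃ t, (ac z t) ⁻¹' U := by
      ext x
      simp only [Set.mem_preimage, Set.mem_image, Set.mem_iUnion]
      constructor
      · rintro ⟨y, hy, h⟩
        obtain ⟨t, ht⟩ := pq_eq.1 h.symm
        refine ⟨t, ?_⟩
        have : ac z t x = y := funext ht
        rwa [this]
      · rintro ⟨t, ht⟩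
        exact ⟨_, ht, (pq_eq.2 ⟨t, fun _ => rfl⟩).symm⟩
    rw [this]
    exact isOpen_iUnion fun t => hU.preimage (ac_cont t)

lemma pq_cont : Continuous (pq z) := pq_open.continuous

instance : T2Space (QQ z) := by
  rw [t2Space_iff_of_isOpenQuotientMap (pq_open (z := z))]
  have h1 : IsClosed {q : (Fin r → Circle) × ((Fin n → ℂ) × (Fin n → ℂ)) | ∀ j, (weightProd z q.1 j : ℂ) * q.2.1 j = q.2.2 j} := by
    simp only [Set.setOf_forall]
    refine isClosed_iInter fun j => isClosed_eq ?_ (by fun_prop)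
    have := wp_cont z j
    fun_prop
  have := isClosedMap_snd_of_compactSpace _ h1
  convert this using 1
  ext ⟨x, y⟩
  simp [pq_eq]

/-- descent of continuous maps with parameters -/
lemma desc {Y Z : Type} [TopologicalSpace Y] [TopologicalSpace Z] (H : Y × (Fin n → ℂ) → Z) (hc : Continuous H)
    (hcomp : ∀ y x t, H (y, ac z t x) = H (y, x)) : ∃ G : Y × QQ z → Z, Continuous G ∧ ∀ y x, G (y, pq z x) = H (y, x) := by
  have ho : IsOpenQuotientMap (Prod.map id (pq z) : Y × (Fin n → ℂ) → Y × QQ z) := ⟨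
    Function.surjective_id.prodMap pq_surj, continuous_id.prodMap pq_cont, IsOpenMap.id.prodMap pq_open.isOpenMap⟩
  have hG : ∀ y x, H (y, Quotient.out (pq z x)) = H (y, x) := by
    intro y x
    have : pq z x = pq z (Quotient.out (pq z x)) := (Quotient.out_eq _).symm
    obtain ⟨t, ht⟩ := pq_eq.1 this
    have ht : ac z t x = Quotient.out (pq z x) := funext ht
    rw [← ht, hcomp]
  refine ⟨fun q => H (q.1, Quotient.out q.2), ?_, hG⟩
  rw [← ho.continuous_comp_iff]
  convert hc using 1
  ext ⟨y, x⟩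
  exact hG y x

lemma desc1 {Z : Type} [TopologicalSpace Z] (H : (Fin n → ℂ) → Z) (hc : Continuous H)
    (hcomp : ∀ x t, H (ac z t x) = H x) : ∃ G : QQ z → Z, Continuous G ∧ ∀ x, G (pq z x) = H x := by
  obtain ⟨G, h1, h2⟩ := desc (Y := Unit) (fun q => H q.2) (by fun_prop) (fun _ x t => hcomp x t)
  exact ⟨fun q => G ((), q), by fun_prop, fun x => h2 () x⟩

lemma exists_ab : ∃ G : QQ z → Fin n → ℝ, Continuous G ∧ ∀ x, G (pq z x) = fun j => ‖x j‖ :=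
  desc1 (fun x j => ‖x j‖) (by fun_prop) (fun x t => by ext j; simp [ac, cnorm])

def ab : QQ z → Fin n → ℝ := exists_ab.choose
lemma ab_cont : Continuous (ab (z := z)) := exists_ab.choose_spec.1
@[fun_prop] lemma ab_cont' (j : Fin n) : Continuous (fun q : QQ z => ab q j) := (continuous_apply j).comp ab_cont
@[simp] lemma ab_pq (x : Fin n → ℂ) (j : Fin n) : ab (pq z x) j = ‖x j‖ := congrFun (exists_ab.choose_spec.2 x) j
lemma ab_nonneg (q : QQ z) (j) : 0 ≤ ab q j := by
  obtain ⟨x, rfl⟩ := pq_surj q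
  simp

lemma exists_sc : ∃ G : (Fin n → ℝ) × QQ z → QQ z, Continuous G ∧ ∀ a x, G (a, pq z x) = pq z (fun j => (a j : ℂ) * x j) :=
  desc (fun q : (Fin n → ℝ) × (Fin n → ℂ) => pq z (fun j => (q.1 j : ℂ) * q.2 j)) (pq_cont.comp (by fun_prop)) (fun a x t => by
    symm
    rw [pq_eq]
    exact ⟨t, fun j => by simp only [ac]; ring⟩)

def sc : (Fin n → ℝ) × QQ z → QQ z := exists_sc.choose
@[fun_prop] lemma sc_cont : Continuous (sc (z := z)) := exists_sc.choose_spec.1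
lemma sc_pq (a : Fin n → ℝ) (x : Fin n → ℂ) : sc (a, pq z x) = pq z (fun j => (a j : ℂ) * x j) := exists_sc.choose_spec.2 a x
lemma sc_one (q : QQ z) : sc (1, q) = q := by
  obtain ⟨x, rfl⟩ := pq_surj q
  rw [sc_pq]; simp
lemma ab_sc (a : Fin n → ℝ) (q : QQ z) (j) : ab (sc (a, q)) j = |a j| * ab q j := by
  obtain ⟨x, rfl⟩ := pq_surj q
  rw [sc_pq]; simp

open Classical in
/-- support -/
def sup (q : QQ z) : Finset (Fin n) := Finset.univ.filter fun j => ab q j ≠ 0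
@[simp] lemma mem_sup {q : QQ z} {j} : j ∈ sup q ↔ ab q j ≠ 0 := by simp [sup]
lemma mem_sup_sc {a : Fin n → ℝ} {q : QQ z} {j} : j ∈ sup (sc (a, q)) ↔ a j ≠ 0 ∧ j ∈ sup q := by
  simp [ab_sc]

variable {R : Type} [CommRing R]

lemma deform_sc {P0 P : Set (QQ z)} (h : P0 ⊆ P) (a : unitInterval → QQ z → Fin n → ℝ) 
    (hc : Continuous fun x : unitInterval × P => a x.1 x.2.1) (h0 : ∀ q ∈ P, a 0 q = 1)
    (h1 : ∀ s, ∀ q ∈ P, sc (a s q, q) ∈ P) (h2 : ∀ q ∈ P, sc (a 1 q, q) ∈ P0) (h3 : ∀ s, ∀ q ∈ P0, sc (a s q, q) ∈ P0) : QI R (inc h) := by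
  have hcc : Continuous fun x : unitInterval × P => sc (a x.1 x.2.1, x.2.1) := sc_cont.comp (hc.prodMk (by fun_prop))
  have hi : Continuous fun x : unitInterval × P0 => (x.1, (⟨x.2.1, h x.2.2⟩ : P)) := by fun_prop
  have hj : Continuous fun x : P => ((1 : unitInterval), x) := by fun_prop
  refine QI_of_equiv R (g := ⟨fun x : P => ⟨sc (a 1 x.1, x.1), h2 _ x.2⟩, Continuous.subtype_mk (hcc.comp hj) _⟩) ?_ ?_
  · refine ContinuousMap.Homotopic.symm ⟨⟨⟨fun x : unitInterval × P0 => ⟨sc (a x.1 x.2.1, x.2.1), h3 _ _ x.2.2⟩, Continuous.subtype_mk (hcc.comp hi) _⟩, ?_, ?_⟩⟩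
    · intro x; exact Subtype.ext (by simp [h0 x.1 (h x.2), sc_one])
    · intro x; rfl
  · refine ContinuousMap.Homotopic.symm ⟨⟨⟨fun x : unitInterval × P => ⟨sc (a x.1 x.2.1, x.2.1), h1 _ _ x.2.2⟩, Continuous.subtype_mk hcc _⟩, ?_, ?_⟩⟩
    · intro x; exact Subtype.ext (by simp [h0 x.1 x.2, sc_one])
    · intro x; rfl

/-- the space of points with support in a family -/
def SF (z : Fin r → Fin n → ℤ) (A : Set (Finset (Fin n))) : Set (QQ z) := {q | sup q ∈ A}

lemma SF_mono {A B : Set (Finset (Fin n))} (h : A ⊆ B) : SF z A ⊆ SF z B := fun _ hq => h hq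

lemma deform_zero {A0 A : Set (Finset (Fin n))} (N : Finset (Fin n)) (h : A0 ⊆ A) (hN : ∀ S ∈ A, S \ N ∈ A0) :
    QI R (inc (SF_mono (z := z) h)) := by
  have key : ∀ (s : unitInterval) (q : QQ z), sup (sc ((fun j => if j ∈ N then 1 - s.1 else 1), q)) = if s.1 = 1 then sup q \ N else sup q := by
    intro s q
    ext j
    rw [mem_sup_sc]
    by_cases hs : s.1 = 1
    · simp [hs, and_comm]
    · have : 1 - s.1 ≠ 0 := fun h => hs (by linarith)
      by_cases hj : j ∈ N <;> simp [hs, hj, this]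
  refine deform_sc _ (fun s _ j => if j ∈ N then 1 - s.1 else 1) ?_ ?_ ?_ ?_ ?_
  · refine continuous_pi fun j => ?_
    by_cases hj : j ∈ N <;> simp only [hj, if_true, if_false] <;> fun_prop
  · intro q _; ext j; simp
  · intro s q hq
    change sup _ ∈ A
    rw [key]
    split_ifs
    · exact h (hN _ hq)
    · exact hq
  · intro q hq
    change sup _ ∈ A0
    rw [key, if_pos (by simp)]
    exact hN _ hq
  · intro s q hq
    change sup _ ∈ A0
    rw [key]
    split_ifs
    · exact hN _ (h hq)
    · exact hq

lemma open_ne (j : Fin n) : IsOpen {q : QQ z | j ∈ sup q} := by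
  simp only [mem_sup]
  exact isOpen_ne_fun (ab_cont' j) continuous_const

end
end SSH

namespace SSH

section
variable {n r : ℕ} (z : Fin r → Fin n → ℤ)

def cq (j : Fin n) : Fin r → ℚ := fun i => (z i j : ℚ)
def sp (S : Finset (Fin n)) : Submodule ℚ (Fin r → ℚ) := Submodule.span ℚ (cq z '' ↑S)
def rk (S : Finset (Fin n)) : ℕ := Module.finrank ℚ (sp z S)
lemma colRank_eq (S : Finset (Fin n)) : colRank z ↑S = rk z S := rfl

variable {z}
lemma cq_mem {S : Finset (Fin n)} {j} (h : j ∈ S) : cq z j ∈ sp z S := Submodule.subset_span ⟨j, h, rfl⟩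
lemma sp_mono {S T : Finset (Fin n)} (h : S ⊆ T) : sp z S ≤ sp z T := Submodule.span_mono (Set.image_mono (by exact_mod_cast h))
lemma rk_mono {S T : Finset (Fin n)} (h : S ⊆ T) : rk z S ≤ rk z T := Submodule.finrank_mono (sp_mono h)
lemma sp_insert (S : Finset (Fin n)) (j) : sp z (insert j S) = sp z S ⊔ Submodule.span ℚ {cq z j} := by
  rw [sp, Finset.coe_insert, Set.image_insert_eq, Submodule.span_insert, sup_comm]; rfl
lemma rk_insert_mem {S : Finset (Fin n)} {j} (h : cq z j ∈ sp z S) : rk z (insert j S) = rk z S := by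
  have : sp z (insert j S) = sp z S := by
    rw [sp_insert, sup_eq_left, Submodule.span_singleton_le_iff_mem]; exact h
  rw [rk, this, rk]
lemma rk_insert_not {S : Finset (Fin n)} {j} (h : cq z j ∉ sp z S) : rk z (insert j S) = rk z S + 1 := by
  rw [rk, sp_insert, Submodule.finrank_sup_span_singleton h, rk]
lemma rk_empty : rk z ∅ = 0 := by
  rw [rk, sp, Finset.coe_empty, Set.image_empty, Submodule.span_empty, finrank_bot]
lemma rk_insert_le (S : Finset (Fin n)) (j) : rk z (insert j S) ≤ rk z S + 1 := by
  by_cases h : cq z j ∈ sp z S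
  · rw [rk_insert_mem h]; omega
  · rw [rk_insert_not h]
lemma rk_le_card (S : Finset (Fin n)) : rk z S ≤ S.card := by
  induction S using Finset.induction_on with
  | empty => simp [rk_empty]
  | insert a S ha ih => 
    rw [Finset.card_insert_of_notMem ha]
    exact (rk_insert_le S a).trans (by omega)
lemma rk_le_r (S : Finset (Fin n)) : rk z S ≤ r := by
  have := Submodule.finrank_le (sp z S)
  simpa [rk] using this

abbrev ind (z : Fin r → Fin n → ℤ) (A : Finset (Fin n)) : Prop := LinearIndepOn ℚ (cq z) (A : Set (Fin n))

lemma ind.rk {A : Finset (Fin n)} (h : ind z A) : rk z A = A.card := by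
  have := finrank_span_eq_card (R := ℚ) h
  rw [SSH.rk, sp, Set.image_eq_range, this]; simp

lemma ind.mono {A B : Finset (Fin n)} (h : ind z B) (hAB : A ⊆ B) : ind z A := LinearIndepOn.mono h (by exact_mod_cast hAB)
lemma ind.insert {A : Finset (Fin n)} {j} (h : ind z A) (hj : cq z j ∉ sp z A) : ind z (insert j A) := by
  have : j ∉ A := fun h' => hj (cq_mem h')
  rw [ind, Finset.coe_insert, linearIndepOn_insert (by exact_mod_cast this)]
  exact ⟨h, hj⟩
lemma ind.not_mem {A : Finset (Fin n)} {j} (h : ind z A) (hj : j ∈ A) : cq z j ∉ sp z (A.erase j) := by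
  have := LinearIndepOn.notMem_span h (by exact_mod_cast hj : j ∈ (A : Set (Fin n)))
  rwa [sp, Finset.coe_erase]

lemma circle_root (u : Circle) (m : ℤ) (hm : m ≠ 0) : ∃ v : Circle, v ^ m = u := by
  refine ⟨Circle.exp (Complex.arg u / m), ?_⟩
  rw [← Circle.exp_zsmul, zsmul_eq_mul, mul_div_cancel₀ _ (by exact_mod_cast hm), Circle.exp_arg]

lemma wp_zpow (v : Circle) (φ : Fin r → ℤ) (j : Fin n) : weightProd z (fun i => v ^ φ i) j = v ^ (∑ i, φ i * z i j) := by
  have key : ∀ (s : Finset (Fin r)) (f : Fin r → ℤ), v ^ (∑ i ∈ s, f i) = ∏ i ∈ s, v ^ f i := by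
    intro s f
    induction s using Finset.induction_on with
    | empty => simp
    | insert a s ha ih => rw [Finset.sum_insert ha, Finset.prod_insert ha, zpow_add, ih]
  rw [weightProd, key]
  exact Finset.prod_congr rfl fun i _ => (zpow_mul _ _ _).symm

lemma exists_rot {S : Finset (Fin n)} {k} (h : cq z k ∉ sp z S) (u : Circle) :
    ∃ t, (∀ j ∈ S, weightProd z t j = 1) ∧ weightProd z t k = u := by
  obtain ⟨f, hf, hS⟩ := Submodule.exists_dual_map_eq_bot_of_notMem h inferInstance
  obtain ⟨b, hb⟩ := IsLocalization.exist_integer_multiples_of_finite (nonZeroDivisors ℤ) (fun i : Fin r => f (Pi.single i 1))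
  choose φ hφ using hb
  have hφ' : ∀ i, (φ i : ℚ) = (b : ℤ) * f (Pi.single i 1) := by
    intro i; have := hφ i; simpa using this
  have hsum : ∀ j, ((∑ i, φ i * z i j : ℤ) : ℚ) = (b : ℤ) * f (cq z j) := by
    intro j
    have e : cq z j = ∑ i, (z i j : ℚ) • (Pi.single i (1:ℚ) : Fin r → ℚ) := by
      ext i; simp [cq, Finset.sum_apply, Pi.single_apply]
    rw [e, map_sum, Finset.mul_sum]
    push_cast
    refine Finset.sum_congr rfl fun i _ => ?_
    rw [hφ', map_smul, smul_eq_mul]; ring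
  have hb0 : ((b : ℤ) : ℚ) ≠ 0 := by exact_mod_cast nonZeroDivisors.ne_zero b.2
  have hk : (∑ i, φ i * z i k) ≠ 0 := by
    intro h0
    have := hsum k
    rw [h0] at this
    exact mul_ne_zero hb0 hf (by exact_mod_cast this.symm)
  obtain ⟨v, hv⟩ := circle_root u _ hk
  refine ⟨fun i => v ^ φ i, ?_, by rw [wp_zpow, hv]⟩
  intro j hj
  have : f (cq z j) = 0 := by
    have : f (cq z j) ∈ (sp z S).map f := ⟨_, cq_mem hj, rfl⟩
    rw [hS] at this
    exact this
  have h0 := hsum j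
  rw [this, mul_zero] at h0
  rw [wp_zpow, (by exact_mod_cast h0 : ∑ i, φ i * z i j = 0), zpow_zero]

lemma wp_prod {ι : Type*} (s : Finset ι) (t : ι → Fin r → Circle) (j : Fin n) : weightProd z (∏ a ∈ s, t a) j = ∏ a ∈ s, weightProd z (t a) j := by
  classical
  induction s using Finset.induction_on with
  | empty => simp [wp_one]
  | insert a s ha ih => rw [Finset.prod_insert ha, Finset.prod_insert ha, wp_mul, ih]

lemma ind.onto {A : Finset (Fin n)} (hA : ind z A) (u : Fin n → Circle) : ∃ t, ∀ a ∈ A, weightProd z t a = u a := by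
  have : ∀ a, ∃ t, a ∈ A → (∀ j ∈ A.erase a, weightProd z t j = 1) ∧ weightProd z t a = u a := by
    intro a
    by_cases ha : a ∈ A
    · obtain ⟨t, ht⟩ := exists_rot (hA.not_mem ha) (u a)
      exact ⟨t, fun _ => ht⟩
    · exact ⟨1, fun h => absurd h ha⟩
  choose t ht using this
  refine ⟨∏ a ∈ A, t a, fun a ha => ?_⟩
  rw [wp_prod, Finset.prod_eq_single_of_mem a ha]
  · exact (ht a ha).2
  · intro b hb hba
    exact (ht b hb).1 a (Finset.mem_erase.2 ⟨hba.symm, ha⟩)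

/-- rotation of a complex number to its norm -/
lemma exists_abs (w : ℂ) : ∃ u : Circle, (u : ℂ) * w = ‖w‖ := by
  by_cases hw : w = 0
  · exact ⟨1, by simp [hw]⟩
  · refine ⟨(nrm w hw)⁻¹, ?_⟩
    have : (‖w‖ : ℂ) ≠ 0 := by simpa using hw
    rw [Circle.coe_inv]
    change (w / (‖w‖ : ℂ))⁻¹ * w = _
    field_simp

variable {R : Type} [CommRing R]

lemma contr_ind {A : Finset (Fin n)} (hA : ind z A) : Acy R (SF z {A}) := by
  have hsup : ∀ s : unitInterval, ∀ q ∈ SF z {A}, pq z (fun j => if j ∈ A then (((1 - s.1) * ab q j + s.1 : ℝ) : ℂ) else 0) ∈ SF z {A} := by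
    intro s q hq
    have hq : sup q = A := hq
    change sup _ = A
    ext j
    rw [mem_sup, ab_pq]
    by_cases hj : j ∈ A
    · simp only [hj, if_true, iff_true]
      have h1 : 0 < ab q j := lt_of_le_of_ne (ab_nonneg q j) (Ne.symm (mem_sup.1 (hq ▸ hj)))
      have : 0 < (1 - s.1) * ab q j + s.1 := by
        rcases eq_or_lt_of_le s.2.1 with h | h
        · rw [← h]; simpa using h1
        · have := mul_nonneg (sub_nonneg.2 s.2.2) h1.le
          linarith
      rw [Complex.norm_real]; exact (norm_pos_iff.2 this.ne').ne'
    · simp [hj]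
  refine contr (pq z (fun j => if j ∈ A then 1 else 0)) ?_ (fun x => pq z (fun j => if j ∈ A then (((1 - x.1.1) * ab x.2 j + x.1.1 : ℝ) : ℂ) else 0)) ?_ ?_ hsup ?_
  · change sup _ = A
    ext j
    simp
  · refine pq_cont.comp (continuous_pi fun j => ?_)
    by_cases hj : j ∈ A <;> simp only [hj, if_true, if_false] <;> fun_prop
  · intro q hq
    have hq : sup q = A := hq
    obtain ⟨x, rfl⟩ := pq_surj q
    symm
    rw [pq_eq]
    choose u hu using exists_abs
    obtain ⟨t, ht⟩ := hA.onto (fun j => u (x j))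
    refine ⟨t, fun j => ?_⟩
    by_cases hj : j ∈ A
    · rw [ht j hj, hu]; simp [hj]
    · have : ¬ (j ∈ sup (pq z x)) := by rwa [hq]
      simp at this
      simp [hj, this]
  · intro q hq
    congr 1; ext j; simp

lemma contr_coloop {G B : Finset (Fin n)} {k : Fin n} (hkG : k ∈ G) (hk : cq z k ∉ sp z (G.erase k)) (hBG : B ⊆ G.erase k)
    (hB : ind z (insert k B)) (A : Set (Finset (Fin n))) (hA : ∀ S ∈ A, B ⊆ S ∧ S ⊆ G ∧ insert k S ∈ A) (hkB : insert k B ∈ A) : Acy R (SF z A) := by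
  classical
  let F : unitInterval × (Fin n → ℂ) → (Fin n → ℂ) := fun q j => if j = k then (((1 - q.1.1) * ‖q.2 k‖ + q.1.1 : ℝ) : ℂ) else
    if j ∈ B then q.2 j else if j ∈ G then ((1 - q.1.1 : ℝ) : ℂ) * q.2 j else 0
  have hF : Continuous F := by
    refine continuous_pi fun j => ?_
    simp only [F]
    split_ifs <;> fun_prop
  have hcomp : ∀ s x t, pq z (F (s, ac z t x)) = pq z (F (s, x)) := by
    intro s x t
    symm
    rw [pq_eq]
    obtain ⟨t', h1, h2⟩ := exists_rot hk (weightProd z t k)⁻¹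
    refine ⟨t' * t, fun j => ?_⟩
    rw [wp_mul]
    by_cases hjk : j = k
    · subst hjk
      simp [F, h2, ac, cnorm]
    · by_cases hjB : j ∈ B
      · have := h1 j (hBG hjB)
        simp [F, hjk, hjB, this, ac]
      · by_cases hjG : j ∈ G
        · have := h1 j (Finset.mem_erase.2 ⟨hjk, hjG⟩)
          simp [F, hjk, hjB, hjG, this, ac]; ring
        · simp [F, hjk, hjB, hjG]
  obtain ⟨H, Hc, HF⟩ := desc (fun q => pq z (F q)) (pq_cont.comp hF) hcomp
  have h0 : ∀ q ∈ SF z A, H (0, q) = q := by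
    intro q hq
    obtain ⟨x, rfl⟩ := pq_surj q
    have hq : sup (pq z x) ∈ A := hq
    rw [HF]
    symm
    rw [pq_eq]
    obtain ⟨u, hu⟩ := exists_abs (x k)
    obtain ⟨t', h1, h2⟩ := exists_rot hk u
    refine ⟨t', fun j => ?_⟩
    by_cases hjk : j = k
    · subst hjk
      simp [F, h2, hu]
    · by_cases hjB : j ∈ B
      · have := h1 j (hBG hjB)
        simp [F, hjk, hjB, this]
      · by_cases hjG : j ∈ G
        · have := h1 j (Finset.mem_erase.2 ⟨hjk, hjG⟩)
          simp [F, hjk, hjB, hjG, this]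
        · have : j ∉ sup (pq z x) := fun h => hjG ((hA _ hq).2.1 h)
          simp at this
          simp [F, hjk, hjB, hjG, this]
  have hs1 : ∀ q ∈ SF z A, sup (H (1, q)) = insert k B := by
    intro q hq
    obtain ⟨x, rfl⟩ := pq_surj q
    have hq : sup (pq z x) ∈ A := hq
    rw [HF]
    ext j
    rw [mem_sup, ab_pq, Finset.mem_insert]
    by_cases hjk : j = k
    · simp [F, hjk]
    · by_cases hjB : j ∈ B
      · have := (hA _ hq).1 hjB
        simp at this
        simp [F, hjk, hjB, this]
      · by_cases hjG : j ∈ G <;> simp [F, hjk, hjB, hjG]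
  have hs2 : ∀ s : unitInterval, s ≠ 0 → s ≠ 1 → ∀ q ∈ SF z A, sup (H (s, q)) = insert k (sup q) := by
    intro s hs0 hs1 q hq
    obtain ⟨x, rfl⟩ := pq_surj q
    have hq : sup (pq z x) ∈ A := hq
    rw [HF]
    have hpos : 0 < s.1 := lt_of_le_of_ne s.2.1 (fun h => hs0 (Subtype.ext h.symm))
    have hpos' : 0 < 1 - s.1 := sub_pos.2 (lt_of_le_of_ne s.2.2 (fun h => hs1 (Subtype.ext h)))
    ext j
    rw [mem_sup, ab_pq, Finset.mem_insert, mem_sup, ab_pq]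
    by_cases hjk : j = k
    · subst hjk
      have : 0 < (1 - s.1) * ‖x j‖ + s.1 := by positivity
      simp only [F, if_true, Complex.norm_real, true_or, iff_true]
      exact (norm_pos_iff.2 this.ne').ne'
    · by_cases hjB : j ∈ B
      · simp [F, hjk, hjB]
      · by_cases hjG : j ∈ G
        · have : ((1 - s.1 : ℝ) : ℂ) ≠ 0 := by exact_mod_cast hpos'.ne'
          simp only [F, hjk, hjB, hjG, if_true, if_false, norm_ne_zero_iff, false_or, mul_ne_zero_iff]
          exact ⟨fun h => h.2, fun h => ⟨this, h⟩⟩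
        · have : j ∉ sup (pq z x) := fun h => hjG ((hA _ hq).2.1 h)
          simp at this
          simp [F, hjk, hjB, hjG, this]
  have hsub : ({insert k B} : Set (Finset (Fin n))) ⊆ A := by simpa using hkB
  have := deform (R := R) (SF_mono (z := z) hsub) H Hc h0 ?_ hs1 ?_
  · exact this.acy_iff.1 (contr_ind hB)
  · intro s q hq
    by_cases hs : s = 0
    · rw [hs, h0 q hq]; exact hq
    by_cases hs' : s = 1
    · rw [hs']; change sup _ ∈ A; rw [hs1 q hq]; exact hkB
    · change sup _ ∈ A; rw [hs2 s hs hs' q hq]; exact (hA _ hq).2.2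
  · intro s q hq
    have hq' : q ∈ SF z A := hsub hq
    by_cases hs : s = 0
    · rw [hs, h0 q hq']; exact hq
    by_cases hs' : s = 1
    · rw [hs']; change sup _ = _; rw [hs1 q hq']
    · change sup _ = _; rw [hs2 s hs hs' q hq', (hq : sup q = _)]; simp

end
end SSH

namespace SSH

section
variable {n r : ℕ} {z : Fin r → Fin n → ℤ} {R : Type} [CommRing R]

/-- unit-modulus part of the stratum -/
def KK (z : Fin r → Fin n → ℤ) (A : Finset (Fin n)) : Set (QQ z) := {q | ∀ j, ab q j = if j ∈ A then 1 else 0}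

lemma KK_sub (A : Finset (Fin n)) : KK z A ⊆ SF z {A} := by
  intro q hq
  change sup q = A
  ext j
  rw [mem_sup, hq j]
  simp

lemma KK_qi (A : Finset (Fin n)) : QI R (inc (KK_sub (z := z) A)) := by
  have hpos : ∀ q ∈ SF z {A}, ∀ j ∈ A, 0 < ab q j := by
    intro q hq j hj
    have hq : sup q = A := hq
    rw [← hq, mem_sup] at hj
    exact lt_of_le_of_ne (ab_nonneg q j) hj.symm
  have hz : ∀ q ∈ SF z {A}, ∀ j ∉ A, ab q j = 0 := by
    intro q hq j hj
    have hq : sup q = A := hq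
    rw [← hq, mem_sup, not_not] at hj
    exact hj
  refine deform_sc _ (fun s q j => if j ∈ A then (1 - s.1) + s.1 / ab q j else 1) ?_ ?_ ?_ ?_ ?_
  · refine continuous_pi fun j => ?_
    by_cases hj : j ∈ A <;> simp only [hj, if_true, if_false]
    · refine Continuous.add (by fun_prop) (Continuous.div (by fun_prop) (by fun_prop) ?_)
      intro x; exact (hpos _ x.2.2 j hj).ne'
    · fun_prop
  · intro q _; ext j; simp
  · intro s q hq
    change sup _ = A
    ext j
    rw [mem_sup_sc, (hq : sup q = A)]
    refine ⟨fun h => h.2, fun hj => ⟨?_, hj⟩⟩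
    simp only [hj, if_true]
    have := hpos q hq j hj
    rcases eq_or_lt_of_le s.2.1 with h | h
    · rw [← h]; simp
    · have h1 := sub_nonneg.2 s.2.2
      have h2 : 0 < s.1 / ab q j := by positivity
      linarith
  · intro q hq j
    rw [ab_sc]
    by_cases hj : j ∈ A
    · have := hpos q hq j hj
      simp [hj, abs_of_pos this, this.ne']
    · simp [hj, hz q hq j hj]
  · intro s q hq j
    rw [ab_sc, hq j]
    by_cases hj : j ∈ A <;> simp [hj]

lemma wp_int {e : Fin n} {B : Finset (Fin n)} {m : ℕ} {c : Fin n → ℤ} (h : ∀ i, (m : ℤ) * z i e = ∑ b ∈ B, c b * z i b)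
    (t : Fin r → Circle) (ht : ∀ b ∈ B, weightProd z t b = 1) : weightProd z t e ^ m = 1 := by
  have key : ∀ (v : Circle) (s : Finset (Fin n)) (f : Fin n → ℤ), v ^ (∑ i ∈ s, f i) = ∏ i ∈ s, v ^ f i := by
    intro v s f
    induction s using Finset.induction_on with
    | empty => simp
    | insert a s ha ih => rw [Finset.sum_insert ha, Finset.prod_insert ha, zpow_add, ih]
  have : weightProd z t e ^ m = ∏ b ∈ B, weightProd z t b ^ c b := by
    simp only [weightProd]
    rw [← Finset.prod_pow]
    simp_rw [← Finset.prod_zpow]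
    rw [Finset.prod_comm]
    refine Finset.prod_congr rfl fun i _ => ?_
    simp_rw [← zpow_mul]
    rw [← key, ← zpow_natCast, ← zpow_mul]
    congr 1
    rw [mul_comm, h]
    exact Finset.sum_congr rfl fun b _ => mul_comm _ _
  rw [this]
  exact Finset.prod_eq_one fun b hb => by rw [ht b hb, one_zpow]

lemma QI_univ {X Y : Type} [TopologicalSpace X] [TopologicalSpace Y] (f : C(X, Y)) (h : QI R (f.restrictPreimage Set.univ)) : QI R f := by
  let e1 : (f ⁻¹' Set.univ) ≃ₜ X := Homeomorph.Set.univ X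
  let e2 : (Set.univ : Set Y) ≃ₜ Y := Homeomorph.Set.univ Y
  have h1 := QI_homeo (R := R) e2
  have h2 := QI_homeo (R := R) e1
  have h3 := QI_comp R h h1
  have e : ((e2 : C((Set.univ : Set Y), Y)).comp (f.restrictPreimage Set.univ)) = f.comp (e1 : C(f ⁻¹' Set.univ, X)) := by
    ext x; rfl
  rw [e] at h3
  exact QI_of_comp_left R h2 h3

open Classical in
/-- extend a vector by ones on B and zero elsewhere -/
def ex (B E : Finset (Fin n)) (y : E → ℂ) : Fin n → ℂ := fun j => if j ∈ B then 1 else if h : j ∈ E then y ⟨j, h⟩ else 0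

lemma ex_cont (B E : Finset (Fin n)) : Continuous (ex B E) := by
  refine continuous_pi fun j => ?_
  unfold ex
  split_ifs <;> fun_prop

/-- base family -/
def bF (B E : Finset (Fin n)) : Set (Finset (Fin n)) := {S | B ⊆ S ∧ S ⊆ B ∪ E ∧ (S ∩ E).Nonempty}

open Classical in
/-- extend unit vector by ones on B and zero elsewhere, from index type of subfinset -/
def ext0 {E : Finset (Fin n)} (J : Finset E) (u : J → Circle) : E → ℂ := fun e => if h : e ∈ J then (u ⟨e, h⟩ : ℂ) else 0

lemma ext0_cont {E : Finset (Fin n)} (J : Finset E) : Continuous (ext0 J) := by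
  refine continuous_pi fun j => ?_
  unfold ext0
  split_ifs <;> fun_prop

lemma base {p : ℕ} [Fact p.Prime] {B E : Finset (Fin n)} (hBE : Disjoint B E) (hB : ind z B) (m : ℕ) (hp : ¬ p ∣ m) (c : Fin n → Fin n → ℤ)
    (h : ∀ e ∈ E, ∀ i, (m : ℤ) * z i e = ∑ b ∈ B, c e b * z i b) : FG (ZMod p) (SF z (bF B E)) ∧ 
      ∀ k, hd (ZMod p) (SF z (bF B E)) k = if k = 2 * E.card then 1 else 0 := by
  classical
  have hEB : ∀ e : E, e.1 ∉ B := fun e he => Finset.disjoint_left.1 hBE he e.2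
  have sup_ex : ∀ y : E → ℂ, ∀ e : E, e.1 ∈ sup (pq z (ex B E y)) ↔ y e ≠ 0 := by
    intro y e
    simp [ex, hEB e]
  have sup_B : ∀ y : E → ℂ, ∀ j, j ∉ E → (j ∈ sup (pq z (ex B E y)) ↔ j ∈ B) := by
    intro y j hj
    by_cases hb : j ∈ B <;> simp [ex, hj, hb]
  have hmem : ∀ y : Pun (E → ℂ), pq z (ex B E y.1) ∈ SF z (bF B E) := by
    intro y
    refine ⟨fun b hb => (sup_B _ b (Finset.disjoint_left.1 hBE hb)).2 hb, ?_, ?_⟩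
    · intro j hj
      by_cases hjE : j ∈ E
      · simp [hjE]
      · simp [(sup_B _ j hjE).1 hj]
    · obtain ⟨e, he⟩ := Function.ne_iff.1 y.2
      exact ⟨e.1, Finset.mem_inter.2 ⟨(sup_ex _ e).2 he, e.2⟩⟩
  let f : C(Pun (E → ℂ), SF z (bF B E)) := ⟨fun y => ⟨_, hmem y⟩, by
    have := ex_cont B E
    have := pq_cont (z := z)
    fun_prop⟩
  suffices hf : QI (ZMod p) f by
    obtain ⟨a, b⟩ := punC (F := ZMod p) (E := E)
    refine ⟨hf.fg_iff.1 a, fun k => ?_⟩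
    rw [← hf.hd_eq, b]; simp
  let O : E → Set (SF z (bF B E)) := fun e => {q | e.1 ∈ sup q.1}
  have hO : ∀ e, IsOpen (O e) := fun e => (open_ne e.1).preimage continuous_subtype_val
  have hcov : (⋃ s ∈ (Finset.univ : Finset E), O s) = Set.univ := by
    rw [Set.eq_univ_iff_forall]
    rintro ⟨q, h1, h2, e, he⟩
    rw [Finset.mem_inter] at he
    simp only [Finset.mem_univ, Set.iUnion_true, Set.mem_iUnion]
    exact ⟨⟨e, he.2⟩, he.1⟩
  refine QI_univ f ?_
  rw [← hcov]
  refine cover_qi f O hO ?_ _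
  intro J hJ
  let A : Finset (Fin n) := B ∪ J.map (Function.Embedding.subtype _)
  have mA : ∀ j, j ∈ A ↔ j ∈ B ∨ ∃ h : j ∈ E, (⟨j, h⟩ : E) ∈ J := by
    intro j; simp [A]
  have mOJ : ∀ q : SF z (bF B E), q ∈ (⋂ j ∈ J, O j) ↔ ∀ j ∈ J, j.1 ∈ sup q.1 := by
    intro q; simp [O]
  set OJ := (⋂ j ∈ J, O j) with hOJ
  have mfOJ : ∀ y, y ∈ f ⁻¹' OJ ↔ ∀ j ∈ J, y.1 j ≠ 0 := by
    intro y
    rw [Set.mem_preimage, mOJ]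
    exact forall_congr' fun j => forall_congr' fun _ => sup_ex y.1 j
  -- the torus part
  obtain ⟨j0, hj0⟩ := hJ
  have hne0 : ∀ u : J → Circle, ext0 J u ≠ 0 := by
    intro u h0
    have := congrFun h0 j0
    simp [ext0, hj0] at this
  let i1 : C(J → Circle, f ⁻¹' OJ) := ⟨fun u => ⟨⟨ext0 J u, hne0 u⟩, (mfOJ _).2 fun j hj => by simp [ext0, hj]⟩, by
    have := ext0_cont J
    fun_prop⟩
  have hi1 : QI (ZMod p) i1 := by
    have hy : ∀ (y : f ⁻¹' OJ) (j : J), y.1.1 j.1 ≠ 0 := fun y j => (mfOJ y.1).1 y.2 j.1 j.2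
    have hv : ∀ e, Continuous fun y : (f ⁻¹' OJ) => y.1.1 e := fun e => (continuous_apply e).comp (continuous_subtype_val.comp continuous_subtype_val)
    have hv2 : ∀ e, Continuous fun y : unitInterval × (f ⁻¹' OJ) => y.2.1.1 e := fun e => (hv e).comp continuous_snd
    let H : unitInterval × (f ⁻¹' OJ) → E → ℂ := fun q e => if e ∈ J then q.2.1.1 e * (((1 - q.1.1) + q.1.1 / ‖q.2.1.1 e‖ : ℝ) : ℂ) else ((1 - q.1.1 : ℝ) : ℂ) * q.2.1.1 e
    have hH : Continuous H := by
      refine continuous_pi fun e => ?_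
      simp only [H]
      by_cases he : e ∈ J
      · simp only [he, if_true]
        refine Continuous.mul (hv2 e) (Complex.continuous_ofReal.comp (Continuous.add (by fun_prop) (Continuous.div (by fun_prop) (hv2 e).norm ?_)))
        intro x
        exact norm_ne_zero_iff.2 (hy x.2 ⟨e, he⟩)
      · simp only [he, if_false]; exact Continuous.mul (by fun_prop) (hv2 e)
    have hHJ : ∀ q, ∀ j ∈ J, H q j ≠ 0 := by
      intro q j hj
      simp only [H, hj, if_true]
      refine mul_ne_zero (hy q.2 ⟨j, hj⟩) ?_
      rw [Complex.ofReal_ne_zero]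
      have := norm_pos_iff.2 (hy q.2 ⟨j, hj⟩)
      rcases eq_or_lt_of_le q.1.2.1 with h | h
      · rw [← h]; simp
      · have h1 := sub_nonneg.2 q.1.2.2
        have h2 : 0 < q.1.1 / ‖q.2.1.1 j‖ := by positivity
        linarith
    have hH0 : ∀ q, H q ≠ 0 := fun q h0 => hHJ q j0 hj0 (congrFun h0 j0)
    refine QI_of_equiv _ (g := ⟨fun y j => nrm (y.1.1 j.1) (hy y j), ?_⟩) ?_ ?_
    · refine continuous_pi fun j => Continuous.subtype_mk (Continuous.div (hv j.1) (Complex.continuous_ofReal.comp (hv j.1).norm) ?_) _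
      intro y
      simpa using hy y j
    · refine ContinuousMap.Homotopic.symm ⟨ContinuousMap.Homotopy.refl _ |>.cast rfl ?_⟩
      ext u j
      change (u j : ℂ) = ext0 J u j.1 / (‖ext0 J u j.1‖ : ℂ)
      simp [ext0, cnorm]
    · refine ContinuousMap.Homotopic.symm ⟨⟨⟨fun q => ⟨⟨H q, hH0 q⟩, (mfOJ _).2 (hHJ q)⟩, by fun_prop⟩, ?_, ?_⟩⟩
      · intro y
        refine Subtype.ext (Subtype.ext ?_)
        ext e
        simp only [H]
        split_ifs <;> simp
      · intro y
        refine Subtype.ext (Subtype.ext ?_)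
        ext e
        simp only [H]
        split_ifs with he
        · simp [i1, ext0, nrm, he]; rfl
        · simp [i1, ext0, he]
  have hgm : ∀ u : J → Circle, pq z (ex B E (ext0 J u)) ∈ KK z A := by
    intro u j
    rw [ab_pq]
    by_cases hjB : j ∈ B
    · simp [ex, hjB, A]
    · by_cases hjE : j ∈ E
      · by_cases hjJ : (⟨j, hjE⟩ : E) ∈ J <;> simp [ex, ext0, hjB, hjE, hjJ, A, cnorm]
      · simp [ex, hjB, hjE, A]
  let g : C(J → Circle, KK z A) := ⟨fun u => ⟨_, hgm u⟩, by
    have := ex_cont B E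
    have := ext0_cont J
    have := pq_cont (z := z)
    fun_prop⟩
  have exv : ∀ (u : J → Circle) (j : J), ex B E (ext0 J u) j.1.1 = u j := by
    intro u j
    simp [ex, ext0, hEB j.1]
  have exB : ∀ (u : J → Circle) (j), j ∈ B → ex B E (ext0 J u) j = 1 := by
    intro u j hj; simp [ex, hj]
  have ex0 : ∀ (u : J → Circle) (j), j ∉ A → ex B E (ext0 J u) j = 0 := by
    intro u j hj
    rw [mA] at hj
    push Not at hj
    by_cases hjE : j ∈ E
    · simp [ex, ext0, hj.1, hjE, hj.2 hjE]
    · simp [ex, hj.1, hjE]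
  let F : Subgroup (J → Circle) :=
    { carrier := {u | ∃ t, (∀ b ∈ B, weightProd z t b = 1) ∧ ∀ j : J, weightProd z t j.1.1 = u j}
      one_mem' := ⟨1, fun _ _ => wp_one _ _, fun _ => wp_one _ _⟩
      mul_mem' := by
        rintro u v ⟨t, h1, h2⟩ ⟨s, h3, h4⟩
        exact ⟨t * s, fun b hb => by rw [wp_mul, h1 b hb, h3 b hb, mul_one], fun j => by rw [wp_mul, h2, h4]; rfl⟩
      inv_mem' := by
        rintro u ⟨t, h1, h2⟩
        exact ⟨t⁻¹, fun b hb => by rw [wp_inv, h1 b hb, inv_one], fun j => by rw [wp_inv, h2]; rfl⟩ }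
  have hg : QI (ZMod p) g := by
    refine transfer_torus g F m ?_ hp ?_ ?_
    · rintro u ⟨t, h1, h2⟩
      ext1 j
      rw [Pi.pow_apply, ← h2 j]
      exact wp_int (h _ j.1.2) t h1
    · rintro ⟨q, hq⟩
      obtain ⟨x, rfl⟩ := pq_surj q
      have hx : ∀ j ∈ A, ‖x j‖ = 1 := by
        intro j hj
        have := hq j
        rwa [ab_pq, if_pos hj] at this
      have hx' : ∀ j ∉ A, x j = 0 := by
        intro j hj
        have := hq j
        rwa [ab_pq, if_neg hj, norm_eq_zero] at this
      choose v hv using exists_abs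
      obtain ⟨t, ht⟩ := hB.onto (fun j => v (x j))
      have hJA : ∀ j : J, j.1.1 ∈ A := fun j => (mA _).2 (Or.inr ⟨j.1.2, j.2⟩)
      refine ⟨fun j => weightProd z t j.1.1 * nrm (x j.1.1) (norm_ne_zero_iff.1 (by rw [hx _ (hJA j)]; simp)), ?_⟩
      refine Subtype.ext (Eq.symm ?_)
      refine pq_eq.2 ⟨t, fun j => ?_⟩
      by_cases hjA : j ∈ A
      · rcases (mA j).1 hjA with hjB | ⟨hjE, hjJ⟩
        · rw [exB _ _ hjB, ht j hjB, hv, hx j hjA]; simp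
        · have := exv (fun j => weightProd z t j.1.1 * nrm (x j.1.1) (norm_ne_zero_iff.1 (by rw [hx _ (hJA j)]; simp))) ⟨⟨j, hjE⟩, hjJ⟩
          rw [this, Circle.coe_mul]
          congr 1
          change _ = x j / (‖x j‖ : ℂ)
          rw [hx j hjA]; simp
      · rw [ex0 _ _ hjA, hx' j hjA, mul_zero]
    · intro u v
      rw [Subtype.ext_iff]
      change pq z _ = pq z _ ↔ _
      rw [pq_eq]
      refine exists_congr fun t => ?_
      constructor
      · intro ht
        refine ⟨fun b hb => ?_, fun j => ?_⟩
        · have := ht b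
          rw [exB _ _ hb, exB _ _ hb, mul_one] at this
          exact Circle.ext (by simpa using this)
        · have := ht j.1.1
          rw [exv, exv] at this
          rw [Pi.mul_apply, Pi.inv_apply, eq_mul_inv_iff_mul_eq]
          exact Circle.ext (by simpa using this)
      · rintro ⟨h1, h2⟩ j
        by_cases hjA : j ∈ A
        · rcases (mA j).1 hjA with hjB | ⟨hjE, hjJ⟩
          · rw [exB _ _ hjB, exB _ _ hjB, h1 j hjB]; simp
          · have e1 := exv u ⟨⟨j, hjE⟩, hjJ⟩
            have e2 := exv v ⟨⟨j, hjE⟩, hjJ⟩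
            have e3 := h2 ⟨⟨j, hjE⟩, hjJ⟩
            rw [e1, e2, e3]
            simp
        · rw [ex0 _ _ hjA, ex0 _ _ hjA, mul_zero]
  -- the other inclusion
  let A' : Set (Finset (Fin n)) := {S | S ∈ bF B E ∧ ∀ j ∈ J, j.1 ∈ S}
  have hAA : ({A} : Set (Finset (Fin n))) ⊆ A' := by
    rintro _ rfl
    refine ⟨⟨Finset.subset_union_left, ?_, ?_⟩, ?_⟩
    · intro j hj
      rcases (mA j).1 hj with hjB | ⟨hjE, hjJ⟩ <;> simp [*]
    · exact ⟨j0.1, Finset.mem_inter.2 ⟨(mA _).2 (Or.inr ⟨j0.2, hj0⟩), j0.2⟩⟩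
    · intro j hj; exact (mA _).2 (Or.inr ⟨j.2, hj⟩)
  have q1 : QI (ZMod p) (inc (SF_mono (z := z) hAA)) := by
    refine deform_zero Aᶜ hAA ?_
    rintro S ⟨⟨h1, h2, h3⟩, h4⟩
    change S \ Aᶜ = A
    ext j
    simp only [Finset.mem_sdiff, Finset.mem_compl, not_not]
    refine ⟨fun h => h.2, fun h => ⟨?_, h⟩⟩
    rcases (mA j).1 h with hjB | ⟨hjE, hjJ⟩
    · exact h1 hjB
    · exact h4 _ hjJ
  let e : SF z A' ≃ₜ OJ :=
    { toFun := fun q => ⟨⟨q.1, q.2.1⟩, (mOJ _).2 q.2.2⟩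
      invFun := fun q => ⟨q.1.1, q.1.2, (mOJ _).1 q.2⟩
      left_inv := fun q => rfl
      right_inv := fun q => rfl
      continuous_toFun := by fun_prop
      continuous_invFun := by fun_prop }
  have q2 := QI_comp (ZMod p) (QI_comp (ZMod p) (QI_comp (ZMod p) hg (KK_qi A)) q1) (QI_homeo e)
  exact QI_of_comp_left (ZMod p) hi1 q2

end
end SSH

namespace SSH

section
variable {n r : ℕ} {z : Fin r → Fin n → ℤ} {p : ℕ}

def zc (z : Fin r → Fin n → ℤ) (j : Fin n) : Fin r → ℤ := fun i => z i j
def LL (z : Fin r → Fin n → ℤ) (S : Finset (Fin n)) : Submodule ℤ (Fin r → ℤ) := Submodule.span ℤ (zc z '' ↑S)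
def psat (z : Fin r → Fin n → ℤ) (p : ℕ) (B G : Finset (Fin n)) : Prop :=
  ∀ a : Fin n → ℤ, ∀ w ∈ LL z G, ∑ b ∈ B, a b • zc z b = (p : ℤ) • w → ∀ b ∈ B, (p : ℤ) ∣ a b

lemma zc_mem {S : Finset (Fin n)} {j} (h : j ∈ S) : zc z j ∈ LL z S := Submodule.subset_span ⟨j, h, rfl⟩

lemma LL_sum {S : Finset (Fin n)} {B : Finset (Fin n)} (h : B ⊆ S) (a : Fin n → ℤ) : ∑ b ∈ B, a b • zc z b ∈ LL z S :=
  Submodule.sum_mem _ fun b hb => Submodule.smul_mem _ _ (zc_mem (h hb))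

lemma psat.mono {B G G' : Finset (Fin n)} (h : psat z p B G) (hG : G' ⊆ G) : psat z p B G' :=
  fun a w hw => h a w (Submodule.span_mono (Set.image_mono (by exact_mod_cast hG)) hw)

lemma ind_int {B : Finset (Fin n)} : ind z B ↔ ∀ a : Fin n → ℤ, ∑ b ∈ B, a b • zc z b = 0 → ∀ b ∈ B, a b = 0 := by
  rw [ind, LinearIndepOn, ← LinearIndependent.iff_fractionRing ℤ ℚ]
  change LinearIndepOn ℤ (cq z) _ ↔ _
  rw [linearIndepOn_finset_iff]
  refine forall_congr' fun a => ?_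
  have : ∑ i ∈ B, a i • cq z i = 0 ↔ ∑ b ∈ B, a b • zc z b = 0 := by
    rw [funext_iff, funext_iff]
    refine forall_congr' fun i => ?_
    simp only [Finset.sum_apply, Pi.smul_apply, cq, zc, Pi.zero_apply]
    simp only [zsmul_eq_mul, smul_eq_mul]
    norm_cast
  rw [this]

lemma psat.ind [hp : Fact p.Prime] {B G : Finset (Fin n)} (h : psat z p B G) : ind z B := by
  rw [ind_int]
  have hp0 : (p : ℤ) ≠ 0 := by exact_mod_cast hp.1.ne_zero
  have key : ∀ k : ℕ, ∀ a : Fin n → ℤ, ∑ b ∈ B, a b • zc z b = 0 → ∀ b ∈ B, (p : ℤ) ^ k ∣ a b := by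
    intro k
    induction k with
    | zero => intro a _ b _; simp
    | succ k ih =>
      intro a ha
      have h1 := h a 0 (Submodule.zero_mem _) (by rw [ha, smul_zero])
      have h2 : ∑ b ∈ B, (a b / p) • zc z b = 0 := by
        have : (p : ℤ) • ∑ b ∈ B, (a b / p) • zc z b = 0 := by
          rw [← ha, Finset.smul_sum]
          refine Finset.sum_congr rfl fun b hb => ?_
          rw [smul_smul, Int.mul_ediv_cancel' (h1 b hb)]
        exact (smul_eq_zero.1 this).resolve_left hp0
      intro b hb
      rw [← Int.mul_ediv_cancel' (h1 b hb), pow_succ']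
      exact mul_dvd_mul_left _ (ih _ h2 b hb)
  intro a ha b hb
  by_contra hne
  have := Int.natAbs_dvd_natAbs.2 (key (a b).natAbs a ha b hb)
  have h3 := Nat.le_of_dvd (Int.natAbs_pos.2 hne) this
  rw [Int.natAbs_pow, Int.natAbs_natCast] at h3
  exact absurd (Nat.lt_pow_self hp.1.one_lt) (not_lt.2 h3)

lemma psat.coprime [hp : Fact p.Prime] {B G : Finset (Fin n)} (h : psat z p B G) {e : Fin n} (he : e ∈ G) (hB : e ∉ B)
    (hs : cq z e ∈ sp z B) : ∃ m : ℕ, ¬ p ∣ m ∧ ∃ c : Fin n → ℤ, (m : ℤ) • zc z e = ∑ b ∈ B, c b • zc z b := by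
  have hp0 : (p : ℤ) ≠ 0 := by exact_mod_cast hp.1.ne_zero
  have h1 : ¬ SSH.ind z (insert e B) := fun hi => by
    have := hi.not_mem (Finset.mem_insert_self e B)
    rw [Finset.erase_insert hB] at this
    exact this hs
  rw [ind_int] at h1
  push Not at h1
  obtain ⟨a, ha, b, hb, hab⟩ := h1
  rw [Finset.sum_insert hB] at ha
  have hae : a e ≠ 0 := by
    intro h0
    rw [h0, zero_smul, zero_add] at ha
    rcases Finset.mem_insert.1 hb with rfl | hb
    · exact hab h0
    · exact hab (ind_int.1 h.ind a ha b hb)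
  have key : ∀ k : ℕ, ∀ D : ℤ, D.natAbs ≤ k → D ≠ 0 → ∀ c : Fin n → ℤ, D • zc z e = ∑ b ∈ B, c b • zc z b →
      ∃ D : ℤ, ¬ (p : ℤ) ∣ D ∧ ∃ c : Fin n → ℤ, D • zc z e = ∑ b ∈ B, c b • zc z b := by
    intro k
    induction k with
    | zero => intro D h1 h2; omega
    | succ k ih =>
      intro D hk hD c hc
      by_cases hpD : (p : ℤ) ∣ D
      · obtain ⟨D', rfl⟩ := hpD
        have h1 := h c (D' • zc z e) (Submodule.smul_mem _ _ (zc_mem he)) (by rw [← hc, smul_smul])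
        refine ih D' ?_ (by rintro rfl; simp at hD) (fun b => c b / p) ?_
        · have hD' : D' ≠ 0 := by rintro rfl; simp at hD
          rw [Int.natAbs_mul, Int.natAbs_natCast] at hk
          have := hp.1.two_le
          have := Int.natAbs_pos.2 hD'
          nlinarith
        · refine smul_right_injective _ hp0 ?_
          change (p : ℤ) • _ = (p : ℤ) • _
          rw [smul_smul, hc, Finset.smul_sum]
          refine Finset.sum_congr rfl fun b hb => ?_
          rw [smul_smul, Int.mul_ediv_cancel' (h1 b hb)]
      · exact ⟨D, hpD, c, hc⟩
  obtain ⟨D, hD, c, hc⟩ := key _ (a e) le_rfl hae (fun b => - a b) (by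
    rw [eq_neg_of_add_eq_zero_left ha]; simp)
  refine ⟨D.natAbs, fun hh => hD (Int.natCast_dvd.2 hh), ?_⟩
  rcases Int.natAbs_eq D with h' | h'
  · exact ⟨c, by rw [← h', hc]⟩
  · refine ⟨fun b => - c b, ?_⟩
    have : (D.natAbs : ℤ) = - D := by omega
    rw [this, neg_smul, hc]; simp

open scoped Pointwise in
lemma psat.extend [hp : Fact p.Prime] {B G : Finset (Fin n)} (h : psat z p B G) (hBG : B ⊆ G) (hlt : B.card < rk z G) :
    ∃ k ∈ G, k ∉ B ∧ psat z p (insert k B) G := by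
  by_contra hcon
  push Not at hcon
  have hpr : Prime (p : ℤ) := Nat.prime_iff_prime_int.1 hp.1
  have h1 : ∀ k ∈ G, zc z k ∈ LL z B ⊔ (Ideal.span {(p : ℤ)}) • LL z G := by
    intro k hk
    by_cases hkB : k ∈ B
    · exact Submodule.mem_sup_left (zc_mem hkB)
    have h2 := hcon k hk hkB
    unfold psat at h2
    push Not at h2
    obtain ⟨a, w, hw, ha, b, hb, hpb⟩ := h2
    rw [Finset.sum_insert hkB] at ha
    have hak : ¬ (p : ℤ) ∣ a k := by
      rintro ⟨d, hd⟩
      have h3 := h a (w - d • zc z k) (Submodule.sub_mem _ hw (Submodule.smul_mem _ _ (zc_mem hk))) (by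
        rw [smul_sub, ← ha, smul_smul, ← hd]; abel)
      rcases Finset.mem_insert.1 hb with rfl | hb
      · exact hpb ⟨d, hd⟩
      · exact hpb (h3 b hb)
    obtain ⟨u, v, huv⟩ := (hpr.coprime_iff_not_dvd.2 hak)
    have : zc z k = - (v • ∑ b ∈ B, a b • zc z b) + (p : ℤ) • (u • zc z k + v • w) := by
      have e1 : (p : ℤ) • w = a k • zc z k + ∑ b ∈ B, a b • zc z b := ha.symm
      rw [smul_add, smul_comm (p : ℤ) v w, e1, smul_add, smul_smul, smul_smul]
      calc zc z k = (u * p + v * a k) • zc z k := by rw [huv, one_smul]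
        _ = _ := by rw [add_smul, mul_comm u]; abel
    rw [this]
    refine Submodule.add_mem_sup (Submodule.neg_mem _ (Submodule.smul_mem _ _ (LL_sum subset_rfl a))) ?_
    refine Submodule.smul_mem_smul (Ideal.mem_span_singleton_self _) ?_
    exact Submodule.add_mem _ (Submodule.smul_mem _ _ (zc_mem hk)) (Submodule.smul_mem _ _ hw)
  have h2 : LL z G ≤ LL z B ⊔ (Ideal.span {(p : ℤ)}) • LL z G := by
    rw [LL, Submodule.span_le]
    rintro _ ⟨k, hk, rfl⟩
    exact h1 k hk
  obtain ⟨m, hm, hm2⟩ := Submodule.exists_sub_one_mem_and_smul_le_of_fg_of_le_sup (IsNoetherian.noetherian (LL z G)) le_rfl h2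
  have hm0 : m ≠ 0 := by
    rintro rfl
    rw [Ideal.mem_span_singleton] at hm
    exact hpr.not_dvd_one ((dvd_neg.1 (by simpa using hm)))
  have h3 : sp z G ≤ sp z B := by
    rw [sp, Submodule.span_le]
    rintro _ ⟨k, hk, rfl⟩
    have h4 : m • zc z k ∈ LL z B := hm2 (Submodule.smul_mem_pointwise_smul _ _ _ (zc_mem hk))
    have h5 : ∀ w ∈ LL z B, (fun i => (w i : ℚ)) ∈ sp z B := by
      intro w hw
      refine Submodule.span_induction ?_ ?_ ?_ ?_ hw
      · rintro _ ⟨b, hb, rfl⟩; exact cq_mem hb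
      · convert Submodule.zero_mem (sp z B) using 1; ext i; simp
      · intro x y _ _ hx hy
        convert Submodule.add_mem _ hx hy using 1; ext i; simp
      · intro c x _ hx
        convert Submodule.smul_mem _ (c : ℚ) hx using 1; ext i; simp
    have h6 := Submodule.smul_mem _ ((m : ℚ)⁻¹) (h5 _ h4)
    change cq z k ∈ sp z B
    convert h6 using 1
    ext i
    simp only [cq, zc, Pi.smul_apply, smul_eq_mul, Int.cast_mul]
    field_simp
  have h4 : rk z G ≤ B.card := (Submodule.finrank_mono h3).trans (rk_le_card B)
  omega

lemma psat_empty (G : Finset (Fin n)) : psat z p ∅ G := fun a w _ _ b hb => by simp at hb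

end
end SSH

namespace SSH

section
variable {n r : ℕ} {z : Fin r → Fin n → ℤ} {p : ℕ}
open Polynomial

def WW (z : Fin r → Fin n → ℤ) (B G : Finset (Fin n)) (c : ℕ) : Set (Finset (Fin n)) :=
  {S | B ⊆ S ∧ S ⊆ G ∧ S ≠ B ∧ rk z S ≤ c}

def tm (z : Fin r → Fin n → ℤ) (c : ℕ) (A : Finset (Fin n)) : ℤ[X] :=
  if rk z A ≤ c then (-1) ^ (c - rk z A) * (X - 1) ^ (A.card - rk z A) else 0

def QP (z : Fin r → Fin n → ℤ) (B G : Finset (Fin n)) (c : ℕ) : ℤ[X] := ∑ A ∈ Finset.Icc B G, tm z c A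

def PP (z : Fin r → Fin n → ℤ) (B G : Finset (Fin n)) (c : ℕ) : ℤ[X] := X ^ (c - B.card) * expand ℤ 2 (QP z B G c)

lemma PP_par {B G : Finset (Fin n)} {c k : ℕ} (h : k % 2 ≠ (c - B.card) % 2) : (PP z B G c).coeff k = 0 := by
  rw [PP, coeff_X_pow_mul']
  split_ifs with h1
  · rw [coeff_expand (by norm_num), if_neg]
    omega
  · rfl

lemma Icc_ins {B G : Finset (Fin n)} {k : Fin n} (hk : k ∈ G) (hkB : k ∉ B) {M : Type} [AddCommMonoid M] (f : Finset (Fin n) → M) :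
    ∑ A ∈ Finset.Icc (insert k B) G, f A = ∑ A ∈ Finset.Icc B (G.erase k), f (insert k A) := by
  symm
  refine Finset.sum_bij' (fun A _ => insert k A) (fun A _ => A.erase k) ?_ ?_ ?_ ?_ ?_
  · intro A hA
    simp only [Finset.mem_Icc, Finset.le_eq_subset] at hA ⊢
    exact ⟨Finset.insert_subset_insert _ hA.1, Finset.insert_subset hk (hA.2.trans (Finset.erase_subset _ _))⟩
  · intro A hA
    simp only [Finset.mem_Icc, Finset.le_eq_subset] at hA ⊢
    refine ⟨?_, Finset.erase_subset_erase _ hA.2⟩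
    rw [← Finset.erase_insert hkB]
    exact Finset.erase_subset_erase _ hA.1
  · intro A hA
    simp only [Finset.mem_Icc, Finset.le_eq_subset] at hA
    exact Finset.erase_insert fun h => by simpa using hA.2 h
  · intro A hA
    simp only [Finset.mem_Icc, Finset.le_eq_subset] at hA
    exact Finset.insert_erase (hA.1 (Finset.mem_insert_self _ _))
  · intro A hA; rfl

lemma Icc_split {B G : Finset (Fin n)} {k : Fin n} (hk : k ∈ G) (hkB : k ∉ B) {M : Type} [AddCommMonoid M] (f : Finset (Fin n) → M) :
    ∑ A ∈ Finset.Icc B G, f A = ∑ A ∈ Finset.Icc B (G.erase k), f A + ∑ A ∈ Finset.Icc (insert k B) G, f A := by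
  rw [← Finset.sum_filter_not_add_sum_filter _ (fun A => k ∈ A)]
  congr 1
  · refine Finset.sum_congr ?_ fun _ _ => rfl
    ext A
    simp only [Finset.mem_filter, Finset.mem_Icc, Finset.le_eq_subset, Finset.subset_erase]
    tauto
  · refine Finset.sum_congr ?_ fun _ _ => rfl
    ext A
    simp only [Finset.mem_filter, Finset.mem_Icc, Finset.le_eq_subset, Finset.insert_subset_iff]
    tauto

lemma rk_eq_of_span {B S : Finset (Fin n)} (hBS : B ⊆ S) (h : ∀ j ∈ S, cq z j ∈ sp z B) : rk z S = rk z B := by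
  refine le_antisymm (Submodule.finrank_mono ?_) (rk_mono hBS)
  rw [sp, Submodule.span_le]
  rintro _ ⟨j, hj, rfl⟩
  exact h j hj

lemma PP_base {B G : Finset (Fin n)} (hBG : B ⊆ G) (hB : ind z B) (h : ∀ j ∈ G, cq z j ∈ sp z B) :
    PP z B G B.card = X ^ (2 * (G \ B).card) := by
  have : QP z B G B.card = X ^ (G \ B).card := by
    have h1 : ∀ A ∈ Finset.Icc B G, tm z B.card A = (X - 1) ^ (A.card - B.card) := by
      intro A hA
      rw [Finset.mem_Icc] at hA
      have : rk z A = B.card := by rw [rk_eq_of_span hA.1 fun j hj => h j (hA.2 hj), hB.rk]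
      simp [tm, this]
    rw [QP, Finset.sum_congr rfl h1, Finset.Icc_eq_image_powerset hBG, Finset.sum_image]
    · have e1 : ∀ A ∈ (G \ B).powerset, ((X : ℤ[X]) - 1) ^ ((B ∪ A).card - B.card) = (X - 1) ^ A.card * 1 ^ ((G \ B).card - A.card) := by
        intro A hA
        rw [Finset.mem_powerset] at hA
        rw [Finset.card_union_of_disjoint, Nat.add_sub_cancel_left, one_pow, mul_one]
        rw [Finset.disjoint_left]
        intro b hb hb'
        exact (Finset.mem_sdiff.1 (hA hb')).2 hb
      rw [Finset.sum_congr rfl e1, Finset.sum_pow_mul_eq_add_pow]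
      simp
    · intro A hA A' hA' h
      simp only [Finset.coe_powerset, Set.mem_preimage, Set.mem_powerset_iff] at hA hA'
      have hA : A ⊆ G \ B := by exact_mod_cast hA
      have hA' : A' ⊆ G \ B := by exact_mod_cast hA'
      ext j
      have hj : j ∈ B ∪ A ↔ j ∈ B ∪ A' := by
        change B ∪ A = B ∪ A' at h
        rw [h]
      rw [Finset.mem_union, Finset.mem_union] at hj
      constructor
      · intro hj1
        have := (Finset.mem_sdiff.1 (hA hj1)).2
        tauto
      · intro hj1
        have := (Finset.mem_sdiff.1 (hA' hj1)).2
        tauto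
  rw [PP, this]
  simp [pow_mul]

lemma PP_coloop {B G : Finset (Fin n)} {k : Fin n} (hk : k ∈ G) (hkB : k ∉ B) (hc : cq z k ∉ sp z (G.erase k)) :
    PP z B G (rk z G) = 0 := by
  have : QP z B G (rk z G) = 0 := by
    rw [QP, Icc_split hk hkB, Icc_ins hk hkB, ← Finset.sum_add_distrib]
    refine Finset.sum_eq_zero fun A hA => ?_
    rw [Finset.mem_Icc] at hA
    have h1 : rk z (insert k A) = rk z A + 1 := rk_insert_not fun h => hc (sp_mono hA.2 h)
    have h2 : k ∉ A := fun h => by simpa using hA.2 h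
    have h3 : insert k A ⊆ G := Finset.insert_subset hk (hA.2.trans (Finset.erase_subset _ _))
    have h4 := rk_mono (z := z) h3
    have h5 : rk z A ≤ rk z G := by omega
    have h6 : rk z G - rk z A = (rk z G - rk z (insert k A)) + 1 := by omega
    have h7 : (insert k A).card - rk z (insert k A) = A.card - rk z A := by
      rw [Finset.card_insert_of_notMem h2]; omega
    rw [tm, tm, if_pos h4, if_pos h5, h7, h6, pow_succ]
    ring
  rw [PP, this]; simp

lemma PP_rec {B G : Finset (Fin n)} {k : Fin n} {c : ℕ} (hk : k ∈ G) (hkB : k ∉ B) (hc : B.card < c) :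
    PP z B G c = PP z B (G.erase k) c + X * PP z (insert k B) G c := by
  rw [PP, QP, Icc_split hk hkB, map_add, mul_add, PP, PP, QP, QP, ← mul_assoc, ← pow_succ', Finset.card_insert_of_notMem hkB]
  congr 4
  omega

/-- The main computation over `ZMod p`. -/
theorem main_modp [hp : Fact p.Prime] : ∀ (N : ℕ) (B G : Finset (Fin n)) (c : ℕ), (G \ B).card ≤ N → B ⊆ G → psat z p B G → B.card ≤ c →
    c ≤ rk z G → FG (ZMod p) (SF z (WW z B G c)) ∧ ∀ k, (hd (ZMod p) (SF z (WW z B G c)) k : ℤ) = (PP z B G c).coeff k := by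
  intro N
  induction N with
  | zero =>
    intro B G c hN hBG hs hBc hcG
    have hGB : G ⊆ B := by
      rw [← Finset.sdiff_eq_empty_iff_subset]; exact Finset.card_eq_zero.1 (by omega)
    obtain rfl := hBG.antisymm hGB
    have : c = B.card := by have := rk_le_card (z := z) B; omega
    subst this
    have hW : WW z B B B.card = bF B ∅ := by
      ext S; simp only [WW, bF, Set.mem_setOf_eq]
      constructor
      · rintro ⟨h1, h2, h3, _⟩; exact absurd (h2.antisymm h1) h3
      · rintro ⟨_, _, h3⟩; simp at h3
    rw [hW]
    obtain ⟨h1, h2⟩ := base (z := z) (p := p) (B := B) (E := ∅) (by simp) hs.ind 1 hp.1.not_dvd_one (fun _ _ => 0) (by simp)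
    refine ⟨h1, fun k => ?_⟩
    rw [h2, PP_base subset_rfl hs.ind fun j hj => cq_mem hj]
    simp [coeff_one]
  | succ N ih =>
    intro B G c hN hBG hs hBc hcG
    have hind := hs.ind
    have herase : ∀ k ∈ G, k ∉ B → (G.erase k \ B).card ≤ N ∧ (G \ insert k B).card ≤ N ∧ B ⊆ G.erase k := by
      intro k hk hkB
      have e1 : G.erase k \ B = (G \ B).erase k := by rw [Finset.erase_sdiff_comm]
      have e2 : G \ insert k B = (G \ B).erase k := by rw [Finset.sdiff_insert]
      have e3 : k ∈ G \ B := Finset.mem_sdiff.2 ⟨hk, hkB⟩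
      rw [e1, e2, Finset.card_erase_of_mem e3]
      refine ⟨by omega, by omega, ?_⟩
      exact Finset.subset_erase.2 ⟨hBG, hkB⟩
    rcases hBc.eq_or_lt with rfl | hlt
    · by_cases hex : ∃ k ∈ G, cq z k ∉ sp z B
      · obtain ⟨k, hk, hkn⟩ := hex
        have hkB : k ∉ B := fun h => hkn (cq_mem h)
        obtain ⟨h1, h2, h3⟩ := herase k hk hkB
        have hrk : ∀ S, B ⊆ S → k ∈ S → ¬ rk z S ≤ B.card := by
          intro S hS hkS
          have := rk_mono (z := z) (Finset.insert_subset hkS hS)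
          rw [rk_insert_not hkn, hind.rk] at this
          omega
        have hW : WW z B G B.card = WW z B (G.erase k) B.card := by
          ext S
          simp only [WW, Set.mem_setOf_eq, Finset.subset_erase]
          constructor
          · rintro ⟨a, b, d, e⟩; exact ⟨a, ⟨b, fun h => hrk S a h e⟩, d, e⟩
          · rintro ⟨a, b, d, e⟩; exact ⟨a, b.1, d, e⟩
        have hP : PP z B G B.card = PP z B (G.erase k) B.card := by
          rw [PP, PP, QP, Icc_split hk hkB, QP]
          congr 2
          rw [add_eq_left]
          refine Finset.sum_eq_zero fun A hA => ?_
          rw [Finset.mem_Icc] at hA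
          rw [tm, if_neg]
          exact hrk A ((Finset.subset_insert _ _).trans hA.1) (hA.1 (Finset.mem_insert_self _ _))
        rw [hW, hP]
        exact ih B _ _ h1 h3 (hs.mono (Finset.erase_subset _ _)) le_rfl (by rw [← hind.rk]; exact rk_mono h3)
      · push Not at hex
        have hrk : ∀ S, B ⊆ S → S ⊆ G → rk z S = B.card := fun S h1 h2 => by
          rw [rk_eq_of_span h1 fun j hj => hex j (h2 hj), hind.rk]
        have hW : WW z B G B.card = bF B (G \ B) := by
          ext S
          simp only [WW, bF, Set.mem_setOf_eq, Finset.union_sdiff_of_subset hBG]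
          refine and_congr_right fun h1 => and_congr_right fun h2 => ?_
          constructor
          · rintro ⟨h3, _⟩
            obtain ⟨j, hj, hjB⟩ := Finset.not_subset.1 fun h => h3 (h.antisymm h1)
            exact ⟨j, by simp [hj, hjB, h2 hj]⟩
          · rintro ⟨j, hj⟩
            simp only [Finset.mem_inter, Finset.mem_sdiff] at hj
            exact ⟨by rintro rfl; exact hj.2.2 hj.1, (hrk S h1 h2).le⟩
        have h1 : ∀ e, ∃ m : ℕ, ¬ p ∣ m ∧ ∃ c : Fin n → ℤ, e ∈ G \ B → (m : ℤ) • zc z e = ∑ b ∈ B, c b • zc z b := by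
          intro e
          by_cases he : e ∈ G \ B
          · have he' := Finset.mem_sdiff.1 he
            obtain ⟨m, h1, c, h2⟩ := hs.coprime he'.1 he'.2 (hex e he'.1)
            exact ⟨m, h1, c, fun _ => h2⟩
          · exact ⟨1, hp.1.not_dvd_one, 0, fun h => absurd h he⟩
        choose m hm c hc using h1
        have hM := base (z := z) (p := p) (B := B) (E := G \ B) Finset.disjoint_sdiff hind (∏ e, m e)
          (by rw [hp.1.prime.dvd_finset_prod_iff]; rintro ⟨e, _, he⟩; exact hm e he)
          (fun e b => (∏ e' ∈ Finset.univ.erase e, (m e' : ℤ)) * c e b) (by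
            intro e he i
            have h1 := congrFun (hc e he) i
            simp only [zc, Finset.sum_apply, Pi.smul_apply, smul_eq_mul] at h1
            rw [Nat.cast_prod, ← Finset.mul_prod_erase _ _ (Finset.mem_univ e), mul_comm (m e : ℤ), mul_assoc, h1, Finset.mul_sum]
            exact Finset.sum_congr rfl fun b _ => by ring)
        rw [hW]
        refine ⟨hM.1, fun k => ?_⟩
        rw [hM.2, PP_base hBG hind hex, coeff_X_pow]
        simp
    · obtain ⟨k, hk, hkB, hks⟩ := hs.extend hBG (hlt.trans_le hcG)
      obtain ⟨hN1, hN2, hBk⟩ := herase k hk hkB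
      have hcard := Finset.card_insert_of_notMem hkB
      have hkrk : rk z (insert k B) ≤ c := by rw [hks.ind.rk, hcard]; exact hlt
      have hkG : insert k B ⊆ G := Finset.insert_subset hk hBG
      by_cases hce : c ≤ rk z (G.erase k)
      · obtain ⟨a1, a2⟩ := ih B _ c hN1 hBk (hs.mono (Finset.erase_subset _ _)) hBc hce
        obtain ⟨b1, b2⟩ := ih (insert k B) G c hN2 hkG hks (by omega) hcG
        let U : Set (Finset (Fin n)) := {S | S ∈ WW z B G c ∧ ¬ S ⊆ insert k B}
        let V : Set (Finset (Fin n)) := {S | S ∈ WW z B G c ∧ k ∈ S}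
        have hUW : U ⊆ WW z B G c := fun S h => h.1
        have hVW : V ⊆ WW z B G c := fun S h => h.1
        have hI : ∀ S, S ∈ WW z (insert k B) G c ↔ S ∈ U ∧ S ∈ V := by
          intro S
          simp only [U, V, WW, Set.mem_setOf_eq]
          constructor
          · rintro ⟨h1, h2, h3, h4⟩
            have h5 := h1 (Finset.mem_insert_self _ _)
            have h6 : B ⊆ S := (Finset.subset_insert _ _).trans h1
            have h7 : S ≠ B := by rintro rfl; exact hkB h5
            exact ⟨⟨⟨h6, h2, h7, h4⟩, fun h => h3 (h.antisymm h1)⟩, ⟨h6, h2, h7, h4⟩, h5⟩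
          · rintro ⟨⟨⟨h6, h2, h7, h4⟩, h8⟩, _, h5⟩
            exact ⟨Finset.insert_subset h5 h6, h2, by rintro rfl; exact h8 subset_rfl, h4⟩
        have hIU : WW z (insert k B) G c ⊆ U := fun S h => ((hI S).1 h).1
        have hIV : WW z (insert k B) G c ⊆ V := fun S h => ((hI S).1 h).2
        have mv := MV_sets (Q := QQ z) (U := SF z U) (V := SF z V) (I := SF z (WW z (insert k B) G c)) (W := SF z (WW z B G c))
          (O1 := ⋃ j ∈ ((insert k B)ᶜ : Finset (Fin n)), {q | j ∈ sup q}) (O2 := {q | k ∈ sup q})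
          (isOpen_biUnion fun j _ => open_ne j) (open_ne k)
          (by
            ext q
            simp only [Set.mem_inter_iff, Set.mem_iUnion, Set.mem_setOf_eq, Finset.mem_compl, exists_prop]
            refine and_congr Iff.rfl ?_
            rw [Finset.not_subset]
            exact exists_congr fun j => and_comm)
          rfl (by ext q; exact hI _)
          (by
            intro q hq
            have hq : sup q ∈ WW z B G c := hq
            by_cases h : k ∈ sup q
            · exact Or.inr h
            · left
              obtain ⟨j, hj, hjB⟩ := Finset.not_subset.1 fun h => hq.2.2.1 (h.antisymm hq.1)
              simp only [Set.mem_iUnion, Set.mem_setOf_eq, Finset.mem_compl, exists_prop]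
              refine ⟨j, ?_, hj⟩
              rw [Finset.mem_insert]
              rintro (rfl | h')
              exacts [h hj, hjB h'])
          (SF_mono hUW) (SF_mono hVW) (SF_mono hIU) (SF_mono hIV)
        have hAU : WW z B (G.erase k) c ⊆ U := by
          rintro S ⟨h1, h2, h3, h4⟩
          refine ⟨⟨h1, h2.trans (Finset.erase_subset _ _), h3, h4⟩, fun h => h3 (Finset.Subset.antisymm ?_ h1)⟩
          intro j hj
          rcases Finset.mem_insert.1 (h hj) with rfl | h'
          · simpa using h2 hj
          · exact h'
        have qU : QI (ZMod p) (inc (SF_mono (z := z) hAU)) := by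
          refine deform_zero {k} hAU ?_
          rintro S ⟨⟨h1, h2, h3, h4⟩, h5⟩
          rw [Finset.sdiff_singleton_eq_erase]
          refine ⟨Finset.subset_erase.2 ⟨h1, hkB⟩, Finset.erase_subset_erase _ h2, ?_, (rk_mono (Finset.erase_subset _ _)).trans h4⟩
          intro h
          apply h5
          rw [← h]
          exact Finset.insert_erase_subset _ _ 
        have hBV : ({insert k B} : Set (Finset (Fin n))) ⊆ V := by
          rintro _ rfl
          refine ⟨⟨Finset.subset_insert _ _, hkG, ?_, hkrk⟩, Finset.mem_insert_self _ _⟩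
          exact Finset.insert_ne_self.2 hkB
        have qV : QI (ZMod p) (inc (SF_mono (z := z) hBV)) := by
          refine deform_zero (insert k B)ᶜ hBV ?_
          rintro S ⟨⟨h1, h2, h3, h4⟩, h5⟩
          rw [sdiff_compl]
          exact Finset.inter_eq_right.2 (Finset.insert_subset h5 h1)
        have hV : Acy (ZMod p) (SF z V) := qV.acy_iff.1 (contr_ind hks.ind)
        have hU : FG (ZMod p) (SF z U) := qU.fg_iff.1 a1
        refine ⟨mv.fg hU hV.fg b1, ?_⟩
        obtain ⟨d1, d2⟩ := mv.dim hU hV b1 (by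
          intro i
          have e1 := b2 i
          have e2 := a2 i
          rw [qU.hd_eq] at e2
          by_cases hi : i % 2 = (c - B.card) % 2
          · left
            rw [PP_par (by rw [hcard]; omega)] at e1
            exact_mod_cast e1
          · right
            rw [PP_par hi] at e2
            exact_mod_cast e2)
        intro i
        rw [PP_rec hk hkB hlt]
        cases i with
        | zero =>
          rw [d1, ← qU.hd_eq, a2]; simp
        | succ i => rw [d2, ← qU.hd_eq, Nat.cast_add, a2, b2, coeff_add, coeff_X_mul]
      · have hkn : cq z k ∉ sp z (G.erase k) := by
          intro h
          have := rk_insert_mem h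
          rw [Finset.insert_erase hk] at this
          omega
        have hrk := rk_insert_not hkn
        rw [Finset.insert_erase hk] at hrk
        have : c = rk z G := by omega
        subst this
        have hac : Acy (ZMod p) (SF z (WW z B G (rk z G))) := by
          refine contr_coloop hk hkn hBk hks.ind _ ?_ ?_
          · rintro S ⟨h1, h2, h3, h4⟩
            have h5 := Finset.insert_subset hk h2
            refine ⟨h1, h2, h1.trans (Finset.subset_insert _ _), h5, ?_, rk_mono h5⟩
            intro h
            exact hkB (h ▸ Finset.mem_insert_self _ _)
          · exact ⟨Finset.subset_insert _ _, hkG, Finset.insert_ne_self.2 hkB, hkrk⟩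
        refine ⟨hac.fg, fun i => ?_⟩
        rw [hac.hd_eq, PP_coloop hk hkB hkn]; simp

end
end SSH

namespace SSH

section
variable {n r : ℕ} {z : Fin r → Fin n → ℤ} {R : Type} [CommRing R]

lemma ext_char {M : Type} [AddCommGroup M] (L : Submodule ℤ M) (f : L →ₗ[ℤ] Additive Circle) :
    ∃ g : M →ₗ[ℤ] Additive Circle, ∀ x : L, g x = f x := by
  classical
  have : ∀ (m : ℤ), m ≠ 0 → Function.Surjective fun a : Additive Circle => m • a := by
    intro m hm a
    obtain ⟨v, hv⟩ := circle_root a.toMul m hm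
    exact ⟨Additive.ofMul v, congrArg Additive.ofMul hv⟩
  let D : DivisibleBy (Additive Circle) ℤ := divisibleByOfSMulRightSurj _ _ (fun {m} hm => this m hm)
  obtain ⟨g, hg⟩ := (Module.Baer.of_divisible (Additive Circle)).extension_property L.subtype L.injective_subtype f
  exact ⟨g, fun x => by rw [← hg]; rfl⟩

/-- character attached to a point of a torus -/
def chr {J : Type} [Fintype J] (u : J → Circle) : (J → ℤ) →ₗ[ℤ] Additive Circle :=
  Fintype.linearCombination ℤ fun j => Additive.ofMul (u j)

lemma chr_apply {J : Type} [Fintype J] (u : J → Circle) (a : J → ℤ) : (chr u a).toMul = ∏ j, u j ^ a j := by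
  rw [chr, Fintype.linearCombination_apply, toMul_sum]; rfl

lemma chr_mul {J : Type} [Fintype J] (u v : J → Circle) (a : J → ℤ) : chr (u * v) a = chr u a + chr v a := by
  apply Additive.toMul.injective
  rw [toMul_add, chr_apply, chr_apply, chr_apply, ← Finset.prod_mul_distrib]
  simp [mul_zpow]

lemma chr_surj {J : Type} [Fintype J] (g : (J → ℤ) →ₗ[ℤ] Additive Circle) : ∃ u, chr u = g := by
  classical
  refine ⟨fun j => (g (Pi.single j 1)).toMul, ?_⟩
  refine LinearMap.pi_ext' fun j => LinearMap.ext_ring ?_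
  simp [chr, Fintype.linearCombination_apply_single]

lemma chr_single {J : Type} [Fintype J] [DecidableEq J] (u : J → Circle) (j : J) : chr u (Pi.single j 1) = Additive.ofMul (u j) := by
  simp [chr, Fintype.linearCombination_apply_single]

lemma chr_zc (t : Fin r → Circle) (j : Fin n) : chr t (zc z j) = Additive.ofMul (weightProd z t j) := by
  apply Additive.toMul.injective
  rw [chr_apply]; rfl

lemma FG_KK [IsNoetherianRing R] (J : Finset (Fin n)) : FG R (KK z J) := by
  classical
  let ζ : (J → ℤ) →ₗ[ℤ] (Fin r → ℤ) := Fintype.linearCombination ℤ fun j : J => zc z j.1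
  have hζ : ∀ j : J, ζ (Pi.single j 1) = zc z j.1 := fun j => by simp [ζ, Fintype.linearCombination_apply_single]
  have hζt : ∀ t, (chr t).comp ζ = chr fun j : J => weightProd z t j.1 := by
    intro t
    refine LinearMap.pi_ext' fun j => LinearMap.ext_ring ?_
    change chr t (ζ (Pi.single j 1)) = chr _ (Pi.single j 1)
    rw [hζ, chr_zc, chr_single]
  let K := LinearMap.ker ζ
  let b := Module.finBasis ℤ K
  let d := Module.finrank ℤ K
  let f : (J → Circle) → (Fin d → Circle) := fun u k => (chr u (b k).1).toMul
  have hf : Continuous f := by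
    refine continuous_pi fun k => ?_
    simp only [f, chr_apply]
    refine continuous_finsetProd _ fun j _ => (continuous_apply j).zpow _
  have hfs : Function.Surjective f := by
    intro s
    obtain ⟨g, hg⟩ := ext_char K (b.constr ℤ fun k => Additive.ofMul (s k))
    obtain ⟨u, rfl⟩ := chr_surj g
    refine ⟨u, ?_⟩
    ext1 k
    simp only [f]
    rw [hg, Module.Basis.constr_basis]; rfl
  have hfe : ∀ u v, f u = f v ↔ ∃ t, ∀ j : J, weightProd z t j.1 * u j = v j := by
    intro u v
    constructor
    · intro h
      obtain ⟨w, hw⟩ : ∃ w, w * u = v := ⟨v * u⁻¹, by simp⟩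
      have h1 : ∀ x ∈ K, chr w x = 0 := by
        have : (chr w).comp K.subtype = 0 := by
          refine b.ext fun k => ?_
          change chr w (b k).1 = 0
          have := congrArg Additive.ofMul (congrFun h k)
          change chr u (b k).1 = chr v (b k).1 at this
          rw [← hw, chr_mul] at this
          exact right_eq_add.1 this
        intro x hx
        exact LinearMap.congr_fun this ⟨x, hx⟩
      let φ : LinearMap.range ζ →ₗ[ℤ] Additive Circle := (K.liftQ (chr w) h1).comp ζ.quotKerEquivRange.symm.toLinearMap
      obtain ⟨g, hg⟩ := ext_char _ φ
      obtain ⟨t, rfl⟩ := chr_surj g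
      refine ⟨t, fun j => ?_⟩
      have h2 := hg ⟨ζ (Pi.single j 1), _, rfl⟩
      have h3 : ζ.quotKerEquivRange.symm ⟨ζ (Pi.single j 1), _, rfl⟩ = Submodule.Quotient.mk (Pi.single j 1) := by
        rw [LinearEquiv.symm_apply_eq]; rfl
      simp only [φ, LinearMap.comp_apply, LinearEquiv.coe_coe] at h2
      rw [h3] at h2
      erw [Submodule.liftQ_apply] at h2
      rw [hζ, chr_zc, chr_single] at h2
      have h4 : weightProd z t j.1 = w j := h2
      rw [h4, ← hw]; rfl
    · rintro ⟨t, ht⟩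
      have h1 : v = (fun j : J => weightProd z t j.1) * u := by ext1 j; exact (ht j).symm
      ext1 k
      simp only [f]
      rw [h1, chr_mul, ← hζt, LinearMap.comp_apply, (b k).2, map_zero, zero_add]
  have hgm : ∀ u : J → Circle, pq z (ex ∅ J fun j => (u j : ℂ)) ∈ KK z J := by
    intro u j
    rw [ab_pq]
    by_cases hj : j ∈ J <;> simp [ex, hj, cnorm]
  let g : (J → Circle) → KK z J := fun u => ⟨_, hgm u⟩
  have hg : Continuous g := by
    have := ex_cont (n := n) ∅ J
    have := pq_cont (z := z)
    fun_prop
  have hgs : Function.Surjective g := by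
    rintro ⟨q, hq⟩
    obtain ⟨x, rfl⟩ := pq_surj q
    have hx : ∀ j ∈ J, ‖x j‖ = 1 := by
      intro j hj
      have := hq j
      rwa [ab_pq, if_pos hj] at this
    have hx' : ∀ j ∉ J, x j = 0 := by
      intro j hj
      have := hq j
      rwa [ab_pq, if_neg hj, norm_eq_zero] at this
    refine ⟨fun j => nrm (x j.1) (norm_ne_zero_iff.1 (by rw [hx _ j.2]; simp)), Subtype.ext ?_⟩
    change pq z _ = pq z _
    congr 1
    ext j
    by_cases hj : j ∈ J
    · simp only [ex, hj, Finset.notMem_empty, if_false, dif_pos]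
      change x j / (‖x j‖ : ℂ) = _
      rw [hx j hj]; simp
    · simp [ex, hj, hx' j hj]
  have hge : ∀ u v, g u = g v ↔ ∃ t, ∀ j : J, weightProd z t j.1 * u j = v j := by
    intro u v
    rw [Subtype.ext_iff]
    change pq z _ = pq z _ ↔ _
    rw [pq_eq]
    refine exists_congr fun t => ?_
    constructor
    · intro h j
      have := h j.1
      simp only [ex, j.2, Finset.notMem_empty, if_false, dif_pos] at this
      exact Circle.ext (by simpa using this)
    · intro h j
      by_cases hj : j ∈ J
      · have := congrArg (fun c : Circle => (c : ℂ)) (h ⟨j, hj⟩)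
        simpa [ex, hj] using this
      · simp [ex, hj]
  have qf : Topology.IsQuotientMap (⟨f, hf⟩ : C(_, _)) := hf.isClosedMap.isQuotientMap hf hfs
  have qg : Topology.IsQuotientMap (⟨g, hg⟩ : C(_, _)) := hg.isClosedMap.isQuotientMap hg hgs
  have hk : Setoid.ker (⟨f, hf⟩ : C(_, _)) = Setoid.ker (⟨g, hg⟩ : C(_, _)) := by
    ext u v
    exact (hfe u v).trans (hge u v).symm
  have e1 := qf.homeomorph
  rw [hk] at e1
  let e : (Fin d → Circle) ≃ₜ KK z J := e1.symm.trans qg.homeomorph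
  exact (QI_homeo e).fg_iff.1 (FG_torus d)

lemma FG_WW [IsNoetherianRing R] (c : ℕ) : FG R (SF z (WW z ∅ Finset.univ c)) := by
  classical
  let O : Fin n → Set (SF z (WW z ∅ Finset.univ c)) := fun e => {q | e ∈ sup q.1}
  have hO : ∀ e, IsOpen (O e) := fun e => (open_ne e).preimage continuous_subtype_val
  have hcov : (⋃ s ∈ (Finset.univ : Finset (Fin n)), O s) = Set.univ := by
    rw [Set.eq_univ_iff_forall]
    rintro ⟨q, h1, h2, h3, h4⟩
    obtain ⟨e, he⟩ := Finset.nonempty_iff_ne_empty.2 h3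
    simp only [Finset.mem_univ, Set.iUnion_true, Set.mem_iUnion]
    exact ⟨e, he⟩
  suffices h : FG R (⋃ s ∈ (Finset.univ : Finset (Fin n)), O s : Set _) by
    rw [hcov] at h
    exact (QI_homeo (R := R) (Homeomorph.Set.univ (SF z (WW z ∅ Finset.univ c)))).fg_iff.1 h
  refine cover_fg O hO ?_ _
  intro J hJ
  let A : Set (Finset (Fin n)) := {S | S ∈ WW z ∅ Finset.univ c ∧ J ⊆ S}
  have mO : ∀ q, q ∈ (⋂ j ∈ J, O j) ↔ J ⊆ sup q.1 := by
    intro q; simp [O, Finset.subset_iff]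
  let e : SF z A ≃ₜ (⋂ j ∈ J, O j : Set _) :=
    { toFun := fun q => ⟨⟨q.1, q.2.1⟩, (mO _).2 q.2.2⟩
      invFun := fun q => ⟨q.1.1, q.1.2, (mO _).1 q.2⟩
      left_inv := fun q => rfl
      right_inv := fun q => rfl
      continuous_toFun := by fun_prop
      continuous_invFun := by fun_prop }
  refine (QI_homeo e).fg_iff.1 ?_
  by_cases hc : rk z J ≤ c
  · have hJA : ({J} : Set (Finset (Fin n))) ⊆ A := by
      rintro _ rfl
      exact ⟨⟨Finset.empty_subset _, Finset.subset_univ _, hJ.ne_empty, hc⟩, subset_rfl⟩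
    have q1 : QI R (inc (SF_mono (z := z) hJA)) := by
      refine deform_zero Jᶜ hJA ?_
      rintro S ⟨_, h⟩
      rw [sdiff_compl]
      exact Finset.inter_eq_right.2 h
    exact q1.fg_iff.1 ((KK_qi (R := R) (z := z) J).fg_iff.1 (FG_KK J))
  · have : SF z A = ∅ := by
      ext q
      simp only [Set.mem_empty_iff_false, iff_false]
      rintro ⟨h1, h2⟩
      exact hc ((rk_mono h2).trans h1.2.2.2)
    rw [this]
    exact FG_empty

end
end SSH

namespace SSH

section
variable (R : Type) [CommRing R] (X : Type) [TopologicalSpace X]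

def Zd (k : ℕ) : Submodule R (Ch R X k) where
  carrier := {x | cyc (dC R X) k x}
  add_mem' := by
    intro a b ha hb
    cases k with
    | zero => trivial
    | succ k =>
      have ha : dC R X k a = 0 := ha
      have hb : dC R X k b = 0 := hb
      change dC R X k (a + b) = 0
      rw [map_add, ha, hb, add_zero]
  zero_mem' := by
    cases k with
    | zero => trivial
    | succ k => exact map_zero (dC R X k)
  smul_mem' := by
    intro c a ha
    cases k with
    | zero => trivial
    | succ k =>
      have ha : dC R X k a = 0 := ha
      change dC R X k (c • a) = 0
      rw [map_smul, ha, smul_zero]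

def cl (k : ℕ) : Zd R X k →ₗ[R] (SC R X).homology k where
  toFun x := mkH (SC R X) k ⟨x.1, mem_Zc_CC.2 x.2⟩
  map_add' x y := (mkH (SC R X) k).map_add ⟨x.1, mem_Zc_CC.2 x.2⟩ ⟨y.1, mem_Zc_CC.2 y.2⟩
  map_smul' c x := (mkH (SC R X) k).map_smul c ⟨x.1, mem_Zc_CC.2 x.2⟩

lemma cl_surj (k : ℕ) : Function.Surjective (cl R X k) := by
  intro h
  obtain ⟨⟨x, hx⟩, rfl⟩ := mkH_surj (SC R X) k h
  exact ⟨⟨x, mem_Zc_CC.1 hx⟩, rfl⟩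

lemma cl_eq_zero {k : ℕ} (x : Zd R X k) : cl R X k x = 0 ↔ ∃ y, dC R X k y = x.1 := by
  refine (mkH_eq_zero (SC R X) (k := k) ⟨x.1, mem_Zc_CC.2 x.2⟩).trans ?_
  refine exists_congr fun y => ?_
  exact ⟨fun h => (SC_d R k y).symm.trans h, fun h => (SC_d R k y).trans h⟩

lemma cyc_smul_cancel {k : ℕ} {p : ℕ} (hp : p ≠ 0) {x : Ch ℤ X k} (h : cyc (dC ℤ X) k ((p : ℤ) • x)) : cyc (dC ℤ X) k x := by
  cases k with
  | zero => trivial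
  | succ k =>
    have h : dC ℤ X k ((p : ℤ) • x) = 0 := h
    rw [map_smul] at h
    exact (smul_eq_zero.1 h).resolve_left (by exact_mod_cast hp)

lemma cyc_d (k : ℕ) (x : Ch R X (k+1)) : cyc (dC R X) k (dC R X k x) := by
  cases k with
  | zero => trivial
  | succ k => exact dC_dC' ..

lemma cyc_sub {k : ℕ} {x y : Ch R X k} (hx : cyc (dC R X) k x) (hy : cyc (dC R X) k y) : cyc (dC R X) k (x - y) :=
  (Zd R X k).sub_mem hx hy

/-- reduction mod p -/
def rd (p k : ℕ) : Ch ℤ X k →+ Ch (ZMod p) X k := Finsupp.mapRange.addMonoidHom (Int.castAddHom (ZMod p))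

variable {X}
lemma rd_single (p k : ℕ) (σ) : rd X p k (Finsupp.single σ 1) = Finsupp.single σ 1 := by
  simp [rd]

lemma rd_d (p k : ℕ) (x : Ch ℤ X (k+1)) : rd X p k (dC ℤ X k x) = dC (ZMod p) X k (rd X p (k+1) x) := by
  have : (rd X p k).comp (dC ℤ X k).toAddMonoidHom = (dC (ZMod p) X k).toAddMonoidHom.comp (rd X p (k+1)) := by
    refine Finsupp.addHom_ext' fun σ => AddMonoidHom.ext_int ?_
    change rd X p k (dC ℤ X k (Finsupp.single σ 1)) = dC (ZMod p) X k (rd X p (k+1) (Finsupp.single σ 1))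
    rw [rd_single, dC_single, dC_single, map_sum]
    refine Finset.sum_congr rfl fun i _ => ?_
    rw [map_zsmul, rd_single, ← Int.cast_smul_eq_zsmul (ZMod p)]
    simp
  exact DFunLike.congr_fun this x

lemma rd_surj (p k : ℕ) : Function.Surjective (rd X p k) :=
  Finsupp.mapRange_surjective _ (by simp) (ZMod.intCast_surjective (n := p))

lemma rd_zero {p k : ℕ} {x : Ch ℤ X k} (h : rd X p k x = 0) : ∃ v, x = (p : ℤ) • v := by
  refine ⟨Finsupp.mapRange (fun a => a / p) (by simp) x, ?_⟩
  ext σ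
  have := DFunLike.congr_fun h σ
  have h1 : ((x σ : ℤ) : ZMod p) = 0 := this
  rw [ZMod.intCast_zmod_eq_zero_iff_dvd] at h1
  simp [Int.mul_ediv_cancel' h1]

lemma rd_p (p k : ℕ) (v : Ch ℤ X k) : rd X p k ((p : ℤ) • v) = 0 := by
  rw [map_zsmul, ← Int.cast_smul_eq_zsmul (ZMod p)]; simp

lemma rd_cyc {p k : ℕ} {x : Ch ℤ X k} (h : cyc (dC ℤ X) k x) : cyc (dC (ZMod p) X) k (rd X p k x) := by
  cases k with
  | zero => trivial
  | succ k =>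
    have h : dC ℤ X k x = 0 := h
    change dC (ZMod p) X k _ = 0
    rw [← rd_d, h, map_zero]

lemma rd_lift {p k : ℕ} {x y : Ch ℤ X k} (h : rd X p k x = rd X p k y) : ∃ v, x = y + (p : ℤ) • v := by
  obtain ⟨v, hv⟩ := rd_zero (p := p) (x := x - y) (by rw [map_sub, h, sub_self])
  exact ⟨v, by rw [← hv]; abel⟩

lemma exact_of_hd {p k : ℕ} [Fact p.Prime] (hf : FG (ZMod p) X) (h : hd (ZMod p) X k = 0) :
    ∀ x : Ch (ZMod p) X k, cyc (dC (ZMod p) X) k x → ∃ y, dC (ZMod p) X k y = x := by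
  have := hf k
  have : Subsingleton ((SC (ZMod p) X).homology k) := Module.finrank_zero_iff.1 h
  exact CC_subsing.1 this

section
variable {M : Type} [AddCommGroup M] {k : ℕ} (c : Zd ℤ X k →+ M)

/-- no p-torsion -/
lemma no_tor {p : ℕ} [hp : Fact p.Prime] (hs : Function.Surjective c)
    (hc : ∀ x, c x = 0 ↔ ∃ y, dC ℤ X k y = x.1) (hf : FG (ZMod p) X) (h : hd (ZMod p) X (k+1) = 0) (m : M)
    (hm : (p : ℤ) • m = 0) : m = 0 := by
  obtain ⟨x, rfl⟩ := hs m
  rw [← map_zsmul, hc] at hm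
  obtain ⟨y, hy⟩ := hm
  have hy : dC ℤ X k y = (p : ℤ) • x.1 := hy
  rw [hc]
  obtain ⟨w', hw⟩ := exact_of_hd hf h (rd X p (k+1) y) (by
    change dC (ZMod p) X k _ = 0
    rw [← rd_d, hy, rd_p])
  obtain ⟨w, rfl⟩ := rd_surj p _ w'
  rw [← rd_d] at hw
  obtain ⟨v, hv⟩ := rd_lift hw.symm
  refine ⟨v, ?_⟩
  rw [hv, map_add, dC_dC', zero_add, map_smul] at hy
  exact smul_right_injective _ (by exact_mod_cast hp.1.ne_zero : (p : ℤ) ≠ 0) hy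

lemma p_div {p : ℕ} [hp : Fact p.Prime] (hc : ∀ x, c x = 0 ↔ ∃ y, dC ℤ X k y = x.1) (x : Zd ℤ X k)
    (h : ∃ w, dC (ZMod p) X k w = rd X p k x.1) :
    ∃ c', c x = (p : ℤ) • c' := by
  obtain ⟨w', hw⟩ := h
  obtain ⟨w, rfl⟩ := rd_surj p _ w'
  rw [← rd_d] at hw
  obtain ⟨v, hv⟩ := rd_lift hw.symm
  have hvc : cyc (dC ℤ X) k v := by
    refine cyc_smul_cancel X hp.1.ne_zero ?_
    have : (p : ℤ) • v = x.1 - dC ℤ X k w := by rw [hv]; abel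
    rw [this]
    exact cyc_sub ℤ X x.2 (cyc_d ℤ X k w)
  refine ⟨c ⟨v, hvc⟩, ?_⟩
  rw [← map_zsmul, ← sub_eq_zero, ← map_sub, hc]
  refine ⟨w, ?_⟩
  change _ = x.1 - (p : ℤ) • v
  rw [hv]; abel
end

lemma fin_transfer {H M Z : Type} [AddCommGroup H] [inst : Module ℤ H] [hf : Module.Finite ℤ H] [AddCommGroup M] [AddCommGroup Z]
    (a : Z →+ H) (ha : Function.Surjective a) (b : Z →+ M) (hb : Function.Surjective b) (hab : ∀ x, a x = 0 → b x = 0) : Module.Finite ℤ M := by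
  obtain rfl : inst = AddCommGroup.toIntModule H := Subsingleton.elim _ _
  choose s hs using ha
  have hψ : ∀ x y, a x = a y → b x = b y := by
    intro x y hxy
    rw [← sub_eq_zero, ← map_sub]
    exact hab _ (by rw [map_sub, hxy, sub_self])
  let φ : H →+ M :=
      { toFun := fun c => b (s c)
        map_zero' := by rw [← map_zero b]; exact hψ _ _ (by rw [hs, map_zero])
        map_add' := fun a b => by rw [← map_add]; exact hψ _ _ (by rw [hs, map_add, hs, hs]) }
  refine Module.Finite.of_surjective φ.toIntLinearMap fun m => ?_
  obtain ⟨x, rfl⟩ := hb m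
  exact ⟨a x, hψ _ _ (hs _)⟩

lemma zero_of_div {M : Type} [AddCommGroup M] [Module.Finite ℤ M] (h : ∀ p : ℕ, p.Prime → ∀ c : M, ∃ c', c = (p : ℤ) • c') : Subsingleton M := by
  have h2 : (⊤ : Submodule ℤ M) ≤ Ideal.span {(2 : ℤ)} • ⊤ := by
    intro c _
    obtain ⟨c', rfl⟩ := h 2 Nat.prime_two c
    exact Submodule.smul_mem_smul (Ideal.mem_span_singleton_self _) trivial
  obtain ⟨m, hm1, hm2⟩ := Submodule.exists_sub_one_mem_and_smul_eq_zero_of_fg_of_le_smul _ _ Module.Finite.fg_top h2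
  have hm0 : m ≠ 0 := by
    rintro rfl
    rw [Ideal.mem_span_singleton] at hm1
    omega
  have key : ∀ k : ℕ, ∀ m : ℕ, m ≤ k → m ≠ 0 → (∀ c : M, (m : ℤ) • c = 0) → Subsingleton M := by
    intro k
    induction k with
    | zero => intro m h1 h2; omega
    | succ k ih =>
      intro m h1 h0 hm
      by_cases h1' : m = 1
      · subst h1'
        exact ⟨fun a b => by
          have ha := hm a
          have hb := hm b
          simp only [Nat.cast_one, one_smul] at ha hb
          rw [ha, hb]⟩
      · obtain ⟨q, hq, m', rfl⟩ := Nat.exists_prime_and_dvd h1'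
        refine ih m' ?_ (by rintro rfl; simp at h0) fun c => ?_
        · have := hq.two_le
          have : 0 < m' := Nat.pos_of_ne_zero (by rintro rfl; simp at h0)
          nlinarith
        · obtain ⟨c', rfl⟩ := h q hq c
          rw [smul_smul, mul_comm]
          exact_mod_cast hm c'
  refine key _ m.natAbs le_rfl (Int.natAbs_ne_zero.2 hm0) fun c => ?_
  rcases Int.natAbs_eq m with h' | h'
  · rw [← h']; exact hm2 c trivial
  · have : (m.natAbs : ℤ) = - m := by omega
    rw [this, neg_smul, hm2 c trivial, neg_zero]

lemma rank_eq {M N : Type} [AddCommGroup M] [Module.Finite ℤ M] [Module.Free ℤ M] {p : ℕ} [Fact p.Prime] [AddCommGroup N] [Module (ZMod p) N]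
    (φ : M →+ N) (hs : Function.Surjective φ) (hk : ∀ x, φ x = 0 → ∃ y, x = (p : ℤ) • y) : Module.finrank ℤ M = Module.finrank (ZMod p) N := by
  let b := Module.finBasis ℤ M
  have hsum : ∀ a : Fin (Module.finrank ℤ M) → ℤ, φ (∑ i, a i • b i) = ∑ i, (a i : ZMod p) • φ (b i) := by
    intro a
    rw [map_sum]
    exact Finset.sum_congr rfl fun i _ => by rw [map_zsmul, Int.cast_smul_eq_zsmul]
  have hli : LinearIndependent (ZMod p) fun i => φ (b i) := by
    rw [Fintype.linearIndependent_iff]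
    intro g hg i
    choose a ha using fun i => ZMod.intCast_surjective (n := p) (g i)
    have h1 : φ (∑ i, a i • b i) = 0 := by
      rw [hsum, ← hg]
      simp_rw [ha]
    obtain ⟨y, hy⟩ := hk _ h1
    have h2 := congrArg (fun x => b.repr x i) hy
    simp only [Module.Basis.repr_sum_self, map_smul, Finsupp.smul_apply, smul_eq_mul] at h2
    rw [← ha, h2]; simp
  have hsp : ⊤ ≤ Submodule.span (ZMod p) (Set.range fun i => φ (b i)) := by
    intro y _
    obtain ⟨x, rfl⟩ := hs y
    rw [← b.sum_repr x, hsum]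
    exact Submodule.sum_mem _ fun i _ => Submodule.smul_mem _ _ (Submodule.subset_span ⟨i, rfl⟩)
  rw [Module.finrank_eq_card_basis (Module.Basis.mk hli hsp)]; simp

theorem uct (h : ℕ → ℕ) (ε : ℕ) (hh : ∀ k, k % 2 ≠ ε % 2 → h k = 0) (hZ : FG ℤ X) (hF : ∀ (p : ℕ) [Fact p.Prime], FG (ZMod p) X)
    (hd' : ∀ (p : ℕ) [Fact p.Prime] k, hd (ZMod p) X k = h k) (k : ℕ) {M : Type} [AddCommGroup M] (c : Zd ℤ X k →+ M)
    (hs : Function.Surjective c) (hc : ∀ x, c x = 0 ↔ ∃ y, dC ℤ X k y = x.1) :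
    Module.Free ℤ M ∧ Module.Finite ℤ M ∧ Module.finrank ℤ M = h k := by
  have hfin : ∀ k {M : Type} [AddCommGroup M] (c : Zd ℤ X k →+ M)
    (hs : Function.Surjective c) (hc : ∀ x, c x = 0 ↔ ∃ y, dC ℤ X k y = x.1), Module.Finite ℤ M := by
    intro k M _ c hs hc
    have := hZ k
    exact fin_transfer (cl ℤ X k).toAddMonoidHom (cl_surj ℤ X k) c hs fun x hx => (hc x).2 ((cl_eq_zero ℤ X x).1 hx)
  have hz : ∀ k {M : Type} [AddCommGroup M] (c : Zd ℤ X k →+ M)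
    (hs : Function.Surjective c) (hc : ∀ x, c x = 0 ↔ ∃ y, dC ℤ X k y = x.1), h k = 0 → Subsingleton M := by
    intro k M _ c hs hc hk
    have := hfin k c hs hc
    refine zero_of_div fun p hp m => ?_
    have : Fact p.Prime := ⟨hp⟩
    obtain ⟨x, rfl⟩ := hs m
    exact p_div c hc x (exact_of_hd (hF p) ((hd' p k).trans hk) _ (rd_cyc x.2))
  have hfM := hfin k c hs hc
  by_cases hk : h k = 0
  · have := hz k c hs hc hk
    exact ⟨inferInstance, hfM, by rw [hk]; exact Module.finrank_zero_of_subsingleton⟩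
  · have hpar : k % 2 = ε % 2 := by
      by_contra h'; exact hk (hh k h')
    have htf : Module.IsTorsionFree ℤ M := by
      have hpt : ∀ p : ℕ, p.Prime → ∀ c : M, (p : ℤ) • c = 0 → c = 0 := by
        intro p hp m
        have : Fact p.Prime := ⟨hp⟩
        exact no_tor c hs hc (hF p) ((hd' p _).trans (hh _ (by omega))) m
      have key : ∀ m : ℕ, m ≠ 0 → ∀ c : M, (m : ℤ) • c = 0 → c = 0 := by
        intro m
        induction m using Nat.recOnMul with
        | zero => intro h; exact absurd rfl h
        | one => intro _ c hc; simpa using hc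
        | prime p hp => intro _; exact hpt p hp
        | mul a b iha ihb =>
          intro hab c hc
          rw [Nat.cast_mul, mul_smul] at hc
          exact ihb (right_ne_zero_of_mul hab) c (iha (left_ne_zero_of_mul hab) _ hc)
      refine Module.isTorsionFree_iff_smul_eq_zero.2 ?_
      intro m c hmc
      by_cases hm : m = 0
      · exact Or.inl hm
      right
      refine key m.natAbs (Int.natAbs_ne_zero.2 hm) c ?_
      rcases Int.natAbs_eq m with h' | h'
      · rw [← h']; exact hmc
      · have : (m.natAbs : ℤ) = - m := by omega
        rw [this, neg_smul, hmc, neg_zero]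
    have hfree : Module.Free ℤ M := inferInstance
    refine ⟨hfree, hfM, ?_⟩
    haveI : Fact (Nat.Prime 2) := ⟨Nat.prime_two⟩
    rw [← hd' 2 k]
    -- the reduction map on homology
    let ψ : Zd ℤ X k →+ (SC (ZMod 2) X).homology k :=
      { toFun := fun x => cl (ZMod 2) X k ⟨rd X 2 k x.1, rd_cyc x.2⟩
        map_zero' := by
          rw [cl_eq_zero]; exact ⟨0, by simp⟩
        map_add' := fun x y => by
          rw [← map_add]; congr 1; ext1; simp }
    have hφ0 : ∀ x : Zd ℤ X k, c x = 0 → ψ x = 0 := by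
      intro x hx
      obtain ⟨y, hy⟩ := (hc x).1 hx
      exact (cl_eq_zero _ _ _).2 ⟨rd X 2 _ y, by rw [← rd_d, hy]⟩
    choose s hs' using hs
    have hψ : ∀ x y, c x = c y → ψ x = ψ y := by
      intro x y hxy
      rw [← sub_eq_zero, ← map_sub]
      exact hφ0 _ (by rw [map_sub, hxy, sub_self])
    let φ : M →+ (SC (ZMod 2) X).homology k :=
      { toFun := fun c => ψ (s c)
        map_zero' := by rw [← map_zero ψ]; exact hψ _ _ (by rw [hs', map_zero])
        map_add' := fun a b => by rw [← map_add]; exact hψ _ _ (by rw [hs', map_add, hs', hs']) }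
    have hφ : ∀ x, φ (c x) = ψ x := fun x => hψ _ _ (hs' _)
    refine rank_eq (p := 2) φ ?_ ?_
    · intro m
      obtain ⟨⟨x', hx'⟩, rfl⟩ := cl_surj (ZMod 2) X k m
      obtain ⟨x, rfl⟩ := rd_surj 2 k x'
      obtain ⟨x1, hx1, hr⟩ : ∃ x1, cyc (dC ℤ X) k x1 ∧ rd X 2 k x1 = rd X 2 k x := by
        clear hφ φ hψ hφ0 ψ hs' s hc hfM htf hfree
        cases k with
        | zero => exact ⟨x, trivial, rfl⟩
        | succ k =>
          have hx' : dC (ZMod 2) X k (rd X 2 (k+1) x) = 0 := hx'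
          rw [← rd_d] at hx'
          obtain ⟨v, hv⟩ := rd_zero hx'
          have hvc : cyc (dC ℤ X) k v := cyc_smul_cancel X two_ne_zero (by rw [← hv]; exact cyc_d ℤ X k x)
          have hsub := hz k (cl ℤ X k).toAddMonoidHom (cl_surj ℤ X k) (cl_eq_zero ℤ X) (hh k (by omega))
          obtain ⟨w, hw⟩ := (cl_eq_zero ℤ X ⟨v, hvc⟩).1 (Subsingleton.elim _ _)
          have hw : dC ℤ X k w = v := hw
          refine ⟨x - ((2 : ℕ) : ℤ) • w, ?_, ?_⟩
          · change dC ℤ X k _ = 0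
            rw [map_sub, map_smul, hw, hv, sub_self]
          · rw [map_sub, rd_p, sub_zero]
      refine ⟨c ⟨x1, hx1⟩, ?_⟩
      rw [hφ]
      change cl (ZMod 2) X k ⟨rd X 2 k x1, _⟩ = _
      congr 1
      ext1
      exact hr
    · intro m hm
      obtain ⟨x, rfl⟩ : ∃ x, c x = m := ⟨_, hs' m⟩
      rw [hφ] at hm
      exact p_div (p := 2) c hc x ((cl_eq_zero _ _ _).1 hm)

end
end SSH

namespace SSH

section API
variable (K L : ChainComplex AddCommGrpCat.{0} ℕ)

def Za (k : ℕ) : AddSubgroup (K.X k) := AddMonoidHom.ker (K.d k (k-1)).hom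

def mka (k : ℕ) : Za K k →+ K.homology k :=
  (K.liftCycles (AddCommGrpCat.ofHom (Za K k).subtype) (k-1) (next_eq k) (by
    ext x; exact x.2) ≫ K.homologyπ k).hom

lemma mka_surj (k : ℕ) : Function.Surjective (mka K k) := by
  intro h
  obtain ⟨c, rfl⟩ := (AddCommGrpCat.epi_iff_surjective (K.homologyπ k)).1 inferInstance h
  have hc : K.iCycles k c ∈ Za K k := by
    change (K.iCycles k ≫ K.d k (k-1)) c = 0
    rw [K.iCycles_d]; rfl
  refine ⟨⟨_, hc⟩, ?_⟩
  change K.homologyπ k _ = _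
  congr 1
  apply (AddCommGrpCat.mono_iff_injective (K.iCycles k)).1 inferInstance
  change (K.liftCycles _ _ _ _ ≫ K.iCycles k) _ = _
  rw [K.liftCycles_i]; rfl

lemma mka_eq_zero {k : ℕ} (x : Za K k) : mka K k x = 0 ↔ ∃ y, K.d (k+1) k y = x.1 := by
  constructor
  · intro h
    have ex := ShortComplex.exact_of_g_is_cokernel (ShortComplex.mk (K.toCycles (k+1) k) (K.homologyπ k) (by simp))
      (K.homologyIsCokernel (k+1) k (by simp))
    rw [ShortComplex.ab_exact_iff] at ex
    obtain ⟨y, hy⟩ := ex _ h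
    refine ⟨y, ?_⟩
    have := congrArg (K.iCycles k) hy
    change (K.toCycles _ _ ≫ K.iCycles k) y = (K.liftCycles _ _ _ _ ≫ K.iCycles k) _ at this
    rw [K.liftCycles_i, K.toCycles_i] at this
    exact this
  · rintro ⟨y, hy⟩
    have : K.toCycles (k+1) k y = K.liftCycles (AddCommGrpCat.ofHom (Za K k).subtype) (k-1) (next_eq k) (by
      ext x; exact x.2) x := by
      apply (AddCommGrpCat.mono_iff_injective (K.iCycles k)).1 inferInstance
      change (K.toCycles _ _ ≫ K.iCycles k) y = (K.liftCycles _ _ _ _ ≫ K.iCycles k) _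
      rw [K.liftCycles_i, K.toCycles_i]
      exact hy
    change K.homologyπ k _ = 0
    erw [← this]
    change (K.toCycles (k+1) k ≫ K.homologyπ k) y = 0
    rw [K.toCycles_comp_homologyπ]; rfl

lemma sum_app {A B : AddCommGrpCat.{0}} {m : ℕ} (c : Fin m → ℤ) (f : Fin m → (A ⟶ B)) (x : A) :
    (∑ j, c j • f j) x = ∑ j, c j • f j x := by
  let ev : (A ⟶ B) →+ B := ⟨⟨fun g => g x, rfl⟩, fun _ _ => rfl⟩
  change ev (∑ j, c j • f j) = _
  rw [map_sum]
  exact Finset.sum_congr rfl fun j _ => map_zsmul ev _ _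

variable {K L}
lemma map_Za (φ : K ⟶ L) {k : ℕ} {x : K.X k} (hx : x ∈ Za K k) : φ.f k x ∈ Za L k := by
  change (φ.f k ≫ L.d k (k-1)) x = 0
  rw [φ.comm]
  change φ.f (k-1) (K.d k (k-1) x) = 0
  have : K.d k (k-1) x = 0 := hx
  rw [this, map_zero]

lemma mka_map (φ : K ⟶ L) {k : ℕ} (x : Za K k) :
    HomologicalComplex.homologyMap φ k (mka K k x) = mka L k ⟨φ.f k x.1, map_Za φ x.2⟩ := by
  have h1 : K.liftCycles (AddCommGrpCat.ofHom (Za K k).subtype) (k-1) (next_eq k) (by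
    ext x; exact x.2) ≫ HomologicalComplex.cyclesMap φ k = AddCommGrpCat.ofHom (((φ.f k).hom.comp (Za K k).subtype).codRestrict (Za L k) fun x => map_Za φ x.2) ≫ 
     L.liftCycles (AddCommGrpCat.ofHom (Za L k).subtype) (k-1) (next_eq k) (by
    ext x; exact x.2) := by
    rw [← cancel_mono (L.iCycles k)]
    simp only [Category.assoc, HomologicalComplex.cyclesMap_i, HomologicalComplex.liftCycles_i, HomologicalComplex.liftCycles_i_assoc]
    rfl
  have h2 := congrArg (· ≫ L.homologyπ k) h1
  simp only [Category.assoc, ← HomologicalComplex.homologyπ_naturality] at h2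
  exact ConcreteCategory.congr_hom h2 x
end API

section
variable (X Y : Type) [TopologicalSpace X] [TopologicalSpace Y]

abbrev KX : ChainComplex AddCommGrpCat.{0} ℕ := _root_.singularChainComplexFunctor.obj (TopCat.of X)

abbrev SSX (i : ℕ) : Type := (TopCat.toSSet.obj (TopCat.of X)).obj (Opposite.op (SimplexCategory.mk i))

def eS (i : ℕ) : C(Δ (i+1), X) ≃ SSX X i := (TopCat.toSSetObjEquiv (TopCat.of X) (Opposite.op (SimplexCategory.mk i))).symm

def eK (i : ℕ) : Ch ℤ X (i+1) ≃+ FreeAbelianGroup (SSX X i) :=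
  (Finsupp.domCongr (eS X i)).trans (FreeAbelianGroup.equivFinsupp _).symm

lemma eK_single (i : ℕ) (σ) : eK X i (Finsupp.single σ 1) = FreeAbelianGroup.of (eS X i σ) := by
  simp [eK]

lemma eS_face (i : ℕ) (j : Fin (i+2)) (σ : C(Δ (i+2), X)) :
    (TopCat.toSSet.obj (TopCat.of X)).δ j (eS X (i+1) σ) = eS X i (fc j σ) := by
  rfl

lemma eK_d (i : ℕ) (x : Ch ℤ X (i+2)) : eK X i (dC ℤ X (i+1) x) = (KX X).d (i+1) i (eK X (i+1) x) := by
  have : (eK X i).toAddMonoidHom.comp (dC ℤ X (i+1)).toAddMonoidHom = ((KX X).d (i+1) i).hom.comp (eK X (i+1)).toAddMonoidHom := by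
    refine Finsupp.addHom_ext' fun σ => AddMonoidHom.ext_int ?_
    change eK X i (dC ℤ X (i+1) (Finsupp.single σ 1)) = (KX X).d (i+1) i (eK X (i+1) (Finsupp.single σ 1))
    rw [eK_single, dC_single, map_sum]
    have h1 : (KX X).d (i+1) i = ∑ j : Fin (i+2), (-1 : ℤ)^(j : ℕ) • AddCommGrpCat.free.map ((TopCat.toSSet.obj (TopCat.of X)).δ j) := 
      alternatingFaceMapComplex_obj_d _ _
    have h2 : ∀ s : SSX X (i+1), (KX X).d (i+1) i (FreeAbelianGroup.of s) = ∑ j : Fin (i+2), (-1 : ℤ)^(j : ℕ) • FreeAbelianGroup.of ((TopCat.toSSet.obj (TopCat.of X)).δ j s) := by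
      intro s
      rw [h1]
      exact sum_app _ _ _
    rw [h2]
    refine Finset.sum_congr rfl fun j _ => ?_
    rw [map_zsmul, eK_single, eS_face]
  exact DFunLike.congr_fun this x

lemma eK_map (f : C(X, Y)) (i : ℕ) (x : Ch ℤ X (i+1)) : eK Y i (mC ℤ f (i+1) x) = (_root_.singularChainComplexFunctor.map (TopCat.ofHom f)).f i (eK X i x) := by
  have : (eK Y i).toAddMonoidHom.comp (mC ℤ f (i+1)).toAddMonoidHom = ((_root_.singularChainComplexFunctor.map (TopCat.ofHom f)).f i).hom.comp (eK X i).toAddMonoidHom := by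
    refine Finsupp.addHom_ext' fun σ => AddMonoidHom.ext_int ?_
    change eK Y i (mC ℤ f (i+1) (Finsupp.single σ 1)) = (_root_.singularChainComplexFunctor.map (TopCat.ofHom f)).f i (eK X i (Finsupp.single σ 1))
    rw [eK_single, mC_single, eK_single]
    rfl
  exact DFunLike.congr_fun this x
end
end SSH

namespace SSH

section
variable (X : Type) [TopologicalSpace X]

lemma Za_iff (i : ℕ) (x : Ch ℤ X (i+2)) : eK X (i+1) x ∈ Za (KX X) (i+1) ↔ dC ℤ X (i+1) x = 0 := by
  have h : eK X (i+1) x ∈ Za (KX X) (i+1) ↔ (KX X).d (i+1) i (eK X (i+1) x) = 0 := Iff.rfl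
  rw [h]
  constructor
  · intro h
    exact (eK X i).map_eq_zero_iff.1 ((eK_d X i x).trans h)
  · intro h
    exact (eK_d X i x).symm.trans ((congrArg (eK X i) h).trans (map_zero _))

lemma Za_zero (x) : x ∈ Za (KX X) 0 := by
  have : (KX X).d 0 (0-1) = 0 := (KX X).shape _ _ (by simp)
  rw [Za, this]; rfl

lemma Zd_Za {i : ℕ} {x : Ch ℤ X (i+1)} (hx : x ∈ Zd ℤ X (i+1)) : eK X i x ∈ Za (KX X) i := by
  cases i with
  | zero => exact Za_zero X _
  | succ i => exact (Za_iff X i x).2 hx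

def pt : C(X, PUnit) := ContinuousMap.const X PUnit.unit

lemma pt_exact {k : ℕ} (x : Ch ℤ PUnit k) (hx : x ∈ Zd ℤ PUnit k) : ∃ y, dC ℤ PUnit k y = x := by
  have h : Acy ℤ PUnit := Acy_unit
  have := h k
  exact (cl_eq_zero ℤ PUnit ⟨x, hx⟩).1 (Subsingleton.elim _ _)

lemma mem_red {i : ℕ} (x : Ch ℤ X (i+1)) (hx : eK X i x ∈ Za (KX X) i) :
    mka (KX X) i ⟨eK X i x, hx⟩ ∈ ReducedHomology X i ↔ x ∈ Zd ℤ X (i+1) := by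
  have h1 : mka (KX X) i ⟨eK X i x, hx⟩ ∈ ReducedHomology X i ↔
     HomologicalComplex.homologyMap (_root_.singularChainComplexFunctor.map (TopCat.ofHom (pt X))) i (mka (KX X) i ⟨eK X i x, hx⟩) = 0 := Iff.rfl
  rw [h1, mka_map, mka_eq_zero]
  have h2 : (∃ y, (KX PUnit).d (i+1) i y = (_root_.singularChainComplexFunctor.map (TopCat.ofHom (pt X))).f i (eK X i x)) ↔
    ∃ y, dC ℤ PUnit (i+1) y = mC ℤ (pt X) (i+1) x := by
    constructor
    · rintro ⟨y, hy⟩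
      refine ⟨(eK PUnit (i+1)).symm y, (eK PUnit i).injective ?_⟩
      refine (eK_d _ _ _).trans (Eq.trans ?_ (eK_map _ _ _ _ _).symm)
      exact (congrArg ((KX PUnit).d (i+1) i) ((eK PUnit (i+1)).apply_symm_apply y)).trans hy
    · rintro ⟨y, hy⟩
      exact ⟨eK PUnit (i+1) y, (eK_d _ _ _).symm.trans ((congrArg (eK PUnit i) hy).trans (eK_map _ _ _ _ _))⟩
  refine h2.trans ?_
  change _ ↔ dC ℤ X i x = 0
  constructor
  · rintro ⟨y, hy⟩
    cases i with
    | succ i => exact (Za_iff X i x).1 hx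
    | zero =>
      have h3 : mC ℤ (pt X) 0 (dC ℤ X 0 x) = 0 := by
        rw [mC_dC', ← hy, dC_dC']
      have hinj : Function.Injective (mC ℤ (pt X) 0) := by
        refine Finsupp.mapDomain_injective ?_
        intro a b _
        ext t
        exact (absurd t.2.2 (by simp))
      exact hinj (h3.trans (map_zero _).symm)
  · intro h
    refine pt_exact _ ?_
    change dC ℤ PUnit i _ = 0
    rw [← mC_dC', h, map_zero]

def cR (i : ℕ) : Zd ℤ X (i+1) →+ ReducedHomology X i where
  toFun x := ⟨mka (KX X) i ⟨eK X i x.1, Zd_Za X x.2⟩, (mem_red X _ _).2 x.2⟩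
  map_zero' := by
    ext1
    refine Eq.trans (congrArg (mka (KX X) i) ?_) (map_zero (mka (KX X) i))
    ext1
    exact map_zero (eK X i)
  map_add' x y := by
    ext1
    refine Eq.trans (congrArg (mka (KX X) i) ?_) (map_add (mka (KX X) i) _ _)
    ext1
    exact map_add (eK X i) x.1 y.1

lemma cR_surj (i : ℕ) : Function.Surjective (cR X i) := by
  rintro ⟨h, hh⟩
  obtain ⟨⟨x, hx⟩, rfl⟩ := mka_surj (KX X) i h
  obtain ⟨x, rfl⟩ := (eK X i).surjective x
  exact ⟨⟨x, (mem_red X _ _).1 hh⟩, rfl⟩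

lemma cR_zero (i : ℕ) (x) : cR X i x = 0 ↔ ∃ y, dC ℤ X (i+1) y = x.1 := by
  have h1 : cR X i x = 0 ↔ mka (KX X) i ⟨eK X i x.1, Zd_Za X x.2⟩ = 0 := Subtype.ext_iff
  rw [h1, mka_eq_zero]
  constructor
  · rintro ⟨y, hy⟩
    refine ⟨(eK X (i+1)).symm y, (eK X i).injective ?_⟩
    refine (eK_d _ _ _).trans ?_
    exact (congrArg ((KX X).d (i+1) i) ((eK X (i+1)).apply_symm_apply y)).trans hy
  · rintro ⟨y, hy⟩
    exact ⟨eK X (i+1) y, (eK_d _ _ _).symm.trans (congrArg (eK X i) hy)⟩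
end
end SSH

namespace SSH

section
variable {n r : ℕ} {z : Fin r → Fin n → ℤ}

lemma single_top {P : Submodule ℚ (Fin r → ℚ)} (h : ∀ i, Pi.single i 1 ∈ P) : P = ⊤ := by
  rw [eq_top_iff]
  intro v _
  have : v = ∑ i, v i • (Pi.single i (1:ℚ) : Fin r → ℚ) := by
    ext i; simp [Finset.sum_apply, Pi.single_apply]
  rw [this]
  exact Submodule.sum_mem _ fun i _ => Submodule.smul_mem _ _ (h i)

lemma sp_univ (heff : Submodule.span ℤ (Set.range fun j => fun i => z i j) = ⊤) : sp z Finset.univ = ⊤ := by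
  have h : ∀ v ∈ Submodule.span ℤ (Set.range fun j => fun i => z i j), (fun i => (v i : ℚ)) ∈ sp z Finset.univ := by
    intro v hv
    induction hv using Submodule.span_induction with
    | mem v hv =>
      obtain ⟨j, rfl⟩ := hv
      exact cq_mem (Finset.mem_univ j)
    | zero =>
      have := (sp z Finset.univ).zero_mem
      convert this using 1
      ext i; simp
    | add a b _ _ ha hb =>
      have := (sp z Finset.univ).add_mem ha hb
      convert this using 1
      ext i; simp
    | smul c a _ ha =>
      have := (sp z Finset.univ).smul_mem (c : ℚ) ha
      convert this using 1
      ext i; simp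
  refine single_top fun i => ?_
  have := h (Pi.single i 1) (by rw [heff]; trivial)
  convert this using 1
  ext k
  by_cases hk : k = i
  · subst hk; simp
  · simp [Pi.single_apply, hk]

lemma sp_top_iff (S : Finset (Fin n)) : sp z S = ⊤ ↔ r ≤ rk z S := by
  constructor
  · intro h
    rw [rk, h]; simp
  · intro h
    refine Submodule.eq_top_of_finrank_eq ?_
    have := rk_le_r (z := z) S
    rw [rk] at *
    simp; omega

lemma roots_fin (m : ℕ) (hm : m ≠ 0) : {u : Circle | u ^ m = 1}.Finite := by
  refine Set.Finite.of_finite_image (f := fun u : Circle => (u : ℂ)) ?_ (Circle.coe_injective.injOn)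
  refine (Polynomial.nthRoots m (1 : ℂ)).toFinset.finite_toSet.subset ?_
  rintro _ ⟨u, hu, rfl⟩
  have hu : u ^ m = 1 := hu
  simp only [Finset.mem_coe, Multiset.mem_toFinset, Polynomial.mem_nthRoots (Nat.pos_of_ne_zero hm)]
  rw [← Circle.coe_pow, hu]; rfl

lemma ker_fin {S : Finset (Fin n)} (h : sp z S = ⊤) : {t : Fin r → Circle | ∀ j ∈ S, weightProd z t j = 1}.Finite := by
  have key : ∀ i : Fin r, ∃ m : ℕ, m ≠ 0 ∧ ∀ t : Fin r → Circle, (∀ j ∈ S, weightProd z t j = 1) → t i ^ m = 1 := by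
    intro i
    have hi : (Pi.single i 1 : Fin r → ℚ) ∈ sp z S := by rw [h]; trivial
    obtain ⟨c, hc⟩ := (Submodule.mem_span_image_finset_iff_exists_fun ℚ).1 hi
    obtain ⟨b, hb⟩ := IsLocalization.exist_integer_multiples_of_finite (nonZeroDivisors ℤ) (fun j : Fin n => if hj : j ∈ S then c ⟨j, hj⟩ else 0)
    choose φ hφ using hb
    have hb0 : (b : ℤ) ≠ 0 := nonZeroDivisors.ne_zero b.2
    have hs : ∀ k, ∑ j ∈ S, φ j * z k j = if k = i then (b : ℤ) else 0 := by
      intro k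
      have h1 := congrFun hc k
      rw [Finset.sum_apply] at h1
      have h2 : ∀ j : S, (φ j : ℚ) = (b : ℤ) * c j := by
        intro j
        have := hφ j
        simpa using this
      have h3 : ((∑ j ∈ S, φ j * z k j : ℤ) : ℚ) = (b : ℤ) * (Pi.single i (1:ℚ) : Fin r → ℚ) k := by
        rw [← h1, Finset.mul_sum, ← Finset.sum_coe_sort]
        push_cast
        refine Finset.sum_congr rfl fun j _ => ?_
        rw [h2]; simp [cq, mul_assoc]
      rw [Pi.single_apply] at h3
      split_ifs with hk
      · rw [if_pos hk, mul_one] at h3; exact_mod_cast h3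
      · rw [if_neg hk, mul_zero] at h3; exact_mod_cast h3
    refine ⟨(b : ℤ).natAbs, Int.natAbs_ne_zero.2 hb0, fun t ht => ?_⟩
    have hz : t i ^ (b : ℤ) = 1 := by
      have h4 : ∏ j ∈ S, weightProd z t j ^ φ j = 1 := Finset.prod_eq_one fun j hj => by rw [ht j hj, one_zpow]
      have key : ∀ (v : Circle) (s : Finset (Fin n)) (f : Fin n → ℤ), v ^ (∑ i ∈ s, f i) = ∏ i ∈ s, v ^ f i := by
        intro v s f
        induction s using Finset.induction_on with
        | empty => simp
        | insert a s ha ih => rw [Finset.sum_insert ha, Finset.prod_insert ha, zpow_add, ih]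
      have h5 : ∏ j ∈ S, weightProd z t j ^ φ j = ∏ k, t k ^ (∑ j ∈ S, φ j * z k j) := by
        simp_rw [key, weightProd, ← Finset.prod_zpow]
        rw [Finset.prod_comm]
        refine Finset.prod_congr rfl fun k _ => Finset.prod_congr rfl fun j _ => ?_
        rw [← zpow_mul, mul_comm]
      rw [← h4, h5]
      simp_rw [hs]
      rw [Finset.prod_eq_single i]
      · simp
      · intro k _ hk; simp [hk]
      · simp
    rcases Int.natAbs_eq (b : ℤ) with h' | h'
    · rw [h', zpow_natCast] at hz; exact hz
    · rw [h', zpow_neg, zpow_natCast, inv_eq_one] at hz; exact hz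
  choose m hm hm' using key
  refine (Set.Finite.pi' fun i => roots_fin (m i) (hm i)).subset ?_
  intro t ht i
  exact hm' i t ht

def sv (x : Sph n) : Fin n → ℂ := fun j => (x : EuclideanSpace ℂ (Fin n)) j

lemma sv_cont : Continuous (sv (n := n)) := by
  unfold sv; fun_prop

lemma stab_eq (x : Sph n) : torusStab z x = {t | ∀ j ∈ sup (pq z (sv x)), weightProd z t j = 1} := by
  ext t
  refine forall_congr' fun j => ?_
  rw [mem_sup, ab_pq, norm_ne_zero_iff]
  change _ * sv x j = sv x j ↔ _
  constructor
  · intro h hx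
    have := mul_right_cancel₀ hx (h.trans (one_mul _).symm)
    exact Circle.coe_injective (this.trans Circle.coe_one.symm)
  · intro h
    by_cases hx : sv x j = 0
    · simp [hx]
    · simp [h hx]

lemma stab_inf (heff : Submodule.span ℤ (Set.range fun j => fun i => z i j) = ⊤) (x : Sph n) :
    (torusStab z x).Infinite ↔ rk z (sup (pq z (sv x))) < r := by
  rw [stab_eq]
  set S := sup (pq z (sv x))
  constructor
  · intro h
    by_contra! h'
    exact h (ker_fin ((sp_top_iff S).2 h'))
  · intro h
    have : ∃ k, cq z k ∉ sp z S := by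
      by_contra! h'
      have h1 : sp z Finset.univ ≤ sp z S := by
        refine Submodule.span_le.2 ?_
        rintro _ ⟨k, _, rfl⟩
        exact h' k
      rw [sp_univ heff, top_le_iff, sp_top_iff] at h1
      omega
    obtain ⟨k, hk⟩ := this
    choose t ht1 ht2 using fun u => exists_rot hk u
    have hinf : Infinite Circle := by
      have := (Set.Ioc_infinite (a := -Real.pi) (b := Real.pi) (by linarith [Real.pi_pos])).to_subtype
      refine Infinite.of_injective (fun t : Set.Ioc (-Real.pi) Real.pi => Circle.exp t) ?_
      · intro a b hab
        have h1 := Circle.arg_exp a.2.1 a.2.2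
        have h2 := Circle.arg_exp b.2.1 b.2.2
        ext1
        rw [← h1, ← h2]
        exact congrArg (fun u : Circle => Complex.arg u) hab
    refine Set.infinite_of_injective_forall_mem (f := t) ?_ fun u => ht1 u
    intro u v huv
    rw [← ht2 u, ← ht2 v, huv]

def oq (z : Fin r → Fin n → ℤ) : OrbitSpace z → QQ z :=
  Quotient.lift (s := orbitSetoid z) (fun x => pq z (sv x)) fun x y h => pq_eq.2 h

lemma oq_emb : Topology.IsClosedEmbedding (oq z) := by
  refine Continuous.isClosedEmbedding ?_ ?_
  · exact Continuous.quotient_lift (pq_cont.comp sv_cont) _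
  · intro a b hab
    induction a using Quotient.inductionOn
    induction b using Quotient.inductionOn
    exact Quotient.sound (pq_eq.1 hab)

abbrev PP1 (z : Fin r → Fin n → ℤ) : Set (QQ z) := SF z (WW z ∅ Finset.univ (r-1))
def PP0 (z : Fin r → Fin n → ℤ) : Set (QQ z) := {q | q ∈ PP1 z ∧ ∑ j, ab q j ^ 2 = 1}

lemma PP0_sub : PP0 z ⊆ PP1 z := fun _ h => h.1

lemma nn_pos {q : QQ z} (h : q ∈ PP1 z) : 0 < ∑ j, ab q j ^ 2 := by
  have : sup q ≠ ∅ := h.2.2.1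
  obtain ⟨j, hj⟩ := Finset.nonempty_iff_ne_empty.2 this
  rw [mem_sup] at hj
  exact Finset.sum_pos' (fun _ _ => sq_nonneg _) ⟨j, Finset.mem_univ _, by positivity⟩

lemma norm_qi {R : Type} [CommRing R] : QI R (inc (PP0_sub (z := z))) := by
  let N : QQ z → ℝ := fun q => Real.sqrt (∑ j, ab q j ^ 2)
  have hN : ∀ q ∈ PP1 z, 0 < N q := fun q h => Real.sqrt_pos.2 (nn_pos h)
  have hpos : ∀ (s : unitInterval), ∀ q ∈ PP1 z, 0 < (1 - s.1) + s.1 * (N q)⁻¹ := by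
    intro s q hq
    have := inv_pos.2 (hN q hq)
    rcases eq_or_lt_of_le s.2.2 with h | h
    · rw [h]; simpa using this
    · have := mul_nonneg s.2.1 this.le
      linarith
  have hsup : ∀ (s : unitInterval), ∀ q ∈ PP1 z, sc ((fun _ => (1 - s.1) + s.1 * (N q)⁻¹), q) ∈ PP1 z := by
    intro s q hq
    have : sup (sc ((fun _ => (1 - s.1) + s.1 * (N q)⁻¹), q)) = sup q := by
      ext j
      rw [mem_sup_sc]
      exact and_iff_right (hpos s q hq).ne'
    change sup _ ∈ WW z ∅ Finset.univ (r-1)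
    rw [this]; exact hq
  refine deform_sc _ (fun s q _ => (1 - s.1) + s.1 * (N q)⁻¹) ?_ ?_ hsup ?_ ?_
  · refine continuous_pi fun _ => ?_
    have h1 : Continuous fun x : unitInterval × PP1 z => (N x.2.1)⁻¹ :=
      Continuous.inv₀ (by simp only [N]; fun_prop) fun x => (hN _ x.2.2).ne'
    fun_prop
  · intro q _; ext j; simp
  · intro q hq
    refine ⟨hsup 1 q hq, ?_⟩
    have h1 := nn_pos hq
    simp_rw [ab_sc, mul_pow, ← Finset.mul_sum]
    simp only [Set.Icc.coe_one, sub_self, zero_add, one_mul, sq_abs, inv_pow, N]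
    rw [Real.sq_sqrt h1.le, inv_mul_cancel₀ h1.ne']
  · intro s q hq
    have : N q = 1 := by simp only [N]; rw [hq.2, Real.sqrt_one]
    have h2 : (fun _ : Fin n => (1 - s.1) + s.1 * (N q)⁻¹) = 1 := by ext j; simp [this]
    rw [h2, sc_one]; exact hq

lemma oq_image (hr : 2 ≤ r) (heff : Submodule.span ℤ (Set.range fun j => fun i => z i j) = ⊤) : oq z '' singSet z = PP0 z := by
  have key : ∀ x : Sph n, ∑ j, ‖sv x j‖ ^ 2 = 1 := by
    intro x
    have := x.2
    rw [mem_sphere_zero_iff_norm, EuclideanSpace.norm_eq, Real.sqrt_eq_one] at this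
    exact this
  ext q
  constructor
  · rintro ⟨_, ⟨x, hx, rfl⟩, rfl⟩
    have h1 := (stab_inf heff x).1 hx
    have h2 : ∑ j, ab (pq z (sv x)) j ^ 2 = 1 := by simp_rw [ab_pq]; exact key x
    refine ⟨⟨Finset.empty_subset _, Finset.subset_univ _, ?_, by change rk z (sup (pq z (sv x))) ≤ _; omega⟩, h2⟩
    intro h
    have h : sup (pq z (sv x)) = ∅ := h
    have h3 : ∀ j, ab (pq z (sv x)) j = 0 := by
      intro j
      by_contra h'
      have := mem_sup.2 h'
      rw [h] at this
      simp at this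
    simp [h3] at h2
  · rintro ⟨⟨_, _, _, h⟩, h2⟩
    obtain ⟨x, rfl⟩ := pq_surj q
    have hx : (WithLp.toLp 2 x : EuclideanSpace ℂ (Fin n)) ∈ Metric.sphere (0 : EuclideanSpace ℂ (Fin n)) 1 := by
      rw [mem_sphere_zero_iff_norm, EuclideanSpace.norm_eq, Real.sqrt_eq_one]
      simpa using h2
    refine ⟨_, ⟨⟨_, hx⟩, (stab_inf heff _).2 ?_, rfl⟩, rfl⟩
    change rk z (sup (pq z x)) < r
    omega

lemma sing_qi (R : Type) [CommRing R] (hr : 2 ≤ r) (heff : Submodule.span ℤ (Set.range fun j => fun i => z i j) = ⊤) :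
    ∃ f : C(singSet z, PP1 z), QI R f := by
  let e : singSet z ≃ₜ PP0 z := ((oq_emb (z := z)).isEmbedding.homeomorphImage (singSet z)).trans (Homeomorph.setCongr (oq_image hr heff))
  exact ⟨_, QI_comp R (QI_homeo (R := R) e) (norm_qi (z := z) (R := R))⟩

end
end SSH

namespace SSH
section
variable {n r : ℕ} {z : Fin r → Fin n → ℤ}

open Polynomial in
lemma poly_id (hr : 2 ≤ r) : PP z ∅ Finset.univ (r-1) = X * (X ^ (r - 2) *
          ((∑ A ∈ Finset.univ.filter (fun A : Finset (Fin n) => colRank z ↑A = r),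
              (X ^ 2 - 1) ^ (A.card - r)) -
            ∑ A : Finset (Fin n),
              (-1 : Polynomial ℤ) ^ (r - colRank z ↑A) *
                (X ^ 2 - 1) ^ (A.card - colRank z ↑A))) := by
  have h1 : expand ℤ 2 (QP z ∅ Finset.univ (r-1)) = ((∑ A ∈ Finset.univ.filter (fun A : Finset (Fin n) => colRank z ↑A = r),
              (X ^ 2 - 1) ^ (A.card - r)) -
            ∑ A : Finset (Fin n),
              (-1 : Polynomial ℤ) ^ (r - colRank z ↑A) *
                (X ^ 2 - 1) ^ (A.card - colRank z ↑A)) := by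
    have hI : Finset.Icc (∅ : Finset (Fin n)) Finset.univ = Finset.univ := by ext; simp
    rw [QP, hI, map_sum, Finset.sum_filter, ← Finset.sum_sub_distrib]
    refine Finset.sum_congr rfl fun A _ => ?_
    rw [colRank_eq, tm]
    have := rk_le_r (z := z) A
    by_cases h : rk z A = r
    · rw [if_neg (by omega), if_pos h, h]; simp
    · have h2 : r - rk z A = (r - 1 - rk z A) + 1 := by omega
      rw [if_pos (by omega), if_neg h, h2, pow_succ]
      simp
  rw [PP, h1, ← mul_assoc, ← pow_succ']
  congr 2
  simp; omega

theorem main (hr : 2 ≤ r) (heff : Submodule.span ℤ (Set.range fun j => fun i => z i j) = ⊤) (i : ℕ) :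
    Module.Free ℤ (ReducedHomology (singSet z) i) ∧ Module.Finite ℤ (ReducedHomology (singSet z) i) ∧
    (Module.finrank ℤ (ReducedHomology (singSet z) i) : ℤ) = (PP z ∅ Finset.univ (r-1)).coeff (i+1) := by
  have hrk : r - 1 ≤ rk z Finset.univ := by
    have := (sp_top_iff _).1 (sp_univ heff)
    omega
  have hm : ∀ (p : ℕ) [Fact p.Prime], FG (ZMod p) (singSet z) ∧ ∀ k, (hd (ZMod p) (singSet z) k : ℤ) = (PP z ∅ Finset.univ (r-1)).coeff k := by
    intro p _
    obtain ⟨f, hf⟩ := sing_qi (ZMod p) hr heff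
    obtain ⟨h1, h2⟩ := main_modp (p := p) (z := z) _ ∅ Finset.univ (r-1) le_rfl (Finset.empty_subset _) (psat_empty _) (by simp) hrk
    refine ⟨hf.fg_iff.2 h1, fun k => ?_⟩
    rw [hf.hd_eq]; exact h2 k
  have hZ : FG ℤ (singSet z) := by
    obtain ⟨f, hf⟩ := sing_qi ℤ hr heff
    exact hf.fg_iff.2 (FG_WW _)
  have : Fact (Nat.Prime 2) := ⟨Nat.prime_two⟩
  obtain ⟨h1, h2, h3⟩ := uct (X := singSet z) (fun k => hd (ZMod 2) (singSet z) k) (r-1) (by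
    intro k hk
    have h := (hm 2).2 k
    rw [PP_par (by simpa using hk)] at h
    exact_mod_cast h) hZ (fun p _ => (hm p).1) (by
    intro p _ k
    have := ((hm p).2 k).trans ((hm 2).2 k).symm
    exact_mod_cast this) (i+1) (cR (singSet z) i) (cR_surj _ i) (cR_zero _ i)
  exact ⟨h1, h2, by rw [h3]; exact (hm 2).2 _⟩
end
end SSH

/-- Suppose `r ≥ 2` and the action is effective.  Then the reduced
integral singular homology groups of the rational singular set `𝒮 ⊆ X_z` are finitely
generated free abelian, and their ranks are given by the coefficients of
`t^(r-2) * (T(M_z; 1, t²) - T(M_z; 0, t²))`, written via the corank–nullity expansion of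
the Tutte polynomial. -/
theorem singular_set_reduced_homology (n r : ℕ) (hn : 1 ≤ n) (hr : 2 ≤ r)
    (z : Fin r → Fin n → ℤ)
    (heff : Submodule.span ℤ (Set.range fun j => fun i => z i j) = ⊤) :
    (∀ i : ℕ, Module.Free ℤ (ReducedHomology (singSet z) i) ∧
        Module.Finite ℤ (ReducedHomology (singSet z) i)) ∧
    (∀ i : ℕ,
      (Module.finrank ℤ (ReducedHomology (singSet z) i) : ℤ) =
        (Polynomial.X ^ (r - 2) *
          ((∑ A ∈ Finset.univ.filter (fun A : Finset (Fin n) => colRank z ↑A = r),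
              (Polynomial.X ^ 2 - 1) ^ (A.card - r)) -
            ∑ A : Finset (Fin n),
              (-1 : Polynomial ℤ) ^ (r - colRank z ↑A) *
                (Polynomial.X ^ 2 - 1) ^ (A.card - colRank z ↑A))).coeff i) := by
  refine ⟨fun i => ⟨(SSH.main hr heff i).1, (SSH.main hr heff i).2.1⟩, fun i => ?_⟩
  rw [(SSH.main hr heff i).2.2, SSH.poly_id hr, Polynomial.coeff_X_mul]
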